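/- Let p₁ ≡ 3 (mod 8) be a prime with p₁ ≠ 3, let m ≥ 1, and set N = 2p₁^m. Let h be the class number of Q(√(−p₁)), and assume 1 + p₁ = 4p^h, where p is a prime with p ≡ 3 (mod 4) and ord_N(p) = φ(N)/2. Let f = ord_N(p) and q = p^f. Let J ⊆ Z_{2p₁} be J = ⟨p⟩ ∪ 2⟨p⟩ ∪ {0}, where ⟨p⟩ is the subgroup of Z_{2p₁}^* generated by p. Then there exists a primitive element γ of F_q such that, with C_i = γ^i⟨γ^N⟩ the cyclotomic classes of order N, the set D = ⋃_{i=0}^{p₁^{m−1}−1} ⋃_{j∈J} C_{2i + p₁^{m−1}j} is a skew Hadamard difference set in the additive group of F_q. -/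

import Mathlib

open scoped Classical

/-- The cyclotomic class `C_i = γ^i ⟨γ^N⟩ = {γ^{i+Nk} : k ∈ ℤ}` of order `N` of a finite
field, with respect to the primitive element `γ`. -/
def cycClass {F : Type*} [Field F] (γ : Fˣ) (N i : ℕ) : Set F :=
  {x : F | ∃ k : ℤ, x = ((γ ^ ((i : ℤ) + (N : ℤ) * k) : Fˣ) : F)}

/-- `D` is a skew Hadamard difference set in `(G, +)`: it is a difference set
(every nonzero `g` has the same number of representations `g = d₁ - d₂` with
`d₁, d₂ ∈ D`) and `G` is the disjoint union of `D`, `-D` and `{0}`. -/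
def IsSkewHadamardDifferenceSet {G : Type*} [AddCommGroup G] (D : Set G) : Prop :=
  (0 : G) ∉ D ∧ (∀ g : G, g ≠ 0 → (g ∈ D ↔ -g ∉ D)) ∧
    ∃ l : ℕ, ∀ g : G, g ≠ 0 →
      Nat.card {x : G × G // x.1 ∈ D ∧ x.2 ∈ D ∧ x.1 - x.2 = g} = l

section Helpers
open NumberField

section A1
variable {K : Type*} [Field K] [NumberField K] {p₁ : ℕ} {α : K}

lemma a1_minpoly (hp₁ : p₁.Prime) (hα : α ^ 2 = -(p₁ : K)) :
    minpoly ℚ α = Polynomial.X ^ 2 + Polynomial.C (p₁ : ℚ) := by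
  have hirr : Irreducible (Polynomial.X ^ 2 + Polynomial.C (p₁ : ℚ)) := by
    apply Polynomial.irreducible_of_degree_le_three_of_not_isRoot
    · rw [Polynomial.natDegree_X_pow_add_C]; decide
    · intro x hx
      simp [Polynomial.IsRoot] at hx
      have : (0 : ℚ) < p₁ := by exact_mod_cast hp₁.pos
      nlinarith [sq_nonneg x]
  symm
  apply minpoly.eq_of_irreducible_of_monic hirr
  · simp [hα]
  · exact Polynomial.monic_X_pow_add_C _ (by norm_num)

lemma a1_finrank (hp₁ : p₁.Prime) (hα : α ^ 2 = -(p₁ : K)) (hKα : Algebra.adjoin ℚ {α} = ⊤) :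
    Module.finrank ℚ K = 2 := by
  have hIntg : IsIntegral ℚ α := Algebra.IsIntegral.isIntegral α
  have htop : IntermediateField.adjoin ℚ {α} = ⊤ := by
    rw [← top_le_iff]
    intro x _
    have : x ∈ Algebra.adjoin ℚ {α} := by rw [hKα]; trivial
    exact IntermediateField.algebra_adjoin_le_adjoin ℚ {α} this
  have hmin := a1_minpoly hp₁ hα
  have h1 := IntermediateField.adjoin.finrank hIntg
  rw [hmin, Polynomial.natDegree_X_pow_add_C, htop] at h1
  rw [← h1]
  exact (IntermediateField.finrank_top' (F := ℚ) (E := K)).symm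

lemma a1_exists_int (hα : α ^ 2 = -(p₁ : K)) : ∃ a : 𝓞 K, algebraMap (𝓞 K) K a = α ∧ a ^ 2 = -(p₁ : 𝓞 K) := by
  have hIntg : IsIntegral ℤ α := by
    refine ⟨Polynomial.X ^ 2 + Polynomial.C (p₁ : ℤ), Polynomial.monic_X_pow_add_C _ (by norm_num), ?_⟩
    simp [hα]
  obtain ⟨a, ha⟩ : ∃ a : 𝓞 K, algebraMap (𝓞 K) K a = α :=
    (IsIntegralClosure.isIntegral_iff (A := 𝓞 K)).mp hIntg
  refine ⟨a, ha, ?_⟩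
  apply RingOfIntegers.coe_injective
  rw [map_pow, map_neg, map_natCast, ha]
  exact hα

lemma a1_finrankZ (h2 : Module.finrank ℚ K = 2) : Module.finrank ℤ (𝓞 K) = 2 := by
  rw [← h2, RingOfIntegers.rank]

lemma a1_norm_sqrt (h2 : Module.finrank ℚ K = 2) {a : 𝓞 K} (ha : a ^ 2 = -(p₁ : 𝓞 K)) :
    Ideal.absNorm (Ideal.span {a}) = p₁ := by
  have h1 : Ideal.absNorm (Ideal.span {a}) ^ 2 = p₁ ^ 2 := by
    rw [← map_pow, Ideal.span_singleton_pow, ha, Ideal.span_singleton_neg,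
      Ideal.absNorm_span_natCast, a1_finrankZ h2]
  exact Nat.pow_left_injective (n := 2) (by norm_num) h1

lemma a1_discr (hp₁ : p₁.Prime) (h2 : Module.finrank ℚ K = 2) {a : 𝓞 K} (ha : a ^ 2 = -(p₁ : 𝓞 K)) :
    (p₁ : ℤ) ≤ |discr K| := by
  have hpi : Prime (p₁ : ℤ) := Nat.prime_iff_prime_int.mp hp₁
  have : (Ideal.span {(p₁ : ℤ)}).IsMaximal :=
    PrincipalIdealRing.isMaximal_of_irreducible hpi.irreducible
  have h := pow_sub_one_dvd_differentIdeal (A := ℤ) (B := 𝓞 K) (p := Ideal.span {(p₁ : ℤ)})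
    (Ideal.span {a}) 2 (by simpa using hp₁.ne_zero) (by
      rw [Ideal.map_span, Ideal.span_singleton_pow, ha, Ideal.span_singleton_neg]
      simp)
  rw [show 2 - 1 = 1 from rfl, pow_one] at h
  have h3 := Ideal.absNorm_dvd_absNorm_of_le (Ideal.dvd_iff_le.mp h)
  rw [a1_norm_sqrt h2 ha, NumberField.absNorm_differentIdeal K (𝓞 K)] at h3
  have := Nat.le_of_dvd (Int.natAbs_pos.mpr (discr_ne_zero K)) h3
  rw [Int.abs_eq_natAbs]; exact_mod_cast this

lemma a1_places (hp₁ : p₁.Prime) (h2 : Module.finrank ℚ K = 2) (hα : α ^ 2 = -(p₁ : K)) :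
    InfinitePlace.nrRealPlaces K = 0 ∧ InfinitePlace.nrComplexPlaces K = 1 := by
  have h0 : InfinitePlace.nrRealPlaces K = 0 := by
    rw [InfinitePlace.nrRealPlaces, Fintype.card_eq_zero_iff]
    constructor
    rintro ⟨w, hw⟩
    have h3 := congrArg (InfinitePlace.embedding_of_isReal hw) hα
    simp only [map_pow, map_neg, map_natCast] at h3
    have : (0 : ℝ) < p₁ := by exact_mod_cast hp₁.pos
    nlinarith [sq_nonneg (InfinitePlace.embedding_of_isReal hw α)]
  have := InfinitePlace.card_add_two_mul_card_eq_rank K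
  omega

lemma a1_reg (hr : InfinitePlace.nrRealPlaces K = 0) (hc : InfinitePlace.nrComplexPlaces K = 1) :
    Units.regulator K = 1 := by
  have hcard : Fintype.card (InfinitePlace K) = 1 := by
    rw [InfinitePlace.card_eq_nrRealPlaces_add_nrComplexPlaces]; omega
  have hrank : Units.rank K = 0 := by rw [Units.rank, hcard]
  obtain ⟨w⟩ : Nonempty (InfinitePlace K) := inferInstance
  have : Subsingleton (InfinitePlace K) := Fintype.card_le_one_iff_subsingleton.mp hcard.le
  have : IsEmpty {w' : InfinitePlace K // w' ≠ w} := ⟨fun x => x.2 (Subsingleton.elim _ _)⟩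
  have : IsEmpty (Fin (Units.rank K)) := by rw [hrank]; infer_instance
  rw [Units.regulator_eq_det K w (Equiv.equivOfIsEmpty _ _)]
  simp

lemma a1_residue (hp₁ : p₁.Prime) (h2 : Module.finrank ℚ K = 2) (hα : α ^ 2 = -(p₁ : K)) :
    dedekindZeta_residue K * Real.sqrt p₁ ≤ Real.pi * classNumber K := by
  obtain ⟨hr, hc⟩ := a1_places hp₁ h2 hα
  obtain ⟨a, -, ha⟩ := a1_exists_int hα
  have hd := a1_discr hp₁ h2 ha
  rw [dedekindZeta_residue_def, hr, hc, a1_reg hr hc]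
  have hw : (2 : ℝ) ≤ Units.torsionOrder K := by
    have h1 := Units.even_torsionOrder K
    have h3 := Units.torsionOrder_pos K
    obtain ⟨k, hk⟩ := h1
    exact_mod_cast (by omega : 2 ≤ Units.torsionOrder K)
  have hs : Real.sqrt p₁ ≤ Real.sqrt |(discr K : ℝ)| := by
    apply Real.sqrt_le_sqrt
    exact_mod_cast hd
  have hsp : 0 < Real.sqrt p₁ := Real.sqrt_pos.mpr (by exact_mod_cast hp₁.pos)
  have hC : (0 : ℝ) ≤ classNumber K := by positivity
  rw [div_mul_eq_mul_div, div_le_iff₀ (mul_pos (by linarith) (lt_of_lt_of_le hsp (by exact_mod_cast hs)))]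
  have : 2 * Real.sqrt p₁ ≤ Units.torsionOrder K * Real.sqrt |(discr K : ℝ)| :=
    mul_le_mul hw hs hsp.le (by positivity)
  calc _ = (Real.pi * classNumber K) * (2 * Real.sqrt p₁) := by ring
    _ ≤ _ := mul_le_mul_of_nonneg_left this (by positivity)
end A1

section A2
variable {K : Type*} [Field K] [NumberField K] {p₁ : ℕ} {α : K}

/-- number of ideals of norm `n` -/
noncomputable def idCnt (K : Type*) [Field K] [NumberField K] (n : ℕ) : ℕ :=
  Nat.card {I : Ideal (𝓞 K) // Ideal.absNorm I = n}

lemma idCnt_finite (n : ℕ) : Finite {I : Ideal (𝓞 K) // Ideal.absNorm I = n} :=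
  Ideal.finite_setOfPred_absNorm_eq n

lemma ideal_coprime_of_norm {I J : Ideal (𝓞 K)} {m n : ℕ} (hI : Ideal.absNorm I = m)
    (hJ : Ideal.absNorm J = n) (h : m.Coprime n) : IsCoprime I J := by
  rw [Ideal.isCoprime_iff_sup_eq, Ideal.eq_top_iff_one]
  have h1 : ((m : ℕ) : 𝓞 K) ∈ I := hI ▸ Ideal.absNorm_mem I
  have h2 : ((n : ℕ) : 𝓞 K) ∈ J := hJ ▸ Ideal.absNorm_mem J
  obtain ⟨u, v, huv⟩ := (Nat.isCoprime_iff_coprime.mpr h)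
  have : (1 : 𝓞 K) = (u : 𝓞 K) * (m : 𝓞 K) + (v : 𝓞 K) * (n : 𝓞 K) := by exact_mod_cast huv.symm
  rw [this]
  exact Ideal.add_mem _ (Ideal.mul_mem_left _ _ (Ideal.mem_sup_left h1))
    (Ideal.mul_mem_left _ _ (Ideal.mem_sup_right h2))

lemma idCnt_mul {m n : ℕ} (h : m.Coprime n) : idCnt K m * idCnt K n ≤ idCnt K (m * n) := by
  have := idCnt_finite (K := K) (m * n)
  rw [idCnt, idCnt, idCnt, ← Nat.card_prod]
  refine Nat.card_le_card_of_injective (fun x => ⟨x.1.1 * x.2.1, by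
    rw [map_mul, x.1.2, x.2.2]⟩) ?_
  rintro ⟨⟨I, hI⟩, ⟨J, hJ⟩⟩ ⟨⟨I', hI'⟩, ⟨J', hJ'⟩⟩ heq
  simp only [Subtype.mk.injEq] at heq
  have e1 : I = I' := by
    apply dvd_antisymm
    · exact (ideal_coprime_of_norm hI hJ' h).dvd_of_dvd_mul_right (heq ▸ dvd_mul_right _ _)
    · exact (ideal_coprime_of_norm hI' hJ h).dvd_of_dvd_mul_right (heq ▸ dvd_mul_right _ _)
  have e2 : J = J' := by
    apply dvd_antisymm
    · exact (ideal_coprime_of_norm hI' hJ h).symm.dvd_of_dvd_mul_left (heq ▸ dvd_mul_left _ _)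
    · exact (ideal_coprime_of_norm hI hJ' h).symm.dvd_of_dvd_mul_left (heq ▸ dvd_mul_left _ _)
  simp [e1, e2]

lemma idCnt_pos {n : ℕ} (I : Ideal (𝓞 K)) (hI : Ideal.absNorm I = n) : 1 ≤ idCnt K n := by
  have := idCnt_finite (K := K) n
  have : Nonempty {I : Ideal (𝓞 K) // Ideal.absNorm I = n} := ⟨⟨I, hI⟩⟩
  exact Nat.card_pos

lemma idCnt_split {l : ℕ} (hl : l.Prime) {P Q : Ideal (𝓞 K)} (hP : Ideal.absNorm P = l)
    (hQ : Ideal.absNorm Q = l) (hPQ : IsCoprime P Q) (k : ℕ) : k + 1 ≤ idCnt K (l ^ k) := by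
  have := idCnt_finite (K := K) (l ^ k)
  rw [idCnt, ← Nat.card_fin (k + 1)]
  have key : ∀ i j : ℕ, i ≤ k → j ≤ k → P ^ i * Q ^ (k - i) = P ^ j * Q ^ (k - j) → j ≤ i := by
    intro i j hi hj h
    have h1 : P ^ j ∣ P ^ i * Q ^ (k - i) := h ▸ dvd_mul_right _ _
    have h2 : P ^ j ∣ P ^ i := (hPQ.pow (m := j) (n := k - i)).dvd_of_dvd_mul_right h1
    have h3 := Ideal.absNorm_dvd_absNorm_of_le (Ideal.dvd_iff_le.mp h2)
    rw [map_pow, map_pow, hP] at h3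
    exact (Nat.pow_dvd_pow_iff_le_right hl.one_lt).mp h3
  refine Nat.card_le_card_of_injective (fun i : Fin (k + 1) => ⟨P ^ i.1 * Q ^ (k - i.1), by
    rw [map_mul, map_pow, map_pow, hP, hQ, ← pow_add]; congr 1; omega⟩) ?_
  intro i j hij
  simp only [Subtype.mk.injEq] at hij
  have h1 := key i j (by omega) (by omega) hij
  have h2 := key j i (by omega) (by omega) hij.symm
  exact Fin.ext (le_antisymm h2 h1)

lemma exists_split (hp₁ : p₁.Prime) (h2 : Module.finrank ℚ K = 2) {a : 𝓞 K} (ha : a ^ 2 = -(p₁ : 𝓞 K))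
    {l : ℕ} (hl : l.Prime) (hl2 : l ≠ 2) {s : ℤ} (hs : (l : ℤ) ∣ s ^ 2 + p₁) (hs0 : ¬ (l : ℤ) ∣ s) :
    ∃ P Q : Ideal (𝓞 K), Ideal.absNorm P = l ∧ Ideal.absNorm Q = l ∧ IsCoprime P Q := by
  have hlp : Prime (l : ℤ) := Nat.prime_iff_prime_int.mp hl
  have hcop : IsCoprime (l : ℤ) (2 * s) := by
    rw [hlp.coprime_iff_not_dvd, hlp.dvd_mul]
    rintro (h | h)
    · have := (Nat.prime_dvd_prime_iff_eq hl Nat.prime_two).mp (by exact_mod_cast h)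
      exact hl2 this
    · exact hs0 h
  obtain ⟨u, v, huv⟩ := hcop
  have huv' : (u : 𝓞 K) * (l : 𝓞 K) + (v : 𝓞 K) * (2 * (s : 𝓞 K)) = 1 := by exact_mod_cast huv
  obtain ⟨c, hc⟩ := hs
  have hc' : (s : 𝓞 K) ^ 2 + (p₁ : 𝓞 K) = (l : 𝓞 K) * (c : 𝓞 K) := by exact_mod_cast hc
  set P : Ideal (𝓞 K) := Ideal.span {(l : 𝓞 K), a - s} with hP
  set Q : Ideal (𝓞 K) := Ideal.span {(l : 𝓞 K), a + s} with hQ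
  have hlP : (l : 𝓞 K) ∈ P := Ideal.subset_span (by simp)
  have hlQ : (l : 𝓞 K) ∈ Q := Ideal.subset_span (by simp)
  have haP : a - s ∈ P := Ideal.subset_span (by simp)
  have haQ : a + s ∈ Q := Ideal.subset_span (by simp)
  have hPQ : IsCoprime P Q := by
    rw [Ideal.isCoprime_iff_sup_eq, Ideal.eq_top_iff_one, ← huv']
    refine Ideal.add_mem _ (Ideal.mul_mem_left _ _ (Ideal.mem_sup_left hlP))
      (Ideal.mul_mem_left _ _ ?_)
    have : (2 * (s : 𝓞 K)) = (a + s) - (a - s) := by ring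
    rw [this]
    exact Ideal.sub_mem _ (Ideal.mem_sup_right haQ) (Ideal.mem_sup_left haP)
  have hmul : P * Q = Ideal.span {(l : 𝓞 K)} := by
    apply le_antisymm
    · rw [hP, hQ, Ideal.span_pair_mul_span_pair, Ideal.span_le]
      have e : (a - s) * (a + s) = (l : 𝓞 K) * (-c) := by
        have : (a - s) * (a + s) = a ^ 2 - s ^ 2 := by ring
        rw [this, ha]; linear_combination -hc'
      intro x hx
      simp only [Set.mem_insert_iff, Set.mem_singleton_iff] at hx
      rw [SetLike.mem_coe, Ideal.mem_span_singleton]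
      rcases hx with rfl | rfl | rfl | rfl
      · exact dvd_mul_right _ _
      · exact dvd_mul_right _ _
      · exact dvd_mul_left _ _
      · rw [e]; exact dvd_mul_right _ _
    · rw [Ideal.span_le, Set.singleton_subset_iff, SetLike.mem_coe]
      have : (l : 𝓞 K) = u * (l * l) + v * (l * (a + s) - (a - s) * l) := by
        linear_combination -(l : 𝓞 K) * huv'
      rw [this]
      exact Ideal.add_mem _ (Ideal.mul_mem_left _ _ (Ideal.mul_mem_mul hlP hlQ))
        (Ideal.mul_mem_left _ _ (Ideal.sub_mem _ (Ideal.mul_mem_mul hlP haQ)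
          (Ideal.mul_mem_mul haP hlQ)))
  have hnorm : Ideal.absNorm P * Ideal.absNorm Q = l ^ 2 := by
    rw [← map_mul, hmul, Ideal.absNorm_span_natCast, a1_finrankZ h2]
  have hnd : ∀ t : ℤ, (t = s ∨ t = -s) → ¬ (l : 𝓞 K) ∣ a + t := by
    rintro t ht ⟨z, hz⟩
    have hα : (algebraMap (𝓞 K) K a) ^ 2 = -(p₁ : K) := by
      rw [← map_pow, ha, map_neg, map_natCast]
    have htr : Algebra.trace ℚ K (algebraMap (𝓞 K) K a) = 0 := by
      rw [trace_eq_finrank_mul_minpoly_nextCoeff, a1_minpoly hp₁ hα,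
        Polynomial.nextCoeff_of_natDegree_pos (by rw [Polynomial.natDegree_X_pow_add_C]; norm_num),
        Polynomial.natDegree_X_pow_add_C]
      simp [Polynomial.coeff_X_pow]
    have hIntg : IsIntegral ℤ (Algebra.trace ℚ K (algebraMap (𝓞 K) K z)) :=
      Algebra.isIntegral_trace (RingOfIntegers.isIntegral_coe z)
    obtain ⟨w, hw⟩ := IsIntegrallyClosed.isIntegral_iff.mp hIntg
    have e1 : algebraMap (𝓞 K) K a + algebraMap ℚ K (t : ℚ) = (l : ℚ) • algebraMap (𝓞 K) K z := by
      have := congrArg (algebraMap (𝓞 K) K) hz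
      rw [map_add, map_mul, map_natCast, map_intCast] at this
      rw [Algebra.smul_def, map_natCast, map_intCast]; exact this
    have e2 := congrArg (Algebra.trace ℚ K) e1
    rw [map_add, htr, Algebra.trace_algebraMap, h2, map_smul, ← hw] at e2
    have e3 : 2 * t = l * w := by
      have : (2 : ℚ) * t = l * w := by simpa using e2
      exact_mod_cast this
    have hu : IsUnit (l : ℤ) := by
      have h1 : (l : ℤ) ∣ 1 := by
        rw [← huv]
        apply dvd_add (dvd_mul_left _ _)
        apply Dvd.dvd.mul_left
        rcases ht with rfl | rfl
        · exact ⟨w, e3⟩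
        · exact ⟨-w, by linear_combination -e3⟩
      exact isUnit_of_dvd_one h1
    exact hlp.not_isUnit hu
  have hPt : P ≠ ⊤ := by
    intro h
    rw [h, Ideal.top_mul] at hmul
    rw [hmul, Ideal.mem_span_singleton] at haQ
    exact hnd s (Or.inl rfl) haQ
  have hQt : Q ≠ ⊤ := by
    intro h
    rw [h, Ideal.mul_top] at hmul
    rw [hmul, Ideal.mem_span_singleton] at haP
    exact hnd (-s) (Or.inr rfl) (by push_cast; rwa [← sub_eq_add_neg])
  have hP1 : Ideal.absNorm P ≠ 1 := fun h => hPt (Ideal.absNorm_eq_one_iff.mp h)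
  have hQ1 : Ideal.absNorm Q ≠ 1 := fun h => hQt (Ideal.absNorm_eq_one_iff.mp h)
  have := (Nat.Prime.mul_eq_prime_sq_iff hl hP1 hQ1).mp hnorm
  exact ⟨P, Q, this.1, this.2, hPQ⟩
end A2

section A3
variable {K : Type*} [Field K] [NumberField K] {p₁ : ℕ} {α : K}

/-- the quadratic character mod `p₁` with values in `ℂ` -/
noncomputable def qC (p₁ : ℕ) [Fact p₁.Prime] : DirichletCharacter ℂ p₁ :=
  (quadraticChar (ZMod p₁)).ringHomComp (Int.castRingHom ℂ)

lemma qC_apply [Fact p₁.Prime] (x : ZMod p₁) : qC p₁ x = ((quadraticChar (ZMod p₁) x : ℤ) : ℂ) := rfl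

lemma qC_sq [Fact p₁.Prime] : (qC p₁) ^ 2 = 1 := by
  apply MulChar.isQuadratic_iff_sq_eq_one.mp
  exact (quadraticChar_isQuadratic (ZMod p₁)).comp _

open ArithmeticFunction in
lemma zetaMul_prime_pow [Fact p₁.Prime] {l : ℕ} (hl : l.Prime) (k : ℕ) :
    (qC p₁).zetaMul (l ^ k) = ∑ i ∈ Finset.range (k + 1), (qC p₁ (l : ZMod p₁)) ^ i := by
  rw [DirichletCharacter.zetaMul, coe_zeta_mul_apply, Nat.sum_divisors_prime_pow hl]
  refine Finset.sum_congr rfl fun i _ => ?_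
  have h : l ^ i ≠ 0 := pow_ne_zero _ hl.ne_zero
  show (if l ^ i = 0 then 0 else (qC p₁) ((l ^ i : ℕ) : ZMod p₁)) = _
  rw [if_neg h, Nat.cast_pow, map_pow]

lemma legendre_neg (hp₁ : p₁.Prime) (hmod : p₁ % 8 = 3) [Fact p₁.Prime] {l : ℕ} (hl : l.Prime)
    (h : quadraticChar (ZMod p₁) (l : ZMod p₁) = 1) :
    l ≠ 2 ∧ ∃ s : ℤ, (l : ℤ) ∣ s ^ 2 + p₁ ∧ ¬ (l : ℤ) ∣ s := by
  have hp2 : p₁ ≠ 2 := by rintro rfl; omega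
  have hl2 : l ≠ 2 := by
    rintro rfl
    have := ZMod.exists_sq_eq_two_iff hp2
    rw [quadraticChar_one_iff_isSquare] at h
    · have := this.mp (by exact_mod_cast h)
      omega
    · intro h0
      rw [h0] at h
      simp at h
  refine ⟨hl2, ?_⟩
  have hlp : l ≠ p₁ := by
    rintro rfl; simp at h
  haveI : Fact l.Prime := ⟨hl⟩
  have h1 : legendreSym p₁ l = 1 := by
    rw [legendreSym]; exact_mod_cast h
  have hne : ((-(p₁ : ℤ) : ℤ) : ZMod l) ≠ 0 := by
    push_cast
    rw [neg_ne_zero]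
    intro h0
    rw [ZMod.natCast_eq_zero_iff] at h0
    exact hlp ((Nat.prime_dvd_prime_iff_eq hl hp₁).mp h0)
  have h3 : legendreSym l (-(p₁ : ℤ)) = 1 := by
    rw [neg_eq_neg_one_mul, legendreSym.mul, legendreSym.at_neg_one hl2]
    rcases (hl.eq_two_or_odd).resolve_left hl2 with hodd
    rcases (by omega : l % 4 = 1 ∨ l % 4 = 3) with h4 | h4
    · rw [← legendreSym.quadratic_reciprocity_one_mod_four h4 hp2, h1, ZMod.χ₄_nat_one_mod_four h4]; rfl
    · rw [ZMod.χ₄_nat_three_mod_four h4]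
      have := legendreSym.quadratic_reciprocity_three_mod_four h4 (by omega : p₁ % 4 = 3)
      rw [h1] at this
      linarith
  obtain ⟨y, hy⟩ := (legendreSym.eq_one_iff l hne).mp h3
  refine ⟨(y.val : ℤ), ?_, ?_⟩
  · rw [← ZMod.intCast_zmod_eq_zero_iff_dvd] 
    push_cast
    rw [ZMod.natCast_zmod_val, pow_two, ← hy]; push_cast; ring
  · rw [← ZMod.intCast_zmod_eq_zero_iff_dvd]
    push_cast
    rw [ZMod.natCast_zmod_val]
    rintro rfl
    exact hne (by simpa using hy)

lemma zetaMul_le_prime_pow (hp₁ : p₁.Prime) (hmod : p₁ % 8 = 3) [Fact p₁.Prime]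
    (h2 : Module.finrank ℚ K = 2) {a : 𝓞 K} (ha : a ^ 2 = -(p₁ : 𝓞 K)) {l : ℕ} (hl : l.Prime) (k : ℕ) :
    ((qC p₁).zetaMul (l ^ k)).re ≤ idCnt K (l ^ k) := by
  rw [zetaMul_prime_pow hl, qC_apply]
  by_cases h0 : (l : ZMod p₁) = 0
  · have hlp : l = p₁ := by
      rw [ZMod.natCast_eq_zero_iff] at h0
      exact ((Nat.prime_dvd_prime_iff_eq hp₁ hl).mp h0).symm
    have h1 := idCnt_pos (K := K) (n := l ^ k) (Ideal.span {a} ^ k) (by rw [map_pow, a1_norm_sqrt h2 ha, hlp])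
    rw [h0]
    simp only [MulChar.map_zero, Int.cast_zero]
    rw [Finset.sum_eq_single 0 (by intro b _ hb; simp [hb]) (by simp)]
    simpa using h1
  rcases quadraticChar_dichotomy h0 with h | h
  · obtain ⟨hl2, s, hs, hs0⟩ := legendre_neg hp₁ hmod hl h
    obtain ⟨P, Q, hP, hQ, hPQ⟩ := exists_split hp₁ h2 ha hl hl2 hs hs0
    have := idCnt_split hl hP hQ hPQ k
    rw [h]
    simp
    exact_mod_cast this
  · rw [h]
    simp only [Int.cast_neg, Int.cast_one, neg_one_geom_sum]
    split_ifs with he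
    · simp
    · have hk : Even k := by
        rcases Nat.even_or_odd k with h | h
        · exact h
        · exact absurd (h.add_one) he
      obtain ⟨j, rfl⟩ := hk
      have := idCnt_pos (K := K) (n := l ^ (j + j)) (Ideal.span {(l : 𝓞 K)} ^ j) (by
        rw [map_pow, Ideal.absNorm_span_natCast, a1_finrankZ h2]; ring)
      simpa using this

lemma zetaMul_le (hp₁ : p₁.Prime) (hmod : p₁ % 8 = 3) [Fact p₁.Prime]
    (h2 : Module.finrank ℚ K = 2) {a : 𝓞 K} (ha : a ^ 2 = -(p₁ : 𝓞 K)) (n : ℕ) :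
    ((qC p₁).zetaMul n).re ≤ idCnt K n := by
  have him : ∀ n, ((qC p₁).zetaMul n).im = 0 ∧ 0 ≤ ((qC p₁).zetaMul n).re := by
    intro n
    have := DirichletCharacter.zetaMul_nonneg (qC_sq (p₁ := p₁)) n
    rw [Complex.le_def] at this
    exact ⟨this.2.symm, this.1⟩
  induction n using Nat.recOnPosPrimePosCoprime with
  | prime_pow l k hl _ => exact zetaMul_le_prime_pow hp₁ hmod h2 ha hl k
  | zero => simp
  | one =>
    have := zetaMul_le_prime_pow hp₁ hmod h2 ha (l := 2) Nat.prime_two 0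
    simpa using this
  | coprime m n hm hn hmn hm' hn' =>
    rw [(qC p₁).isMultiplicative_zetaMul.map_mul_of_coprime hmn, Complex.mul_re, (him m).1]
    have := idCnt_mul (K := K) hmn
    calc _ = ((qC p₁).zetaMul m).re * ((qC p₁).zetaMul n).re := by ring
      _ ≤ (idCnt K m : ℝ) * idCnt K n := mul_le_mul hm' hn' (him n).2 (by positivity)
      _ ≤ _ := by exact_mod_cast this
end A3

section A4
variable {K : Type*} [Field K] [NumberField K] {p₁ : ℕ} {α : K}
open Filter Topology

lemma LSeries_re_le {f g : ℕ → ℂ} {s : ℝ} (hf : LSeriesSummable f s) (hg : LSeriesSummable g s)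
    (h : ∀ n, (f n).re ≤ (g n).re) : (LSeries f s).re ≤ (LSeries g s).re := by
  have h1 := Complex.hasSum_re (Summable.hasSum hf)
  have h2 := Complex.hasSum_re (Summable.hasSum hg)
  refine hasSum_le (fun n => ?_) h1 h2
  rcases eq_or_ne n 0 with rfl | hn
  · simp
  · rw [LSeries.term_of_ne_zero hn, LSeries.term_of_ne_zero hn]
    have : ((n : ℂ) ^ (s : ℂ)) = (((n : ℝ) ^ s : ℝ) : ℂ) := by
      rw [Complex.ofReal_cpow (by positivity)]; simp
    rw [this, Complex.div_ofReal_re, Complex.div_ofReal_re]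
    exact div_le_div_of_nonneg_right (h n) (by positivity)

open Ideal in
lemma dedekind_summable {s : ℝ} (hs : 1 < s) :
    LSeriesSummable (fun n => ((idCnt K n : ℝ) : ℂ)) s := by
  have htend : Tendsto (fun n : ℕ ↦ (∑ k ∈ Finset.Icc 1 n, (idCnt K k : ℝ)) / n) atTop
      (𝓝 (dedekindZeta_residue K)) := by
    unfold idCnt
    refine ((Ideal.tendsto_norm_le_div_atTop₀ K).comp tendsto_natCast_atTop_atTop).congr fun n ↦ ?_
    simp only [Function.comp_apply, Nat.cast_le, ← Nat.cast_sum]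
    congr
    rw [← add_left_inj 1, ← card_norm_le_eq_card_norm_le_add_one,
      show Finset.Icc 1 n = Finset.Ioc 0 n from Finset.Icc_succ_left_eq_Ioc _ _,
      show 1 = Nat.card {I : Ideal (𝓞 K) // absNorm I = 0} by simp [Ideal.absNorm_eq_zero_iff],
      Finset.sum_Ioc_add_eq_sum_Icc (n.zero_le),
      ← Finset.card_preimage_eq_sum_card_image_eq (fun k _ ↦ finite_setOfPred_absNorm_eq k)]
    simp [Set.coe_eq_subtype]
  refine LSeriesSummable_of_sum_norm_bigO_and_nonneg (r := 1) ?_ (fun _ => Nat.cast_nonneg _) zero_le_one (by simpa using hs)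
  have h1 := htend.isBigO_one ℝ
  have h2 : (fun n : ℕ ↦ (∑ k ∈ Finset.Icc 1 n, (idCnt K k : ℝ))) =ᶠ[atTop]
      fun n : ℕ => ((∑ k ∈ Finset.Icc 1 n, (idCnt K k : ℝ)) / n) * n := by
    filter_upwards [eventually_ge_atTop 1] with n hn
    have : (n : ℝ) ≠ 0 := by exact_mod_cast (by omega : n ≠ 0)
    field_simp
  refine h2.isBigO.trans ?_
  have := h1.mul (Asymptotics.isBigO_refl (fun n : ℕ => (n : ℝ)) atTop)
  simpa using this

lemma qC_ne_one [Fact p₁.Prime] (hp2 : p₁ ≠ 2) : qC p₁ ≠ 1 := by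
  intro h
  obtain ⟨x, hx⟩ := quadraticChar_exists_neg_one (F := ZMod p₁) (by rwa [ZMod.ringChar_zmod_n])
  have h1 := congrArg (fun c => c x) h
  have hx0 : IsUnit x := by
    rw [isUnit_iff_ne_zero]; rintro rfl; simp at hx
  simp only [qC_apply, hx, MulChar.one_apply hx0] at h1
  norm_num at h1

open DirichletCharacter ArithmeticFunction in
lemma zeta_L [Fact p₁.Prime] {s : ℂ} (hs : 1 < s.re) :
    LSeries (qC p₁).zetaMul s = riemannZeta s * LFunction (qC p₁) s := by
  rw [zetaMul, ← coe_mul, LSeries_convolution']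
  · simp only [(qC p₁).LFunction_eq_LSeries hs]
    congr 1
    · simp_rw [← LSeries_zeta_eq_riemannZeta hs, ← natCoe_apply]
    · exact LSeries_congr (fun h => ((qC p₁).apply_eq_toArithmeticFunction_apply h).symm) s
  · exact LSeriesSummable_zeta_iff.mpr hs
  · exact (LSeriesSummable_congr _ fun h ↦ ((qC p₁).apply_eq_toArithmeticFunction_apply h).symm).mpr <|
      ZMod.LSeriesSummable_of_one_lt_re (qC p₁) hs

open DirichletCharacter in
lemma L_one_le_residue (hp₁ : p₁.Prime) (hmod : p₁ % 8 = 3) [Fact p₁.Prime]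
    (h2 : Module.finrank ℚ K = 2) {a : 𝓞 K} (ha : a ^ 2 = -(p₁ : 𝓞 K)) :
    (LFunction (qC p₁) 1).re ≤ dedekindZeta_residue K := by
  have hp2 : p₁ ≠ 2 := by rintro rfl; omega
  have hc : Tendsto (fun s : ℝ => (s : ℂ)) (𝓝[>] 1) (𝓝[≠] 1) := by
    refine tendsto_nhdsWithin_iff.mpr ⟨?_, ?_⟩
    · exact (Complex.continuous_ofReal.tendsto 1).mono_left nhdsWithin_le_nhds
    · filter_upwards [self_mem_nhdsWithin] with s hs
      simp only [Set.mem_Ioi] at hs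
      simp only [Set.mem_compl_iff, Set.mem_singleton_iff]
      exact_mod_cast hs.ne'
  have t1 := riemannZeta_residue_one.comp hc
  have t2 : Tendsto (fun s : ℝ => LFunction (qC p₁) s) (𝓝[>] 1) (𝓝 (LFunction (qC p₁) 1)) :=
    ((differentiable_LFunction (qC_ne_one hp2)).continuous.tendsto 1).comp
      (hc.mono_right nhdsWithin_le_nhds)
  have t3 := (Complex.continuous_re.tendsto _).comp (t1.mul t2)
  have t4 := (Complex.continuous_re.tendsto _).comp (tendsto_sub_one_mul_dedekindZeta_nhdsGT K)
  rw [one_mul] at t3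
  refine le_of_tendsto_of_tendsto t3 t4 ?_
  filter_upwards [self_mem_nhdsWithin] with s hs
  simp only [Set.mem_Ioi] at hs
  have hs' : 1 < (s : ℂ).re := by simpa using hs
  simp only [Function.comp_apply]
  rw [mul_assoc, ← zeta_L hs']
  have : ((s : ℂ) - 1) = ((s - 1 : ℝ) : ℂ) := by push_cast; rfl
  rw [this, Complex.re_ofReal_mul, Complex.re_ofReal_mul]
  refine mul_le_mul_of_nonneg_left ?_ (by linarith)
  refine LSeries_re_le ((qC p₁).LSeriesSummable_zetaMul hs') (dedekind_summable hs) fun n => ?_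
  simpa [idCnt] using zetaMul_le hp₁ hmod h2 ha n

open DirichletCharacter in
lemma L_one_nonneg (hmod : p₁ % 8 = 3) [Fact p₁.Prime] :
    0 ≤ (LFunction (qC p₁) 1).re := by
  have hp2 : p₁ ≠ 2 := by rintro rfl; omega
  have hc : Tendsto (fun s : ℝ => (s : ℂ)) (𝓝[>] 1) (𝓝[≠] 1) := by
    refine tendsto_nhdsWithin_iff.mpr ⟨?_, ?_⟩
    · exact (Complex.continuous_ofReal.tendsto 1).mono_left nhdsWithin_le_nhds
    · filter_upwards [self_mem_nhdsWithin] with s hs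
      simp only [Set.mem_Ioi] at hs
      simp only [Set.mem_compl_iff, Set.mem_singleton_iff]
      exact_mod_cast hs.ne'
  have t1 := riemannZeta_residue_one.comp hc
  have t2 : Tendsto (fun s : ℝ => LFunction (qC p₁) s) (𝓝[>] 1) (𝓝 (LFunction (qC p₁) 1)) :=
    ((differentiable_LFunction (qC_ne_one hp2)).continuous.tendsto 1).comp
      (hc.mono_right nhdsWithin_le_nhds)
  have t3 := (Complex.continuous_re.tendsto _).comp (t1.mul t2)
  rw [one_mul] at t3
  refine ge_of_tendsto t3 ?_
  filter_upwards [self_mem_nhdsWithin] with s hs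
  simp only [Set.mem_Ioi] at hs
  have hs' : 1 < (s : ℂ).re := by simpa using hs
  simp only [Function.comp_apply]
  rw [mul_assoc, ← zeta_L hs']
  have : ((s : ℂ) - 1) = ((s - 1 : ℝ) : ℂ) := by push_cast; rfl
  rw [this, Complex.re_ofReal_mul]
  refine mul_nonneg (by linarith) ?_
  have h0 : (LSeries (0 : ℕ → ℂ) (s : ℂ)).re ≤ (LSeries (qC p₁).zetaMul s).re := by
    refine LSeries_re_le (LSeriesSummable_zero) ((qC p₁).LSeriesSummable_zetaMul hs') fun n => ?_
    have := DirichletCharacter.zetaMul_nonneg (qC_sq (p₁ := p₁)) n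
    rw [Complex.le_def] at this
    simpa using this.1
  simpa using h0
end A4

section A5
open Filter Topology Complex HurwitzZeta

lemma hz_bound {n : ℕ} (hn : 1 ≤ n) {x s : ℝ} (hx : (n : ℝ) ≤ x) (hx' : x ≤ n + 1) (hs : 1 ≤ s) (hs' : s ≤ 2) :
    1 / ((n : ℝ) + 1) ^ s ≤ 1 / x ^ s ∧ 1 / x ^ s ≤ 1 / (n : ℝ) ^ s ∧
      1 / (n : ℝ) ^ s - 1 / ((n : ℝ) + 1) ^ s ≤ 2 / (n : ℝ) ^ 2 := by
  have hn0 : (1 : ℝ) ≤ n := by exact_mod_cast hn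
  have hn1 : (0 : ℝ) < n := by linarith
  refine ⟨?_, ?_, ?_⟩
  · exact one_div_le_one_div_of_le (Real.rpow_pos_of_pos (by linarith) _) (Real.rpow_le_rpow (by linarith) hx' (by linarith))
  · exact one_div_le_one_div_of_le (by positivity) (Real.rpow_le_rpow (by linarith) hx (by linarith))
  · set r : ℝ := (n : ℝ) / (n + 1) with hr
    have hr0 : 0 < r := by positivity
    have hr1 : r ≤ 1 := by rw [hr, div_le_one (by positivity)]; linarith
    have e1 : 1 / ((n : ℝ) + 1) ^ s = (1 / (n : ℝ) ^ s) * r ^ s := by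
      rw [hr, Real.div_rpow (by positivity) (by positivity)]
      have : (n : ℝ) ^ s ≠ 0 := by positivity
      field_simp
    have e2 : r ^ 2 ≤ r ^ s := by
      have := Real.rpow_le_rpow_of_exponent_ge hr0 hr1 hs'
      simpa using this
    have e3 : 1 / (n : ℝ) ^ s ≤ 1 / n := by
      apply one_div_le_one_div_of_le hn1
      have := Real.rpow_le_rpow_of_exponent_le hn0 hs
      simpa using this
    have e4 : 1 - r ≤ 1 / n := by
      rw [hr, one_sub_div (by positivity)]
      rw [div_le_div_iff₀ (by positivity) hn1]; linarith
    have e5 : 0 < 1 / (n : ℝ) ^ s := by positivity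
    rw [e1]
    calc _ = (1 / (n : ℝ) ^ s) * (1 - r ^ s) := by ring
      _ ≤ (1 / (n : ℝ)) * (2 / n) := by
        apply mul_le_mul e3 _ _ (by positivity)
        · have : (2 : ℝ) / n = 2 * (1 / n) := by ring
          rw [this]
          nlinarith
        · have : r ^ s ≤ 1 := Real.rpow_le_one hr0.le hr1 (by linarith)
          linarith
      _ = _ := by field_simp

lemma hz_tendsto {a : ℝ} (h0 : 0 < a) (h1 : a < 1) :
    Summable (fun n : ℕ => (1 / ((n : ℝ) + a) - 1 / ((n : ℝ) + 1 - a)) / 2) ∧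
    hurwitzZetaOdd (a : UnitAddCircle) 1 =
      ((∑' n : ℕ, (1 / ((n : ℝ) + a) - 1 / ((n : ℝ) + 1 - a)) / 2 : ℝ) : ℂ) := by
  set B : ℕ → ℝ := fun n => 2 / (n : ℝ) ^ 2 + if n = 0 then 1 / a ^ 2 + 1 / (1 - a) ^ 2 else 0 with hB
  have hBs : Summable B := by
    apply Summable.add
    · have := (Real.summable_one_div_nat_pow (p := 2)).mpr (by norm_num)
      simpa [div_eq_mul_inv] using this.mul_left 2
    · exact (hasSum_ite_eq 0 _).summable
  have ha1 : 0 < 1 - a := by linarith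
  have bound : ∀ s : ℝ, 1 ≤ s → s ≤ 2 → ∀ n : ℕ,
      |(1 / ((n : ℝ) + a) ^ s - 1 / ((n : ℝ) + 1 - a) ^ s) / 2| ≤ B n := by
    intro s hs hs' n
    rw [abs_le]
    rcases Nat.eq_zero_or_pos n with rfl | hn
    · have k1 : ∀ x : ℝ, 0 < x → x < 1 → 0 ≤ 1 / x ^ s ∧ 1 / x ^ s ≤ 1 / x ^ 2 := by
        intro x hx hx'
        refine ⟨by positivity, one_div_le_one_div_of_le (by positivity) ?_⟩
        have := Real.rpow_le_rpow_of_exponent_ge hx hx'.le hs'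
        simpa using this
      obtain ⟨a1, a2⟩ := k1 a h0 h1
      obtain ⟨b1, b2⟩ := k1 (1 - a) ha1 (by linarith)
      have hBn : B 0 = 1 / a ^ 2 + 1 / (1 - a) ^ 2 := by simp [hB]
      rw [hBn, Nat.cast_zero, zero_add, zero_add]
      constructor <;> linarith
    · obtain ⟨a1, a2, a3⟩ := hz_bound hn (x := n + a) (s := s) (by linarith) (by linarith) hs hs'
      obtain ⟨b1, b2, b3⟩ := hz_bound hn (x := n + 1 - a) (s := s) (by linarith) (by linarith) hs hs'
      have hBn : B n = 2 / (n : ℝ) ^ 2 := by simp [hB, hn.ne']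
      rw [hBn]
      have : 0 ≤ 2 / (n : ℝ) ^ 2 := by positivity
      constructor <;> linarith
  have hS : Summable (fun n : ℕ => (1 / ((n : ℝ) + a) - 1 / ((n : ℝ) + 1 - a)) / 2) := by
    refine Summable.of_norm_bounded hBs fun n => ?_
    have := bound 1 le_rfl (by norm_num) n
    rw [Real.rpow_one, Real.rpow_one] at this
    exact this
  refine ⟨hS, ?_⟩
  have hc : Tendsto (fun s : ℝ => (s : ℂ)) (𝓝[>] 1) (𝓝 1) :=
    (Complex.continuous_ofReal.tendsto 1).mono_left nhdsWithin_le_nhds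
  have t2 : Tendsto (fun s : ℝ => hurwitzZetaOdd (a : UnitAddCircle) s) (𝓝[>] 1) (𝓝 (hurwitzZetaOdd (a : UnitAddCircle) 1)) :=
    ((differentiable_hurwitzZetaOdd a).continuous.tendsto 1).comp hc
  have hmem : ∀ᶠ s : ℝ in 𝓝[>] 1, 1 < s ∧ s ≤ 2 := by
    filter_upwards [Ioc_mem_nhdsGT (show (1 : ℝ) < 2 by norm_num)] with s hs using hs
  have t1 : Tendsto (fun s : ℝ => ∑' n : ℕ, (1 / ((n : ℝ) + a) ^ s - 1 / ((n : ℝ) + 1 - a) ^ s) / 2)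
      (𝓝[>] 1) (𝓝 (∑' n : ℕ, (1 / ((n : ℝ) + a) - 1 / ((n : ℝ) + 1 - a)) / 2)) := by
    refine tendsto_tsum_of_dominated_convergence hBs (fun n => ?_) ?_
    · have hcont : ∀ x : ℝ, 0 < x → Tendsto (fun s : ℝ => 1 / x ^ s) (𝓝[>] 1) (𝓝 (1 / x)) := by
        intro x hx
        have : ContinuousAt (fun s : ℝ => 1 / x ^ s) 1 := by
          refine ContinuousAt.div continuousAt_const (Real.continuousAt_const_rpow hx.ne') (by positivity)
        have := this.tendsto.mono_left (nhdsWithin_le_nhds (s := Set.Ioi 1))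
        simpa using this
      exact ((hcont _ (by positivity)).sub (hcont _ (by have : (0 : ℝ) ≤ n := by positivity
                                                        linarith))).div_const 2
    · filter_upwards [hmem] with s hs n using bound s hs.1.le hs.2 n
  have t3 := (Complex.continuous_ofReal.tendsto _).comp t1
  refine tendsto_nhds_unique t2 (t3.congr' ?_)
  filter_upwards [hmem] with s hs
  have hh := hasSum_nat_hurwitzZetaOdd_of_mem_Icc (a := a) ⟨h0.le, h1.le⟩ (s := s) (by simpa using hs.1)
  rw [← hh.tsum_eq]
  simp only [Function.comp_apply]
  rw [Complex.ofReal_tsum]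
  refine tsum_congr fun n => ?_
  have hn : (0 : ℝ) ≤ n := by positivity
  push_cast
  rw [Complex.ofReal_cpow (by linarith), Complex.ofReal_cpow (by linarith)]
  push_cast
  rfl

lemma hz_one {a : ℝ} (h0 : 0 < a) (h1 : a < 1) :
    hurwitzZetaOdd (a : UnitAddCircle) 1 = Real.pi / 2 * Complex.cot (Real.pi * a) := by
  obtain ⟨hS, he⟩ := hz_tendsto h0 h1
  rw [he]
  have hmem : (a : ℂ) ∈ Complex.integerComplement := by
    rw [Complex.mem_integerComplement_iff]
    rintro ⟨n, hn⟩
    have : (n : ℝ) = a := by exact_mod_cast hn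
    have h2 : (0 : ℝ) < (n : ℝ) := by linarith
    have h3 : (n : ℝ) < 1 := by linarith
    have h2' : 0 < n := by exact_mod_cast h2
    have h3' : n < 1 := by exact_mod_cast h3
    omega
  have t1 := (Complex.continuous_ofReal.tendsto _).comp hS.hasSum.tendsto_sum_nat
  have t2 := tendsto_logDeriv_euler_cot_sub hmem
  have t3 : Tendsto (fun n : ℕ => 1 / ((a : ℂ) + n)) atTop (𝓝 0) := by
    have : Tendsto (fun n : ℕ => 1 / (a + n : ℝ)) atTop (𝓝 0) := by
      simp only [one_div]
      exact tendsto_inv_atTop_zero.comp (tendsto_atTop_add_const_left _ _ tendsto_natCast_atTop_atTop)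
    have := (Complex.continuous_ofReal.tendsto _).comp this
    simpa [Function.comp_def] using this
  have t4 := ((t2.add_const (1 / (a : ℂ))).sub t3).div_const 2
  refine tendsto_nhds_unique t1 ?_
  have e : (Real.pi / 2 * Complex.cot (Real.pi * a) : ℂ) =
    (Real.pi * Complex.cot (Real.pi * a) - 1 / a + 1 / a - 0) / 2 := by ring
  rw [e]
  refine t4.congr fun M => ?_
  simp only [Function.comp_apply]
  induction M with
  | zero => simp
  | succ M ih =>
    rw [Finset.sum_range_succ, Finset.sum_range_succ, Complex.ofReal_add, ← ih]
    push_cast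
    have hM : (0 : ℝ) ≤ M := by positivity
    have d1 : (M : ℂ) + 1 - a ≠ 0 := by
      have : (M : ℝ) + 1 - a ≠ 0 := by linarith
      exact_mod_cast this
    have e1 : 1 / ((a : ℂ) - (M + 1)) = - (1 / ((M : ℂ) + 1 - a)) := by
      rw [← neg_sub, div_neg]
    rw [cotTerm, e1, add_comm (M : ℂ) (a : ℂ)]
    ring
end A5

section A6
open Filter Topology Complex HurwitzZeta
variable {p₁ : ℕ}

lemma qC_odd [Fact p₁.Prime] (hmod : p₁ % 8 = 3) : (qC p₁).Odd := by
  have hp2 : p₁ ≠ 2 := by rintro rfl; omega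
  rw [DirichletCharacter.Odd, qC_apply, quadraticChar_neg_one (by rwa [ZMod.ringChar_zmod_n]),
    ZMod.card, ZMod.χ₄_nat_three_mod_four (by omega)]
  norm_num

lemma qC_zero [Fact p₁.Prime] : qC p₁ 0 = 0 := by simp [qC_apply]

lemma L_one_cot [Fact p₁.Prime] (hmod : p₁ % 8 = 3) :
    DirichletCharacter.LFunction (qC p₁) 1 = (Real.pi / (2 * p₁)) * ∑ j : ZMod p₁, qC p₁ j * Complex.cot (Real.pi * (j.val / p₁ : ℝ)) := by
  have hN : (p₁ : ℂ) ≠ 0 := by exact_mod_cast (Fact.out : p₁.Prime).ne_zero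
  have hodd : Function.Odd (qC p₁ : ZMod p₁ → ℂ) := (qC_odd hmod).to_fun
  rw [DirichletCharacter.LFunction, ZMod.LFunction_def_odd hodd, cpow_neg, cpow_one, Finset.mul_sum,
    Finset.mul_sum]
  refine Finset.sum_congr rfl fun j _ => ?_
  by_cases hj : j = 0
  · subst hj; simp [qC_zero]
  have h0 : 0 < j.val := by
    rw [Nat.pos_iff_ne_zero]; simpa [ZMod.val_eq_zero] using hj
  have h1 : j.val < p₁ := ZMod.val_lt j
  have hNp : (0 : ℝ) < p₁ := by exact_mod_cast (Fact.out : p₁.Prime).pos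
  have hj1 : (j.val : ℝ) < p₁ := by exact_mod_cast h1
  have hj0 : (0 : ℝ) < j.val := by exact_mod_cast h0
  rw [ZMod.toAddCircle_apply, hz_one (by positivity) ((div_lt_one hNp).mpr hj1)]
  field_simp

lemma sum_mul_pow_root {w : ℂ} {n : ℕ} (hw : w ^ n = 1) (h1 : w ≠ 1) :
    ∑ a ∈ Finset.range n, (a : ℂ) * w ^ a = n / (w - 1) := by
  have h2 : w - 1 ≠ 0 := sub_ne_zero.mpr h1
  have key : ∀ n : ℕ, (∑ a ∈ Finset.range n, (a : ℂ) * w ^ a) * (w - 1) = n * w ^ n - ∑ a ∈ Finset.range n, w ^ (a + 1) := by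
    intro n
    induction n with
    | zero => simp
    | succ n ih => rw [Finset.sum_range_succ, add_mul, ih, Finset.sum_range_succ]; push_cast; ring
  rw [eq_div_iff h2, key, hw]
  have h3 : ∑ a ∈ Finset.range n, w ^ (a + 1) = 0 := by
    have : ∑ a ∈ Finset.range n, w ^ a = 0 := by
      rw [geom_sum_eq h1, hw]; simp
    simp_rw [pow_succ]
    rw [← Finset.sum_mul, this, zero_mul]
  rw [h3]; ring

lemma gauss_sum_S [Fact p₁.Prime] (hmod : p₁ % 8 = 3) :
    gaussSum (qC p₁) ZMod.stdAddChar * ∑ a : ZMod p₁, (a.val : ℂ) * qC p₁ a =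
      - (p₁ * I / 2) * ∑ j : ZMod p₁, qC p₁ j * Complex.cot (Real.pi * (j.val / p₁ : ℝ)) := by
  have hp2 : p₁ ≠ 2 := by rintro rfl; omega
  have hN : (p₁ : ℂ) ≠ 0 := by exact_mod_cast (Fact.out : p₁.Prime).ne_zero
  have hchi : ∑ j : ZMod p₁, qC p₁ j = 0 := MulChar.sum_eq_zero_of_ne_one (qC_ne_one hp2)
  have hinv : (qC p₁)⁻¹ = qC p₁ := by
    rw [inv_eq_iff_mul_eq_one, ← pow_two]; exact qC_sq
  have h1 : ∀ a : ZMod p₁, gaussSum (qC p₁) ZMod.stdAddChar * qC p₁ a =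
      ∑ k : ZMod p₁, qC p₁ k * (ZMod.stdAddChar k : ℂ) ^ a.val := by
    intro a
    by_cases ha : a = 0
    · subst ha; simp [hchi, qC_zero]
    · obtain ⟨u, rfl⟩ := (isUnit_iff_ne_zero.mpr ha)
      have h3 := gaussSum_mulShift (qC p₁) ZMod.stdAddChar u
      have h4 : gaussSum (qC p₁) ZMod.stdAddChar * qC p₁ u = gaussSum (qC p₁) (AddChar.mulShift ZMod.stdAddChar (u : ZMod p₁)) := by
        rw [← h3, mul_comm, ← mul_assoc]
        have : qC p₁ (u : ZMod p₁) * qC p₁ u = 1 := by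
          rw [← pow_two, ← MulChar.pow_apply' _ (by norm_num), qC_sq, MulChar.one_apply u.isUnit]
        rw [this, one_mul]
      rw [h4, gaussSum]
      refine Finset.sum_congr rfl fun k _ => ?_
      rw [AddChar.mulShift_apply, ← AddChar.map_nsmul_eq_pow, nsmul_eq_mul, ZMod.natCast_zmod_val]
  have h2 : ∀ k : ZMod p₁, qC p₁ k * ∑ a : ZMod p₁, (a.val : ℂ) * (ZMod.stdAddChar k : ℂ) ^ a.val =
      qC p₁ k * (p₁ * (-1 / 2)) + - (p₁ * I / 2) * (qC p₁ k * Complex.cot (Real.pi * (k.val / p₁ : ℝ))) := by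
    intro k
    by_cases hk : k = 0
    · subst hk; simp [qC_zero]
    have hw1 : (ZMod.stdAddChar k : ℂ) ≠ 1 := by
      intro h
      apply hk
      apply ZMod.injective_stdAddChar
      simpa using h
    have hwp : (ZMod.stdAddChar k : ℂ) ^ p₁ = 1 := by
      rw [← AddChar.map_nsmul_eq_pow]; simp
    have hs : ∑ a : ZMod p₁, (a.val : ℂ) * (ZMod.stdAddChar k : ℂ) ^ a.val =
        ∑ a ∈ Finset.range p₁, (a : ℂ) * (ZMod.stdAddChar k : ℂ) ^ a := by
      refine Finset.sum_bij (fun a _ => a.val) (fun a _ => Finset.mem_range.mpr (ZMod.val_lt a))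
        (fun a _ b _ h => ZMod.val_injective _ h) (fun b hb => ⟨(b : ZMod p₁), Finset.mem_univ _, ?_⟩) (fun _ _ => rfl)
      exact ZMod.val_cast_of_lt (Finset.mem_range.mp hb)
    rw [hs, sum_mul_pow_root hwp hw1, Complex.cot_pi_eq_exp_ratio]
    have he : cexp (2 * Real.pi * I * (k.val / p₁ : ℝ)) = ZMod.stdAddChar k := by
      have := ZMod.stdAddChar_coe (N := p₁) (k.val : ℤ)
      rw [Int.cast_natCast, ZMod.natCast_zmod_val] at this
      rw [this]
      congr 1
      push_cast
      ring
    rw [he]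
    set w : ℂ := ZMod.stdAddChar k
    have d1 : w - 1 ≠ 0 := sub_ne_zero.mpr hw1
    have d2 : 1 - w ≠ 0 := sub_ne_zero.mpr hw1.symm
    field_simp
    ring
  calc _ = ∑ a : ZMod p₁, ∑ k : ZMod p₁, (a.val : ℂ) * (qC p₁ k * (ZMod.stdAddChar k : ℂ) ^ a.val) := by
        rw [Finset.mul_sum]
        refine Finset.sum_congr rfl fun a _ => ?_
        rw [← Finset.mul_sum, ← h1]; ring
    _ = ∑ k : ZMod p₁, qC p₁ k * ∑ a : ZMod p₁, (a.val : ℂ) * (ZMod.stdAddChar k : ℂ) ^ a.val := by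
        rw [Finset.sum_comm]
        refine Finset.sum_congr rfl fun k _ => ?_
        rw [Finset.mul_sum]
        refine Finset.sum_congr rfl fun a _ => ?_
        ring
    _ = _ := by
        rw [Finset.sum_congr rfl fun k _ => h2 k, Finset.sum_add_distrib, ← Finset.sum_mul, hchi,
          zero_mul, zero_add, ← Finset.mul_sum]

/-- Part A: the class number bound. -/
theorem class_number_bound {K : Type*} [Field K] [NumberField K] {α : K} (hp₁ : p₁.Prime)
    (hmod : p₁ % 8 = 3) [Fact p₁.Prime]
    (hα : α ^ 2 = -(p₁ : K)) (hKα : Algebra.adjoin ℚ {α} = ⊤) :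
    |∑ a : ZMod p₁, (a.val : ℤ) * quadraticChar (ZMod p₁) a| ≤ p₁ * classNumber K := by
  have hp2 : p₁ ≠ 2 := by rintro rfl; omega
  have h2 := a1_finrank hp₁ hα hKα
  obtain ⟨a, -, ha⟩ := a1_exists_int hα
  have hres := a1_residue hp₁ h2 hα
  have hL := L_one_le_residue hp₁ hmod h2 ha
  have hL0 := L_one_nonneg (p₁ := p₁) hmod
  have hcot := L_one_cot (p₁ := p₁) hmod
  have hg := gauss_sum_S (p₁ := p₁) hmod
  set S : ℤ := ∑ a : ZMod p₁, (a.val : ℤ) * quadraticChar (ZMod p₁) a with hS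
  have hSC : ∑ a : ZMod p₁, (a.val : ℂ) * qC p₁ a = (S : ℂ) := by
    rw [hS]; push_cast; rfl
  set R : ℝ := ∑ j : ZMod p₁, (quadraticChar (ZMod p₁) j : ℝ) * Real.cot (Real.pi * (j.val / p₁)) with hR
  have hRC : ∑ j : ZMod p₁, qC p₁ j * Complex.cot (Real.pi * (j.val / p₁ : ℝ)) = (R : ℂ) := by
    rw [hR]; push_cast
    rfl
  rw [hRC] at hcot hg
  rw [hSC] at hg
  have hNp : (0 : ℝ) < p₁ := by exact_mod_cast hp₁.pos
  have hLr : (DirichletCharacter.LFunction (qC p₁) 1).re = Real.pi / (2 * p₁) * R := by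
    rw [hcot]
    have : (Real.pi / (2 * p₁) * R : ℂ) = ((Real.pi / (2 * p₁) * R : ℝ) : ℂ) := by push_cast; rfl
    rw [this, Complex.ofReal_re]
  have hτ : ‖gaussSum (qC p₁) ZMod.stdAddChar‖ = Real.sqrt p₁ := by
    have h3 := gaussSum_sq (χ := qC p₁) (qC_ne_one hp2)
      ((quadraticChar_isQuadratic (ZMod p₁)).comp _) (ψ := ZMod.stdAddChar) (ZMod.isPrimitive_stdAddChar p₁)
    have h4 := congrArg norm h3
    rw [norm_pow, norm_mul, ZMod.card] at h4
    rw [eq_comm, Real.sqrt_eq_iff_eq_sq hNp.le (norm_nonneg _), h4]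
    rw [show qC p₁ (-1) = -1 from qC_odd hmod]
    simp
  have h5 := congrArg norm hg
  rw [norm_mul, norm_mul, hτ, norm_neg, norm_div, norm_mul, norm_I] at h5
  simp only [norm_natCast, norm_intCast, mul_one, norm_ofNat, norm_real, Real.norm_eq_abs] at h5
  have hR0 : 0 ≤ R := by
    rw [hLr] at hL0
    exact nonneg_of_mul_nonneg_right hL0 (by positivity)
  rw [abs_of_nonneg hR0] at h5
  have hs := Real.sq_sqrt hNp.le
  set t := Real.sqrt p₁ with ht
  have htp : 0 < t := Real.sqrt_pos.mpr hNp
  have h6 : Real.pi / (2 * p₁) * R * t ≤ Real.pi * classNumber K := by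
    rw [← hLr]
    exact (mul_le_mul_of_nonneg_right hL htp.le).trans hres
  have h7 : R * t ≤ 2 * p₁ * classNumber K := by
    have e : Real.pi / (2 * p₁) * R * t = Real.pi * (R * t / (2 * p₁)) := by ring
    rw [e] at h6
    have h8 := le_of_mul_le_mul_left h6 Real.pi_pos
    rw [div_le_iff₀ (by positivity)] at h8
    linarith
  have h9 : |(S : ℝ)| * p₁ ≤ p₁ * (p₁ * classNumber K) := by
    calc |(S : ℝ)| * p₁ = (t * |(S : ℝ)|) * t := by rw [← hs]; ring
      _ = p₁ / 2 * (R * t) := by rw [h5]; ring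
      _ ≤ p₁ / 2 * (2 * p₁ * classNumber K) := mul_le_mul_of_nonneg_left h7 (by positivity)
      _ = _ := by ring
  rw [mul_comm] at h9
  have h10 := le_of_mul_le_mul_left h9 hNp
  exact_mod_cast h10
end A6

section B1
variable {C : Type*} [NormedField C] [IsUltrametricDist C] {p : ℕ}

lemma ultra_sum_le {ι : Type*} (s : Finset ι) (g : ι → C) (h : ∀ i ∈ s, ‖g i‖ ≤ 1) :
    ‖∑ i ∈ s, g i‖ ≤ 1 :=
  IsUltrametricDist.norm_sum_le_of_forall_le_of_nonneg zero_le_one h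

lemma norm_of_pow_one {z : C} {n : ℕ} (hn : n ≠ 0) (h : z ^ n = 1) : ‖z‖ = 1 := by
  have : ‖z‖ ^ n = 1 := by rw [← norm_pow, h, norm_one]
  exact (pow_eq_one_iff_of_nonneg (norm_nonneg _) hn).mp this

lemma norm_lam [Fact p.Prime] (hpn : ‖(p : C)‖ = (p : ℝ)⁻¹) {ζ : C} (hζ : IsPrimitiveRoot ζ p) :
    ‖ζ - 1‖ ^ (p - 1) = (p : ℝ)⁻¹ := by
  have hp : p.Prime := Fact.out
  obtain ⟨k, rfl⟩ : ∃ k, p = k + 1 := ⟨p - 1, by have := hp.pos; omega⟩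
  have hz1 : ‖ζ‖ = 1 := norm_of_pow_one hp.ne_zero hζ.pow_eq_one
  have key : ∀ i ∈ Finset.range k, ‖1 - ζ ^ (i + 1)‖ = ‖ζ - 1‖ := by
    intro i hi
    rw [Finset.mem_range] at hi
    have geo : ∀ (z : C) (j : ℕ), ‖z‖ = 1 → ‖1 - z ^ j‖ ≤ ‖z - 1‖ := by
      intro z j hz
      have : 1 - z ^ j = (∑ i ∈ Finset.range j, z ^ i) * (1 - z) := by
        rw [geom_sum_mul_neg]
      rw [this, norm_mul, norm_sub_rev 1 z]
      exact mul_le_of_le_one_left (norm_nonneg _) (ultra_sum_le _ _ (by intro i _; simp [hz]))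
    apply le_antisymm (geo ζ _ hz1)
    have hco : Nat.Coprime (i + 1) (k + 1) :=
      (Nat.coprime_of_lt_prime (by omega) (by omega) hp).symm
    obtain ⟨j, -, hj⟩ := (hζ.pow_of_coprime _ hco).eq_pow_of_pow_eq_one (ξ := ζ) hζ.pow_eq_one
    have := geo (ζ ^ (i + 1)) j (by simp [hz1])
    rw [hj] at this
    rw [norm_sub_rev ζ 1, norm_sub_rev 1 (ζ ^ (i + 1))]; exact this
  have h1 := hζ.prod_one_sub_pow_eq_order
  have h2 := congrArg norm h1
  rw [norm_prod, Finset.prod_congr rfl key, Finset.prod_const, Finset.card_range] at h2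
  simp only [Nat.add_sub_cancel]
  rw [h2, ← hpn]; push_cast; rfl

variable (C) in
/-- closed unit ball -/
def ballRing : Subring C where
  carrier := {x | ‖x‖ ≤ 1}
  mul_mem' := by
    intro a b ha hb
    simp only [Set.mem_setOf_eq, norm_mul] at *
    exact mul_le_one₀ ha (norm_nonneg _) hb
  one_mem' := by simp
  add_mem' := by
    intro a b ha hb
    exact (IsUltrametricDist.norm_add_le_max a b).trans (max_le ha hb)
  zero_mem' := by simp
  neg_mem' := by intro a ha; simpa using ha

lemma mem_ballRing {x : C} : x ∈ ballRing C ↔ ‖x‖ ≤ 1 := Iff.rfl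

variable (C) in
/-- open unit ball -/
def ballIdeal : Ideal (ballRing C) where
  carrier := {x | ‖(x : C)‖ < 1}
  add_mem' := by
    intro a b ha hb
    exact (IsUltrametricDist.norm_add_le_max (a : C) b).trans_lt (max_lt ha hb)
  zero_mem' := by simp
  smul_mem' := by
    intro a b hb
    simp only [Set.mem_setOf_eq, smul_eq_mul, Subring.coe_mul, norm_mul] at *
    exact mul_lt_one_of_nonneg_of_lt_one_right (mem_ballRing.mp a.2) (norm_nonneg _) hb

lemma mem_ballIdeal {x : ballRing C} : x ∈ ballIdeal C ↔ ‖(x : C)‖ < 1 := Iff.rfl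

instance ballIdeal_max : (ballIdeal C).IsMaximal := by
  rw [Ideal.isMaximal_iff]
  refine ⟨by rw [mem_ballIdeal]; simp, ?_⟩
  intro J x hJ hx hxJ
  rw [mem_ballIdeal, not_lt] at hx
  have hx1 : ‖(x : C)‖ = 1 := le_antisymm x.2 hx
  have hx0 : (x : C) ≠ 0 := by intro h; rw [h] at hx1; simp at hx1
  have : (1 : ballRing C) = ⟨(x : C)⁻¹, by rw [mem_ballRing, norm_inv, hx1, inv_one]⟩ * x := by
    ext; simp [hx0]
  rw [this]
  exact J.mul_mem_left _ hxJ

variable (C) in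
/-- residue field -/
abbrev resF := ballRing C ⧸ ballIdeal C

noncomputable instance resF_field : Field (resF C) := Ideal.Quotient.field _

variable (C) in
/-- reduction -/
noncomputable abbrev redm : ballRing C →+* resF C := Ideal.Quotient.mk _

lemma redm_eq_zero {x : ballRing C} : redm C x = 0 ↔ ‖(x : C)‖ < 1 := by
  rw [Ideal.Quotient.eq_zero_iff_mem, mem_ballIdeal]

lemma redm_ne_zero {x : ballRing C} : redm C x ≠ 0 ↔ ‖(x : C)‖ = 1 := by
  rw [Ne, redm_eq_zero, not_lt]
  exact ⟨fun h => le_antisymm x.2 h, fun h => h.ge⟩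

lemma resF_charP [Fact p.Prime] (hpn : ‖(p : C)‖ = (p : ℝ)⁻¹) : CharP (resF C) p := by
  have hp : p.Prime := Fact.out
  refine (CharP.charP_iff_prime_eq_zero hp).mpr ?_
  have : (p : resF C) = redm C (p : ballRing C) := by simp
  rw [this, redm_eq_zero]
  simp only [SubringClass.coe_natCast, hpn]
  exact inv_lt_one_of_one_lt₀ (by exact_mod_cast hp.one_lt)

lemma norm_natCast_coprime [Fact p.Prime] (hpn : ‖(p : C)‖ = (p : ℝ)⁻¹) {a : ℕ} (ha : ¬ p ∣ a) :
    ‖(a : C)‖ = 1 := by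
  have := resF_charP hpn
  have h : (a : resF C) ≠ 0 := by rwa [Ne, CharP.cast_eq_zero_iff (resF C) p]
  have h2 : (a : resF C) = redm C (a : ballRing C) := by simp
  rw [h2, redm_ne_zero] at h
  simpa using h

lemma norm_intCast_le (a : ℤ) : ‖(a : C)‖ ≤ 1 := by
  have := (a : ballRing C).2
  rw [mem_ballRing] at this
  simpa using this

lemma red_prim [Fact p.Prime] (hpn : ‖(p : C)‖ = (p : ℝ)⁻¹) {n : ℕ} (hn : ¬ p ∣ n) {z : ballRing C}
    (hz : IsPrimitiveRoot (z : C) n) : IsPrimitiveRoot (redm C z) n := by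
  have hn0 : 0 < n := by rcases Nat.eq_zero_or_pos n with h | h; · simp [h] at hn
                         · exact h
  have hzn : z ^ n = 1 := by ext; simpa using hz.pow_eq_one
  rw [IsPrimitiveRoot.iff hn0]
  refine ⟨by rw [← map_pow, hzn, map_one], ?_⟩
  intro l hl hln h
  obtain ⟨k, rfl⟩ : ∃ k, n = k + 1 := ⟨n - 1, by omega⟩
  have h1 := hz.prod_one_sub_pow_eq_order
  have h2 := norm_natCast_coprime hpn hn
  have h3 : (((k + 1 : ℕ)) : C) = k + 1 := by push_cast; rfl
  rw [h3, ← h1, norm_prod] at h2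
  have hle : ∀ j, ‖1 - (z : C) ^ (j + 1)‖ ≤ 1 := fun j => by
    have := (1 - z ^ (j + 1)).2
    simpa [mem_ballRing] using this
  have hlt : ‖1 - (z : C) ^ (l - 1 + 1)‖ < 1 := by
    have : redm C (1 - z ^ (l - 1 + 1)) = 0 := by
      rw [map_sub, map_one, map_pow, Nat.sub_add_cancel hl, h, sub_self]
    rw [redm_eq_zero] at this
    simpa using this
  have hmem : l - 1 ∈ Finset.range k := by rw [Finset.mem_range]; omega
  rw [← Finset.mul_prod_erase _ _ hmem] at h2
  have h4 : ∏ x ∈ (Finset.range k).erase (l - 1), ‖1 - (z : C) ^ (x + 1)‖ ≤ 1 :=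
    Finset.prod_le_one (fun i _ => norm_nonneg _) (fun i _ => hle i)
  have := mul_lt_one_of_nonneg_of_lt_one_left (norm_nonneg _) hlt h4
  linarith

end B1

section B2
variable {C : Type*} [NormedField C] [IsUltrametricDist C] [IsAlgClosed C] [CharZero C] {p : ℕ} [Fact p.Prime]
  {F : Type*} [Field F] [Fintype F] [Algebra (ZMod p) F] {f : ℕ}

lemma exists_teich (hpn : ‖(p : C)‖ = (p : ℝ)⁻¹) (hf : f ≠ 0) (hcard : Fintype.card F = p ^ f) :
    ∃ (ι : F →+* resF C) (Ω : MulChar F (ballRing C)), (∀ x, redm C (Ω x) = ι x) ∧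
      orderOf (Ω.ringHomComp (ballRing C).subtype) = p ^ f - 1 := by
  have hp : p.Prime := Fact.out
  have hq1 : 1 < p ^ f := Nat.one_lt_pow hf hp.one_lt
  set n := p ^ f - 1 with hn
  have hn0 : 0 < n := by omega
  have : NeZero n := ⟨hn0.ne'⟩
  have : NeZero (n : C) := ⟨by exact_mod_cast hn0.ne'⟩
  have hpn' : ¬ p ∣ n := by
    intro h
    have h2 : p ∣ p ^ f := dvd_pow_self p hf
    have h3 : p ∣ 1 := by
      have : p ^ f = n + 1 := by omega
      rw [this] at h2
      exact (Nat.dvd_add_right h).mp h2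
    exact hp.one_lt.ne' (Nat.dvd_one.mp h3)
  obtain ⟨z0, hz0⟩ := HasEnoughRootsOfUnity.exists_primitiveRoot C n
  have hz0n : ‖z0‖ = 1 := norm_of_pow_one hn0.ne' hz0.pow_eq_one
  let z : ballRing C := ⟨z0, hz0n.le⟩
  have hz : IsPrimitiveRoot (redm C z) n := red_prim hpn hpn' (z := z) hz0
  have hzz : IsPrimitiveRoot z n := IsPrimitiveRoot.of_map_of_injective (f := (ballRing C).subtype) hz0
    Subtype.val_injective
  have := resF_charP (C := C) hpn
  letI : Algebra (ZMod p) (resF C) := ZMod.algebra _ p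
  haveI := FiniteField.isSplittingField_of_card_eq (K := F) p f hcard
  have hspl : (Polynomial.map (algebraMap (ZMod p) (resF C)) (Polynomial.X ^ p ^ f - Polynomial.X)).Splits := by
    have e : (Polynomial.map (algebraMap (ZMod p) (resF C)) (Polynomial.X ^ p ^ f - Polynomial.X)) =
      Polynomial.X * (Polynomial.X ^ n - Polynomial.C 1) := by
      have : p ^ f = n + 1 := by omega
      rw [this]
      simp [pow_succ]; ring
    rw [e]
    exact Polynomial.Splits.X.mul (Polynomial.X_pow_sub_one_splits hz)
  let ι : F →+* resF C := (Polynomial.IsSplittingField.lift F (Polynomial.X ^ p ^ f - Polynomial.X : Polynomial (ZMod p)) hspl).toRingHom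
  obtain ⟨g, hg⟩ := IsCyclic.exists_generator (α := Fˣ)
  have hcu : Fintype.card Fˣ = n := by rw [Fintype.card_units, hcard]
  have hgn : (g : F) ^ n = 1 := by
    rw [← Units.val_pow_eq_pow_val, ← hcu, pow_card_eq_one]; rfl
  obtain ⟨j, -, hj⟩ := hz.eq_pow_of_pow_eq_one (ξ := ι g) (by rw [← map_pow, hgn, map_one])
  let u : (ballRing C)ˣ := Units.ofPowEqOne z n hzz.pow_eq_one hn0.ne'
  have hu : (u ^ j) ∈ rootsOfUnity (Fintype.card Fˣ) (ballRing C) := by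
    rw [hcu, mem_rootsOfUnity, ← pow_mul, mul_comm, pow_mul]
    have : u ^ n = 1 := by ext; simpa [u] using hz0.pow_eq_one
    rw [this, one_pow]
  let Ω := MulChar.ofRootOfUnity hu hg
  have hΩg : Ω g = z ^ j := by
    have := MulChar.ofRootOfUnity_spec hu hg
    simpa [u] using this
  have hred : ∀ x, redm C (Ω x) = ι x := by
    intro x
    by_cases hx : x = 0
    · subst hx
      rw [MulChar.map_zero, map_zero, map_zero]
    · obtain ⟨y, rfl⟩ := (isUnit_iff_ne_zero.mpr hx)
      obtain ⟨i, rfl⟩ := (Submonoid.mem_powers_iff _ _).mp (mem_powers_iff_mem_zpowers.mpr (hg y))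
      rw [Units.val_pow_eq_pow_val, map_pow, map_pow, map_pow, hΩg, map_pow, hj]
  refine ⟨ι, Ω, hred, ?_⟩
  apply Nat.dvd_antisymm
  · rw [orderOf_dvd_iff_pow_eq_one, MulChar.eq_iff hg, MulChar.pow_apply_coe, ← map_pow, hgn, map_one,
      MulChar.one_apply_coe]
  · have h1 := pow_orderOf_eq_one (Ω.ringHomComp (ballRing C).subtype)
    set k := orderOf (Ω.ringHomComp (ballRing C).subtype) with hk
    rw [MulChar.eq_iff hg, MulChar.pow_apply_coe, MulChar.one_apply_coe, MulChar.ringHomComp_apply, ← map_pow] at h1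
    have h2 : (Ω g) ^ k = 1 := by ext; simpa using h1
    have h3 := congrArg (redm C) h2
    rw [map_pow, hred, map_one, ← map_pow, map_eq_one_iff ι ι.injective] at h3
    have h4 : g ^ k = 1 := by ext; simpa using h3
    have h5 := orderOf_dvd_of_pow_eq_one h4
    rwa [orderOf_eq_card_of_forall_mem_zpowers hg, Nat.card_eq_fintype_card, hcu] at h5

variable (F) in
/-- the trace character -/
noncomputable def trChar {R : Type*} [CommRing R] {ζ : R} (hζ : IsPrimitiveRoot ζ p) : AddChar F R :=
  (AddChar.zmodChar p hζ.pow_eq_one).compAddMonoidHom (Algebra.trace (ZMod p) F).toAddMonoidHom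

lemma trChar_apply {R : Type*} [CommRing R] {ζ : R} (hζ : IsPrimitiveRoot ζ p) (x : F) :
    trChar F hζ x = ζ ^ (Algebra.trace (ZMod p) F x).val := by
  simp [trChar, AddChar.zmodChar_apply]

lemma trace_exists_ne : ∃ b : F, Algebra.trace (ZMod p) F b ≠ 0 := by
  have htr := (traceForm_nondegenerate (ZMod p) F).1 1
  simp_rw [Algebra.traceForm_apply] at htr
  by_contra! hf
  exact one_ne_zero (htr (fun n => hf _))

lemma trChar_ne_one {R : Type*} [CommRing R] {ζ : R} (hζ : IsPrimitiveRoot ζ p) : trChar F hζ ≠ 1 := by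
  obtain ⟨b, hb⟩ := trace_exists_ne (p := p) (F := F)
  intro h
  have := congrArg (fun ψ => ψ b) h
  simp only [trChar_apply, AddChar.one_apply] at this
  have h2 := hζ.dvd_of_pow_eq_one _ this
  have h3 := Nat.eq_zero_of_dvd_of_lt h2 (ZMod.val_lt _)
  exact hb ((ZMod.val_eq_zero _).mp h3)

lemma trChar_prim {R : Type*} [CommRing R] {ζ : R} (hζ : IsPrimitiveRoot ζ p) :
    (trChar F hζ).IsPrimitive := AddChar.IsPrimitive.of_ne_one (trChar_ne_one hζ)

lemma trace_pow_p (x : F) : Algebra.trace (ZMod p) F (x ^ p) = Algebra.trace (ZMod p) F x := by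
  have : CharP F p := charP_of_injective_algebraMap (algebraMap (ZMod p) F).injective p
  have := Algebra.trace_eq_of_algEquiv (FiniteField.frobeniusAlgEquiv (ZMod p) F p) x
  rw [← this]
  congr 1
  simp [ZMod.card]

lemma gauss_pow_p {R : Type*} [CommRing R] {ζ : R} (hζ : IsPrimitiveRoot ζ p) (φ : MulChar F R) :
    gaussSum (φ ^ p) (trChar F hζ) = gaussSum φ (trChar F hζ) := by
  have : CharP F p := charP_of_injective_algebraMap (algebraMap (ZMod p) F).injective p
  have hp : p.Prime := Fact.out
  unfold gaussSum
  refine Fintype.sum_equiv (frobeniusEquiv F p).toEquiv _ _ ?_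
  intro x
  simp only [RingEquiv.toEquiv_eq_coe, EquivLike.coe_coe, frobeniusEquiv_apply, frobenius_def]
  rw [MulChar.pow_apply' _ hp.ne_zero, trChar_apply, trChar_apply, trace_pow_p, map_pow]

lemma gauss_pow_p_pow {R : Type*} [CommRing R] {ζ : R} (hζ : IsPrimitiveRoot ζ p) (φ : MulChar F R) (e : ℕ) :
    gaussSum (φ ^ p ^ e) (trChar F hζ) = gaussSum φ (trChar F hζ) := by
  induction e with
  | zero => simp
  | succ e ih => rw [pow_succ, pow_mul, gauss_pow_p, ih]

end B2

section B3
variable {C : Type*} [NormedField C] [IsUltrametricDist C] [IsAlgClosed C] [CharZero C] {p : ℕ} [Fact p.Prime]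
  {F : Type*} [Field F] [Fintype F] [Algebra (ZMod p) F] {f : ℕ}

lemma sum_inv_trace (hf : f ≠ 0) (hcard : Fintype.card F = p ^ f) (hq : 2 < p ^ f) :
    ∑ x : F, x⁻¹ * algebraMap (ZMod p) F (Algebra.trace (ZMod p) F x) = -1 := by
  have hp : p.Prime := Fact.out
  have hfr : Module.finrank (ZMod p) F = f := by
    have := Module.card_eq_pow_finrank (K := ZMod p) (V := F)
    rw [hcard, ZMod.card] at this
    exact (Nat.pow_right_injective hp.two_le this).symm
  simp_rw [FiniteField.algebraMap_trace_eq_sum_pow, hfr, Nat.card_eq_fintype_card, ZMod.card, Finset.mul_sum]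
  rw [Finset.sum_comm]
  have key : ∀ i ∈ Finset.range f, ∑ x : F, x⁻¹ * x ^ p ^ i = if i = 0 then -1 else 0 := by
    intro i hi
    rw [Finset.mem_range] at hi
    have h1 : ∑ x : F, x⁻¹ * x ^ p ^ i = ∑ x : Fˣ, (x : F) ^ (p ^ i - 1) := by
      have hpos : 0 < p ^ i := pow_pos hp.pos i
      rw [← Finset.add_sum_erase _ _ (Finset.mem_univ (0 : F))]
      rw [inv_zero, zero_mul, zero_add]
      symm
      refine Finset.sum_bij (fun (x : Fˣ) _ => (x : F)) ?_ ?_ ?_ ?_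
      · intro a _; simp
      · intro a _ b _ h; exact Units.ext h
      · intro b hb
        have hb' : b ≠ 0 := by simpa using hb
        exact ⟨Units.mk0 b hb', Finset.mem_univ _, rfl⟩
      · intro a _
        obtain ⟨k, hk⟩ : ∃ k, p ^ i = k + 1 := ⟨p ^ i - 1, by omega⟩
        rw [hk, pow_succ']; simp
    rw [h1]
    have h2 := FiniteField.sum_pow_units F (p ^ i - 1)
    rw [h2, hcard]
    by_cases hi0 : i = 0
    · subst hi0; simp
    · rw [if_neg hi0, if_neg]
      intro hd
      have h3 : p ^ i < p ^ f := Nat.pow_lt_pow_right hp.one_lt hi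
      have h4 : 1 < p ^ i := Nat.one_lt_pow hi0 hp.one_lt
      have := Nat.le_of_dvd (by omega) hd
      omega
  rw [Finset.sum_congr rfl key, Finset.sum_ite_eq' (Finset.range f) 0 (fun _ => (-1 : F)), if_pos]
  rw [Finset.mem_range]; omega

lemma norm_lam_lt (hpn : ‖(p : C)‖ = (p : ℝ)⁻¹) {ζ : C} (hζ : IsPrimitiveRoot ζ p) : ‖ζ - 1‖ < 1 := by
  have hp : p.Prime := Fact.out
  have h := norm_lam hpn hζ
  by_contra! h2
  have h3 := one_le_pow₀ h2 (n := p - 1)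
  rw [h] at h3
  have : (p : ℝ)⁻¹ < 1 := inv_lt_one_of_one_lt₀ (by exact_mod_cast hp.one_lt)
  linarith

lemma norm_lam_pos {ζ : C} (hζ : IsPrimitiveRoot ζ p) : 0 < ‖ζ - 1‖ := by
  have hp : p.Prime := Fact.out
  rw [norm_pos_iff, sub_ne_zero]
  exact hζ.ne_one hp.one_lt

lemma exists_omega (hpn : ‖(p : C)‖ = (p : ℝ)⁻¹) (hf : f ≠ 0) (hcard : Fintype.card F = p ^ f) (hq : 2 < p ^ f)
    {ζ : C} (hζ : IsPrimitiveRoot ζ p) :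
    ∃ ω : MulChar F C, orderOf ω = p ^ f - 1 ∧ ‖gaussSum ω (trChar F hζ)‖ = ‖ζ - 1‖ := by
  have hp : p.Prime := Fact.out
  obtain ⟨ι, Ω, hred, hord⟩ := exists_teich (F := F) hpn hf hcard
  set ω := Ω.ringHomComp (ballRing C).subtype with hω
  refine ⟨ω⁻¹, by rw [orderOf_inv, hord], ?_⟩
  have hω1 : ω⁻¹ ≠ 1 := by
    intro h
    have : orderOf ω = 1 := by rw [← orderOf_inv, h, orderOf_one]
    omega
  have hz1 : ‖ζ‖ = 1 := norm_of_pow_one hp.ne_zero hζ.pow_eq_one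
  let zt : ballRing C := ⟨ζ, hz1.le⟩
  let t : F → ℕ := fun x => (Algebra.trace (ZMod p) F x).val
  let W : ballRing C := ∑ x : F, Ω x⁻¹ * ∑ i ∈ Finset.range (t x), zt ^ i
  have hG : gaussSum ω⁻¹ (trChar F hζ) = (W : C) * (ζ - 1) := by
    have h0 := MulChar.sum_eq_zero_of_ne_one hω1
    have : gaussSum ω⁻¹ (trChar F hζ) = ∑ x, ω⁻¹ x * (ζ ^ t x - 1) := by
      simp_rw [mul_sub, mul_one, Finset.sum_sub_distrib, h0, sub_zero]
      simp only [gaussSum, trChar_apply, t]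
    rw [this]
    simp only [W, AddSubmonoidClass.coe_finset_sum, Subring.coe_mul, SubmonoidClass.coe_pow]
    rw [Finset.sum_mul]
    refine Finset.sum_congr rfl fun x _ => ?_
    rw [mul_assoc, geom_sum_mul, MulChar.inv_apply']
    rfl
  have hzt : redm C zt = 1 := by
    have : redm C (zt - 1) = 0 := by
      rw [redm_eq_zero]
      exact norm_lam_lt hpn hζ
    rwa [map_sub, map_one, sub_eq_zero] at this
  have hW : redm C W = -1 := by
    have h1 : redm C W = ι (∑ x : F, x⁻¹ * algebraMap (ZMod p) F (Algebra.trace (ZMod p) F x)) := by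
      simp only [W]
      rw [map_sum, map_sum]
      refine Finset.sum_congr rfl fun x _ => ?_
      rw [map_mul, map_mul, hred, map_sum]
      simp only [map_pow, hzt, one_pow, Finset.sum_const, Finset.card_range, nsmul_eq_mul, mul_one]
      congr 1
      have : algebraMap (ZMod p) F (Algebra.trace (ZMod p) F x) = ((t x : ℕ) : F) := by
        conv_lhs => rw [← ZMod.natCast_zmod_val (Algebra.trace (ZMod p) F x)]
        rw [map_natCast]
      rw [this, map_natCast]
    rw [h1, sum_inv_trace hf hcard hq, map_neg, map_one]
  have hWn : ‖(W : C)‖ = 1 := by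
    rw [← redm_ne_zero, hW]; simp
  rw [hG, norm_mul, hWn, one_mul]

lemma norm_mulChar_le (φ : MulChar F C) (x : F) : ‖φ x‖ ≤ 1 := by
  by_cases hx : IsUnit x
  · obtain ⟨u, rfl⟩ := hx
    rw [norm_of_pow_one (n := Fintype.card Fˣ) Fintype.card_ne_zero]
    rw [← map_pow, ← Units.val_pow_eq_pow_val, pow_card_eq_one, Units.val_one, map_one]
  · rw [φ.map_nonunit hx]; simp

lemma norm_jacobi_le (φ χ : MulChar F C) : ‖jacobiSum φ χ‖ ≤ 1 := by
  refine ultra_sum_le _ _ fun x _ => ?_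
  rw [norm_mul]
  exact mul_le_one₀ (norm_mulChar_le _ _) (norm_nonneg _) (norm_mulChar_le _ _)

lemma good_step {ζ : C} (hζ : IsPrimitiveRoot ζ p) {ω : MulChar F C}
    (hω : orderOf ω = p ^ f - 1) (hG : ‖gaussSum ω (trChar F hζ)‖ = ‖ζ - 1‖) (k s e : ℕ)
    (h : k < p ^ f - 1 → ‖ζ - 1‖ ^ s ≤ ‖gaussSum (ω ^ k) (trChar F hζ)‖) (hk : k + p ^ e < p ^ f - 1) :
    ‖ζ - 1‖ ^ (s + 1) ≤ ‖gaussSum (ω ^ (k + p ^ e)) (trChar F hζ)‖ := by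
  have hp : p.Prime := Fact.out
  have hpos : 0 < p ^ e := pow_pos hp.pos e
  have hne : ω ^ k * ω ^ p ^ e ≠ 1 := by
    rw [← pow_add]
    intro h1
    have := Nat.le_of_dvd (by omega) (orderOf_dvd_of_pow_eq_one h1)
    omega
  have hj := congrArg norm (jacobiSum_mul_nontrivial hne (trChar F hζ))
  rw [norm_mul, norm_mul, gauss_pow_p_pow, hG, ← pow_add] at hj
  rw [pow_succ]
  calc ‖ζ - 1‖ ^ s * ‖ζ - 1‖ ≤ ‖gaussSum (ω ^ k) (trChar F hζ)‖ * ‖ζ - 1‖ := by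
        gcongr; exact h (by omega)
    _ = _ := hj.symm
    _ ≤ _ := mul_le_of_le_one_right (norm_nonneg _) (norm_jacobi_le _ _)

lemma good_digits {ζ : C} (hζ : IsPrimitiveRoot ζ p) {ω : MulChar F C}
    (hω : orderOf ω = p ^ f - 1) (hG : ‖gaussSum ω (trChar F hζ)‖ = ‖ζ - 1‖) (d : ℕ → ℕ) (e : ℕ → ℕ) (J : ℕ)
    (hk : ∑ j ∈ Finset.range J, d j * p ^ e j < p ^ f - 1) :
    ‖ζ - 1‖ ^ (∑ j ∈ Finset.range J, d j) ≤ ‖gaussSum (ω ^ (∑ j ∈ Finset.range J, d j * p ^ e j)) (trChar F hζ)‖ := by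
  induction J with
  | zero => simp [gaussSum_one_left (trChar_ne_one hζ)]
  | succ J ih =>
    rw [Finset.sum_range_succ] at hk
    have ih := ih (by omega)
    rw [Finset.sum_range_succ, Finset.sum_range_succ]
    generalize ∑ j ∈ Finset.range J, d j * p ^ e j = K at *
    generalize ∑ j ∈ Finset.range J, d j = s at *
    generalize d J = t at *
    induction t with
    | zero => simpa using ih
    | succ t iht =>
      have h1 : K + (t + 1) * p ^ e J = (K + t * p ^ e J) + p ^ e J := by ring
      rw [h1] at hk ⊢
      exact good_step hζ hω hG _ (s + t) (e J) (fun _ => iht (by omega)) hk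

end B3

section B4

lemma digit_tel (p n f : ℕ) (J : ℕ) (hJ : J ≤ f) (hn : 1 < n) :
    (n : ℤ) * ∑ j ∈ Finset.range J, ((p * (p ^ j % n) / n : ℕ) : ℤ) * (p : ℤ) ^ (f - 1 - j) =
      (p : ℤ) ^ f - ((p ^ J % n : ℕ) : ℤ) * (p : ℤ) ^ (f - J) := by
  induction J with
  | zero => simp [Nat.mod_eq_of_lt hn]
  | succ J ih =>
    rw [Finset.sum_range_succ, mul_add, ih (by omega)]
    have h1 : p ^ (J + 1) % n = (p * (p ^ J % n)) % n := by
      rw [pow_succ', Nat.mul_mod_mod]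
    have h2 := Nat.div_add_mod (p * (p ^ J % n)) n
    rw [← h1] at h2
    have h3 : (n : ℤ) * ((p * (p ^ J % n) / n : ℕ) : ℤ) + ((p ^ (J + 1) % n : ℕ) : ℤ) = p * ((p ^ J % n : ℕ) : ℤ) := by
      exact_mod_cast h2
    have h4 : f - J = (f - 1 - J) + 1 := by omega
    have h5 : f - (J + 1) = f - 1 - J := by omega
    rw [h4, h5, pow_succ]
    linear_combination ((p : ℤ) ^ (f - 1 - J)) * h3

lemma digit_sum (p n : ℕ) (J : ℕ) (hn : 1 < n) :
    (n : ℤ) * ∑ j ∈ Finset.range J, ((p * (p ^ j % n) / n : ℕ) : ℤ) =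
      (p - 1) * ∑ j ∈ Finset.range J, ((p ^ j % n : ℕ) : ℤ) + 1 - ((p ^ J % n : ℕ) : ℤ) := by
  induction J with
  | zero => simp [Nat.mod_eq_of_lt hn]
  | succ J ih =>
    rw [Finset.sum_range_succ, mul_add, ih, Finset.sum_range_succ]
    have h1 : p ^ (J + 1) % n = (p * (p ^ J % n)) % n := by
      rw [pow_succ', Nat.mul_mod_mod]
    have h2 := Nat.div_add_mod (p * (p ^ J % n)) n
    rw [← h1] at h2
    have h3 : (n : ℤ) * ((p * (p ^ J % n) / n : ℕ) : ℤ) + ((p ^ (J + 1) % n : ℕ) : ℤ) = p * ((p ^ J % n : ℕ) : ℤ) := by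
      exact_mod_cast h2
    linear_combination h3

lemma geo_tel (p f : ℕ) (J : ℕ) (hJ : J ≤ f) :
    ∑ j ∈ Finset.range J, ((p : ℤ) - 1) * (p : ℤ) ^ (f - 1 - j) = (p : ℤ) ^ f - (p : ℤ) ^ (f - J) := by
  induction J with
  | zero => simp
  | succ J ih =>
    rw [Finset.sum_range_succ, ih (by omega)]
    have h4 : f - J = (f - 1 - J) + 1 := by omega
    have h5 : f - (J + 1) = f - 1 - J := by omega
    rw [h4, h5, pow_succ]; ring

variable {C : Type*} [NormedField C] [IsUltrametricDist C] [IsAlgClosed C] [CharZero C] {p : ℕ} [Fact p.Prime]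
  {F : Type*} [Field F] [Fintype F] [Algebra (ZMod p) F] {f : ℕ}

theorem stickelberger_bound (hpn : ‖(p : C)‖ = (p : ℝ)⁻¹) (hf : f ≠ 0) (hcard : Fintype.card F = p ^ f) (hq : 2 < p ^ f)
    {ζ : C} (hζ : IsPrimitiveRoot ζ p) {n : ℕ} (hn : 1 < n) (hnq : n ∣ p ^ f - 1) :
    ∃ φ : MulChar F C, orderOf φ = n ∧
      ((p : ℝ)⁻¹) ^ (∑ j ∈ Finset.range f, p ^ j % n) ≤ ‖gaussSum φ (trChar F hζ)‖ ^ n ∧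
      ((p : ℝ)⁻¹) ^ (∑ j ∈ Finset.range f, (n - p ^ j % n)) ≤ ‖gaussSum φ⁻¹ (trChar F hζ)‖ ^ n := by
  have hp : p.Prime := Fact.out
  obtain ⟨ω, hord, hG⟩ := exists_omega (F := F) hpn hf hcard hq hζ
  obtain ⟨M, hM⟩ := hnq
  have hMpos : 0 < M := by
    rcases Nat.eq_zero_or_pos M with h | h
    · subst h; omega
    · exact h
  have hMlt : M < p ^ f - 1 := by rw [hM]; exact lt_mul_of_one_lt_left hMpos hn
  set d : ℕ → ℕ := fun j => p * (p ^ j % n) / n with hd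
  have hrf : p ^ f % n = 1 := by
    have : p ^ f = 1 + n * M := by omega
    rw [this, Nat.add_mul_mod_self_left, Nat.mod_eq_of_lt hn]
  have hdlt : ∀ j, d j ≤ p - 1 := by
    intro j
    have : d j < p := by
      rw [hd]
      apply Nat.div_lt_of_lt_mul
      rw [mul_comm n p]
      exact Nat.mul_lt_mul_of_pos_left (Nat.mod_lt _ (by omega)) hp.pos
    omega
  have hn0 : (n : ℤ) ≠ 0 := by exact_mod_cast (by omega : n ≠ 0)
  have hMz : (n : ℤ) * M = (p : ℤ) ^ f - 1 := by
    have : p ^ f = 1 + n * M := by omega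
    have : ((p ^ f : ℕ) : ℤ) = ((1 + n * M : ℕ) : ℤ) := by rw [this]
    push_cast at this; linarith
  have e1z : ∑ j ∈ Finset.range f, (d j : ℤ) * (p : ℤ) ^ (f - 1 - j) = M := by
    have := digit_tel p n f f le_rfl hn
    rw [hrf] at this
    apply mul_left_cancel₀ hn0
    rw [this, hMz]; simp
  have e1 : ∑ j ∈ Finset.range f, d j * p ^ (f - 1 - j) = M := by exact_mod_cast e1z
  have hcast : ∀ j, ((p - 1 - d j : ℕ) : ℤ) = (p : ℤ) - 1 - d j := by
    intro j
    have := hdlt j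
    have := hp.pos
    omega
  have e2 : ∑ j ∈ Finset.range f, (p - 1 - d j) * p ^ (f - 1 - j) = p ^ f - 1 - M := by
    have h1 : ((∑ j ∈ Finset.range f, (p - 1 - d j) * p ^ (f - 1 - j) : ℕ) : ℤ) = (p : ℤ) ^ f - 1 - M := by
      push_cast
      simp_rw [hcast, sub_mul _ ((d _ : ℕ) : ℤ), Finset.sum_sub_distrib, e1z, geo_tel p f f le_rfl]
      simp
    have h2 : ((p ^ f : ℕ) : ℤ) = (p : ℤ) ^ f := by push_cast; rfl
    rw [← h2] at h1
    omega
  have s1 : n * ∑ j ∈ Finset.range f, d j = (p - 1) * ∑ j ∈ Finset.range f, p ^ j % n := by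
    have := digit_sum p n f hn
    rw [hrf] at this
    zify [hp.one_le]
    rw [this]; push_cast; ring
  have s2 : n * ∑ j ∈ Finset.range f, (p - 1 - d j) = (p - 1) * ∑ j ∈ Finset.range f, (n - p ^ j % n) := by
    have := digit_sum p n f hn
    rw [hrf] at this
    have hc : ∀ j, ((n - p ^ j % n : ℕ) : ℤ) = (n : ℤ) - ((p ^ j % n : ℕ) : ℤ) := by
      intro j
      have := Nat.mod_lt (p ^ j) (by omega : n > 0)
      omega
    zify [hp.one_le]
    simp_rw [hc, hcast, Finset.sum_sub_distrib, mul_sub]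
    rw [this]
    simp; ring
  have g1 := good_digits hζ hord hG d (fun j => f - 1 - j) f (by rw [e1]; exact hMlt)
  have g2 := good_digits hζ hord hG (fun j => p - 1 - d j) (fun j => f - 1 - j) f (by rw [e2]; omega)
  rw [e1] at g1
  rw [e2] at g2
  have hinv : ω ^ (p ^ f - 1 - M) = (ω ^ M)⁻¹ := by
    rw [eq_inv_iff_mul_eq_one, ← pow_add, Nat.sub_add_cancel hMlt.le, ← hord, pow_orderOf_eq_one]
  rw [hinv] at g2
  refine ⟨ω ^ M, ?_, ?_, ?_⟩
  · rw [orderOf_pow, hord, hM, Nat.gcd_mul_left_left, Nat.mul_div_cancel _ hMpos]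
  · have := pow_le_pow_left₀ (by positivity) g1 n
    rwa [← pow_mul, mul_comm _ n, s1, pow_mul, norm_lam hpn hζ] at this
  · have := pow_le_pow_left₀ (by positivity) g2 n
    rwa [← pow_mul, mul_comm _ n, s2, pow_mul, norm_lam hpn hζ] at this

end B4

section C1
variable {p₁ m p f : ℕ}

lemma C1_coprime (N : ℕ) (hp : p.Prime) (hN0 : N ≠ 0) (hf : f = orderOf ((p : ZMod N)))
   (hford : 2 * f = Nat.totient N) : Nat.Coprime p N := by
  have hf0 : 0 < f := by
    have := Nat.totient_pos.mpr (Nat.pos_of_ne_zero hN0)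
    omega
  have h1 : (p : ZMod N) ^ f = 1 := by rw [hf]; exact pow_orderOf_eq_one _
  have : IsUnit (p : ZMod N) := IsUnit.of_pow_eq_one h1 hf0.ne'
  exact (ZMod.isUnit_iff_coprime p N).mp this

lemma C1_f (hp₁ : p₁.Prime) (hmod : p₁ % 8 = 3) (hm : 1 ≤ m)
   (hford : 2 * f = Nat.totient (2 * p₁ ^ m)) : f = p₁ ^ (m - 1) * ((p₁ - 1) / 2) ∧ f % 2 = 1 ∧ 2 * f = Nat.totient (p₁ ^ m) := by
  have hodd : Odd p₁ := Nat.odd_iff.mpr (by omega)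
  have hc : Nat.Coprime 2 (p₁ ^ m) := by
    rw [Nat.coprime_two_left]; exact hodd.pow
  rw [Nat.totient_mul hc, Nat.totient_two, one_mul] at hford
  refine ⟨?_, ?_, hford⟩
  · rw [Nat.totient_prime_pow hp₁ (by omega)] at hford
    have h2 : p₁ - 1 = 2 * ((p₁ - 1) / 2) := by omega
    rw [h2] at hford
    have : p₁ ^ (m - 1) * (2 * ((p₁ - 1) / 2)) = 2 * (p₁ ^ (m - 1) * ((p₁ - 1) / 2)) := by ring
    rw [this] at hford
    omega
  · rw [Nat.totient_prime_pow hp₁ (by omega)] at hford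
    have h2 : p₁ - 1 = 2 * ((p₁ - 1) / 2) := by omega
    rw [h2] at hford
    have : p₁ ^ (m - 1) * (2 * ((p₁ - 1) / 2)) = 2 * (p₁ ^ (m - 1) * ((p₁ - 1) / 2)) := by ring
    rw [this] at hford
    have h3 : f = p₁ ^ (m - 1) * ((p₁ - 1) / 2) := by omega
    rw [h3, ← Nat.odd_iff]
    exact (hodd.pow).mul (Nat.odd_iff.mpr (by omega))

lemma C1_ord (hp₁ : p₁.Prime) (hmod : p₁ % 8 = 3) (hm : 1 ≤ m) (hp : p.Prime)
   (hf : f = orderOf ((p : ZMod (2 * p₁ ^ m)))) (hford : 2 * f = Nat.totient (2 * p₁ ^ m)) :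
   Nat.Coprime p (p₁ ^ m) ∧ p % 2 = 1 ∧ orderOf ((p : ZMod (p₁ ^ m))) = f := by
  have hN0 : 2 * p₁ ^ m ≠ 0 := by have := pow_pos hp₁.pos m; omega
  have hc := C1_coprime _ hp hN0 hf hford
  have h1 : Nat.Coprime p 2 := Nat.Coprime.coprime_mul_right_right hc
  have h2 : Nat.Coprime p (p₁ ^ m) := Nat.Coprime.coprime_mul_left_right hc
  have hodd : p % 2 = 1 := by rw [Nat.coprime_comm, Nat.coprime_two_left] at h1; exact Nat.odd_iff.mp h1
  refine ⟨h2, hodd, ?_⟩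
  rw [hf]
  have hiff : ∀ k, (p : ZMod (p₁ ^ m)) ^ k = 1 ↔ (p : ZMod (2 * p₁ ^ m)) ^ k = 1 := by
    intro k
    have e1 : (p : ZMod (p₁ ^ m)) ^ k = 1 ↔ p ^ k ≡ 1 [MOD p₁ ^ m] := by
      rw [← ZMod.natCast_eq_natCast_iff]; push_cast; rfl
    have e2 : (p : ZMod (2 * p₁ ^ m)) ^ k = 1 ↔ p ^ k ≡ 1 [MOD 2 * p₁ ^ m] := by
      rw [← ZMod.natCast_eq_natCast_iff]; push_cast; rfl
    rw [e1, e2]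
    have hodd1 : Odd p₁ := Nat.odd_iff.mpr (by omega)
    have hc2 : Nat.Coprime 2 (p₁ ^ m) := by
      rw [Nat.coprime_two_left]; exact hodd1.pow
    rw [← Nat.modEq_and_modEq_iff_modEq_mul hc2]
    constructor
    · intro h
      refine ⟨?_, h⟩
      have : p ^ k % 2 = 1 := Nat.odd_iff.mp ((Nat.odd_iff.mpr hodd).pow)
      exact this
    · exact fun h => h.2
  apply Nat.dvd_antisymm
  · apply orderOf_dvd_of_pow_eq_one; rw [hiff]; exact pow_orderOf_eq_one _
  · apply orderOf_dvd_of_pow_eq_one; rw [← hiff]; exact pow_orderOf_eq_one _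

lemma C1_char [Fact p₁.Prime] (hmod : p₁ % 8 = 3) (hm : 1 ≤ m)
    (hcop : Nat.Coprime p (p₁ ^ m)) (hord : orderOf ((p : ZMod (p₁ ^ m))) = f) (hfodd : f % 2 = 1)
    (hford : 2 * f = Nat.totient (p₁ ^ m)) :
    quadraticChar (ZMod p₁) p = 1 ∧ 
    ∀ a : ℕ, quadraticChar (ZMod p₁) a = 1 → ∃ k, p ^ k ≡ a [MOD p₁ ^ m] := by
  have hp₁ : p₁.Prime := Fact.out
  have : NeZero (p₁ ^ m) := ⟨(pow_pos hp₁.pos m).ne'⟩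
  have hdvd : p₁ ∣ p₁ ^ m := dvd_pow_self _ (by omega)
  let red : (ZMod (p₁ ^ m))ˣ →* (ZMod p₁)ˣ := Units.map (ZMod.castHom hdvd (ZMod p₁)).toMonoidHom
  let χ' : (ZMod (p₁ ^ m))ˣ →* ℤˣ := ((quadraticChar (ZMod p₁)).toUnitHom).comp red
  have hχ' : ∀ u : (ZMod (p₁ ^ m))ˣ, ((χ' u : ℤˣ) : ℤ) = quadraticChar (ZMod p₁) (ZMod.castHom hdvd (ZMod p₁) u) := by
    intro u
    simp [χ', red, MulChar.coe_toUnitHom]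
  let pu : (ZMod (p₁ ^ m))ˣ := ZMod.unitOfCoprime p hcop
  have hpu : (pu : ZMod (p₁ ^ m)) = p := rfl
  have hopu : orderOf pu = f := by rw [← orderOf_units, hpu, hord]
  have hχp : χ' pu = 1 := by
    have h1 : χ' pu ^ f = 1 := by rw [← map_pow, ← hopu, pow_orderOf_eq_one, map_one]
    rcases Int.units_eq_one_or (χ' pu) with h | h
    · exact h
    · rw [h, (Nat.odd_iff.mpr hfodd).neg_one_pow] at h1
      exact absurd h1 (by decide)
  have hp2 : p₁ ≠ 2 := by rintro rfl; omega
  have hneg : χ' (-1) ≠ 1 := by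
    intro h
    have h2 := hχ' (-1)
    rw [h] at h2
    simp only [Units.val_one, Units.val_neg, map_neg, map_one] at h2
    rw [quadraticChar_neg_one (by rwa [ZMod.ringChar_zmod_n]), ZMod.card, ZMod.χ₄_nat_three_mod_four (by omega)] at h2
    norm_num at h2
  have hle : Subgroup.zpowers pu ≤ χ'.ker := by
    rw [Subgroup.zpowers_le]; exact hχp
  have hcardU : Nat.card (ZMod (p₁ ^ m))ˣ = 2 * f := by
    rw [hford, Nat.card_eq_fintype_card, ZMod.card_units_eq_totient]
  have heq : Subgroup.zpowers pu = χ'.ker := by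
    apply Subgroup.eq_of_le_of_card_ge hle
    rw [Nat.card_zpowers, hopu]
    have h1 := Subgroup.card_mul_index χ'.ker
    rw [hcardU] at h1
    have h2 : χ'.ker.index ≠ 1 := by
      rw [Ne, Subgroup.index_eq_one]
      intro h
      exact hneg (by have : (-1 : (ZMod (p₁ ^ m))ˣ) ∈ χ'.ker := by rw [h]; trivial
                     exact this)
    have hf0 : 0 < f := by omega
    have h3 : χ'.ker.index ≠ 0 := by intro h; rw [h] at h1; omega
    nlinarith [Nat.two_le_iff _ |>.mpr ⟨h3, h2⟩]
  constructor
  · have := hχ' pu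
    rw [hχp, hpu] at this
    simpa using this.symm
  · intro a ha
    have hca : Nat.Coprime a (p₁ ^ m) := by
      apply Nat.Coprime.pow_right
      rw [Nat.coprime_comm, hp₁.coprime_iff_not_dvd]
      intro h
      rw [(ZMod.natCast_eq_zero_iff a p₁).mpr h] at ha
      simp at ha
    let au := ZMod.unitOfCoprime a hca
    have hau : (au : ZMod (p₁ ^ m)) = a := rfl
    have hk : au ∈ χ'.ker := by
      have h1 := hχ' au
      rw [hau, map_natCast, ha] at h1
      exact Units.ext h1
    rw [← heq] at hk
    obtain ⟨k, hk⟩ := (Submonoid.mem_powers_iff _ _).mp (mem_powers_iff_mem_zpowers.mpr hk)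
    refine ⟨k, ?_⟩
    rw [← ZMod.natCast_eq_natCast_iff]
    have := congrArg (fun u : (ZMod (p₁ ^ m))ˣ => (u : ZMod (p₁ ^ m))) hk
    simp only [Units.val_pow_eq_pow_val, hpu, hau] at this
    push_cast; exact this

end C1

section C2
variable {p₁ m p f : ℕ}

lemma sum_zmod_range {A : Type*} [AddCommMonoid A] (n : ℕ) [NeZero n] (g : ℕ → A) :
    ∑ a : ZMod n, g a.val = ∑ x ∈ Finset.range n, g x := by
  refine Finset.sum_bij (fun a _ => a.val) ?_ ?_ ?_ ?_
  · intro a _; exact Finset.mem_range.mpr (ZMod.val_lt a)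
  · intro a _ b _ h; exact ZMod.val_injective n h
  · intro b hb
    exact ⟨(b : ZMod n), Finset.mem_univ _, ZMod.val_cast_of_lt (Finset.mem_range.mp hb)⟩
  · intro a _; rfl

lemma C2_blocks [Fact p₁.Prime] (hp2 : p₁ ≠ 2) (t : ℕ) :
    ∑ x ∈ Finset.range (t * p₁), (x : ℤ) * quadraticChar (ZMod p₁) (x : ZMod p₁) =
      t * ∑ a : ZMod p₁, (a.val : ℤ) * quadraticChar (ZMod p₁) a := by
  have hz : ∑ x ∈ Finset.range p₁, quadraticChar (ZMod p₁) (x : ZMod p₁) = 0 := by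
    rw [← sum_zmod_range p₁ (fun x => quadraticChar (ZMod p₁) (x : ZMod p₁))]
    simp only [ZMod.natCast_zmod_val]
    exact quadraticChar_sum_zero (by rwa [ZMod.ringChar_zmod_n])
  have hs : ∑ a : ZMod p₁, (a.val : ℤ) * quadraticChar (ZMod p₁) a = ∑ x ∈ Finset.range p₁, (x : ℤ) * quadraticChar (ZMod p₁) (x : ZMod p₁) := by
    rw [← sum_zmod_range p₁ (fun x => (x : ℤ) * quadraticChar (ZMod p₁) (x : ZMod p₁))]
    simp only [ZMod.natCast_zmod_val]
  induction t with
  | zero => simp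
  | succ t ih =>
    rw [add_mul, one_mul, Finset.sum_range_add, ih]
    have : ∀ x ∈ Finset.range p₁, ((t * p₁ + x : ℕ) : ℤ) * quadraticChar (ZMod p₁) ((t * p₁ + x : ℕ) : ZMod p₁) =
      (t * p₁ : ℤ) * quadraticChar (ZMod p₁) (x : ZMod p₁) + (x : ℤ) * quadraticChar (ZMod p₁) (x : ZMod p₁) := by
      intro x _
      have e : ((t * p₁ + x : ℕ) : ZMod p₁) = x := by simp
      rw [e]; push_cast; ring
    rw [Finset.sum_congr rfl this, Finset.sum_add_distrib, ← Finset.mul_sum, hz, ← hs]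
    push_cast; ring

lemma C2_sum [Fact p₁.Prime] (hmod : p₁ % 8 = 3) (hm : 1 ≤ m)
    (hcop : Nat.Coprime p (p₁ ^ m)) (hord : orderOf ((p : ZMod (p₁ ^ m))) = f) (hfodd : f % 2 = 1)
    (hford : 2 * f = Nat.totient (p₁ ^ m)) :
    (2 * (∑ j ∈ Finset.range f, p ^ j % p₁ ^ m : ℕ) - (p₁ ^ m : ℕ) * f : ℤ) =
      (p₁ ^ (m - 1) : ℕ) * ∑ a : ZMod p₁, (a.val : ℤ) * quadraticChar (ZMod p₁) a := by
  have hp₁ : p₁.Prime := Fact.out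
  have hp2 : p₁ ≠ 2 := by rintro rfl; omega
  have : NeZero (p₁ ^ m) := ⟨(pow_pos hp₁.pos m).ne'⟩
  obtain ⟨hχp, hχ⟩ := C1_char hmod hm hcop hord hfodd hford
  rw [← C2_blocks hp2, ← pow_succ, Nat.sub_add_cancel hm]
  set n := p₁ ^ m with hn
  have hdvd : p₁ ∣ n := dvd_pow_self _ (by omega)
  have hn0 : 0 < n := pow_pos hp₁.pos m
  have hχmod : ∀ x, quadraticChar (ZMod p₁) ((x % n : ℕ) : ZMod p₁) = quadraticChar (ZMod p₁) (x : ZMod p₁) := by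
    intro x
    congr 1
    rw [ZMod.natCast_eq_natCast_iff]
    exact (Nat.mod_modEq x n).of_dvd hdvd
  have hR : (Finset.range n).filter (fun x : ℕ => quadraticChar (ZMod p₁) (x : ZMod p₁) = 1) =
      (Finset.range f).image (fun j => p ^ j % n) := by
    ext x
    simp only [Finset.mem_filter, Finset.mem_range, Finset.mem_image]
    constructor
    · rintro ⟨hx, h1⟩
      obtain ⟨k, hk⟩ := hχ x h1
      refine ⟨k % f, Nat.mod_lt _ (by omega), ?_⟩
      have : p ^ (k % f) ≡ p ^ k [MOD n] := by
        rw [← ZMod.natCast_eq_natCast_iff]; push_cast; rw [← hord, pow_mod_orderOf]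
      have h2 : p ^ (k % f) % n = x % n := this.trans hk
      rw [h2, Nat.mod_eq_of_lt hx]
    · rintro ⟨j, hj, rfl⟩
      refine ⟨Nat.mod_lt _ hn0, ?_⟩
      rw [hχmod]; push_cast; rw [map_pow, hχp, one_pow]
  have hinj : Set.InjOn (fun j => p ^ j % n) (Finset.range f : Set ℕ) := by
    intro i hi j hj h
    simp only [Finset.coe_range, Set.mem_Iio] at hi hj
    have h2 : p ^ i ≡ p ^ j [MOD n] := h
    rw [← ZMod.natCast_eq_natCast_iff] at h2
    push_cast at h2
    exact pow_injOn_Iio_orderOf (by simpa [hord] using hi) (by simpa [hord] using hj) h2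
  have hS : ∑ x ∈ (Finset.range n).filter (fun x : ℕ => quadraticChar (ZMod p₁) (x : ZMod p₁) = 1), (x : ℤ) = (∑ j ∈ Finset.range f, p ^ j % n : ℕ) := by
    rw [hR, Finset.sum_image hinj]; push_cast; rfl
  have hcardR : ((Finset.range n).filter (fun x : ℕ => quadraticChar (ZMod p₁) (x : ZMod p₁) = 1)).card = f := by
    rw [hR, Finset.card_image_of_injOn hinj, Finset.card_range]
  have hneg1 : quadraticChar (ZMod p₁) (-1) = -1 := by
    rw [quadraticChar_neg_one (by rwa [ZMod.ringChar_zmod_n]), ZMod.card, ZMod.χ₄_nat_three_mod_four (by omega)]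
  have hflip : ∀ x, x ≤ n → quadraticChar (ZMod p₁) ((n - x : ℕ) : ZMod p₁) = - quadraticChar (ZMod p₁) (x : ZMod p₁) := by
    intro x hx
    rw [Nat.cast_sub hx, (ZMod.natCast_eq_zero_iff n p₁).mpr hdvd, zero_sub, neg_eq_neg_one_mul, map_mul, hneg1, neg_one_mul]
  have hzero : quadraticChar (ZMod p₁) ((0 : ℕ) : ZMod p₁) = 0 := by simp
  have hT : ∑ x ∈ (Finset.range n).filter (fun x : ℕ => quadraticChar (ZMod p₁) (x : ZMod p₁) = -1), (x : ℤ) =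
      ∑ x ∈ (Finset.range n).filter (fun x : ℕ => quadraticChar (ZMod p₁) (x : ZMod p₁) = 1), ((n : ℤ) - x) := by
    refine Finset.sum_bij (fun x _ => n - x) ?_ ?_ ?_ ?_
    · intro x hx
      simp only [Finset.mem_filter, Finset.mem_range] at hx ⊢
      have hx0 : x ≠ 0 := by rintro rfl; rw [hzero] at hx; simp at hx
      refine ⟨by omega, ?_⟩
      rw [hflip x hx.1.le, hx.2, neg_neg]
    · intro x hx y hy h
      simp only [Finset.mem_filter, Finset.mem_range] at hx hy
      omega
    · intro y hy
      simp only [Finset.mem_filter, Finset.mem_range] at hy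
      have hy0 : y ≠ 0 := by rintro rfl; rw [hzero] at hy; simp at hy
      refine ⟨n - y, ?_, by omega⟩
      simp only [Finset.mem_filter, Finset.mem_range]
      refine ⟨by omega, ?_⟩
      rw [hflip y hy.1.le, hy.2]
    · intro x hx
      simp only [Finset.mem_filter, Finset.mem_range] at hx
      omega
  have hsplit : ∑ x ∈ Finset.range n, (x : ℤ) * quadraticChar (ZMod p₁) (x : ZMod p₁) =
     ∑ x ∈ (Finset.range n).filter (fun x : ℕ => quadraticChar (ZMod p₁) (x : ZMod p₁) = 1), (x : ℤ) -
     ∑ x ∈ (Finset.range n).filter (fun x : ℕ => quadraticChar (ZMod p₁) (x : ZMod p₁) = -1), (x : ℤ) := by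
    rw [Finset.sum_filter, Finset.sum_filter, ← Finset.sum_sub_distrib]
    refine Finset.sum_congr rfl fun x _ => ?_
    by_cases hx : (x : ZMod p₁) = 0
    · simp [hx]
    · rcases quadraticChar_dichotomy hx with h | h <;> rw [h] <;> norm_num
  rw [hsplit, hT, Finset.sum_sub_distrib, hS, Finset.sum_const, hcardR]
  simp only [nsmul_eq_mul]
  ring

end C2

section C3
variable {C : Type*} [Field C] [CharZero C]

lemma rootpow_val {n : ℕ} [NeZero n] {ξ : C} (h : ξ ^ n = 1) (k : ℕ) : ξ ^ ((k : ZMod n)).val = ξ ^ k := by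
  rw [ZMod.val_natCast]
  exact (pow_eq_pow_mod k h).symm

/-- quadratic Gauss sum -/
noncomputable def qtau (p₁ : ℕ) [Fact p₁.Prime] (ξ : C) : C :=
  ∑ a : ZMod p₁, ((quadraticChar (ZMod p₁) a : ℤ) : C) * ξ ^ a.val

lemma qtau_pow {p₁ : ℕ} [Fact p₁.Prime] {ξ : C} (h : ξ ^ p₁ = 1) (t : ℕ) (ht : (t : ZMod p₁) ≠ 0) :
    qtau p₁ (ξ ^ t) = ((quadraticChar (ZMod p₁) (t : ZMod p₁) : ℤ) : C) * qtau p₁ ξ := by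
  unfold qtau
  rw [Finset.mul_sum]
  refine Fintype.sum_equiv (Equiv.mulLeft₀ (t : ZMod p₁) ht) _ _ ?_
  intro a
  change _ = _ * (_ * ξ ^ ((t : ZMod p₁) * a).val)
  rw [show (Equiv.mulLeft₀ (t : ZMod p₁) ht) a = (t : ZMod p₁) * a from rfl]
  have h1 : ξ ^ ((t : ZMod p₁) * a).val = (ξ ^ t) ^ a.val := by
    rw [← pow_mul, ← rootpow_val h (t * a.val)]
    push_cast; rw [ZMod.natCast_zmod_val]
  rw [h1, map_mul]
  have h2 := quadraticChar_sq_one ht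
  push_cast
  have h3 : ((quadraticChar (ZMod p₁) (t : ZMod p₁) : ℤ) : C) ^ 2 = 1 := by exact_mod_cast h2
  linear_combination (-(((quadraticChar (ZMod p₁) a : ℤ) : C) * (ξ ^ t) ^ a.val)) * h3

lemma chi_neg_one {p₁ : ℕ} [Fact p₁.Prime] (hmod : p₁ % 8 = 3) : quadraticChar (ZMod p₁) (-1) = -1 := by
  have hp2 : p₁ ≠ 2 := by rintro rfl; omega
  rw [quadraticChar_neg_one (by rwa [ZMod.ringChar_zmod_n]), ZMod.card, ZMod.χ₄_nat_three_mod_four (by omega)]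

lemma qtau_inv {p₁ : ℕ} [Fact p₁.Prime] (hmod : p₁ % 8 = 3) {ξ : C} (h : ξ ^ p₁ = 1) :
    qtau p₁ ξ⁻¹ = - qtau p₁ ξ := by
  have hp₁ : p₁.Prime := Fact.out
  have h1 : ξ⁻¹ = ξ ^ (p₁ - 1) := by
    apply inv_eq_of_mul_eq_one_right
    rw [← pow_succ', Nat.sub_add_cancel hp₁.one_le, h]
  have h2 : ((p₁ - 1 : ℕ) : ZMod p₁) = -1 := by
    rw [Nat.cast_sub hp₁.one_le]; simp
  rw [h1, qtau_pow h, h2, chi_neg_one hmod]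
  · push_cast; ring
  · rw [h2]; simp

lemma qtau_sq {p₁ : ℕ} [Fact p₁.Prime] (hmod : p₁ % 8 = 3) {ξ : C} (h : IsPrimitiveRoot ξ p₁) :
    qtau p₁ ξ ^ 2 = - (p₁ : C) := by
  have hp₁ : p₁.Prime := Fact.out
  have hp2 : p₁ ≠ 2 := by rintro rfl; omega
  have h0 : qtau p₁ ξ = gaussSum ((quadraticChar (ZMod p₁)).ringHomComp (Int.castRingHom C)) (AddChar.zmodChar p₁ h.pow_eq_one) := by
    simp only [qtau, gaussSum, MulChar.ringHomComp_apply, AddChar.zmodChar_apply]; rfl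
  rw [h0, gaussSum_sq]
  · simp [MulChar.ringHomComp_apply, chi_neg_one hmod]
  · intro hh
    have := congrArg (fun c => c (-1)) hh
    simp only [MulChar.ringHomComp_apply, chi_neg_one hmod] at this
    rw [show (-1 : ZMod p₁) = ((-1 : (ZMod p₁)ˣ) : ZMod p₁) by simp, MulChar.one_apply_coe] at this
    norm_num at this
  · exact (quadraticChar_isQuadratic (ZMod p₁)).comp _
  · exact AddChar.zmodChar_primitive_of_primitive_root p₁ h

lemma eq_one_of_coprime_pow {a b : ℕ} (hab : Nat.Coprime a b) {u : C} (ha : u ^ a = 1) (hb : u ^ b = 1) : u = 1 := by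
  have := pow_gcd_eq_one.mpr ⟨ha, hb⟩
  rwa [hab, pow_one] at this

variable {p : ℕ} [Fact p.Prime] {F : Type*} [Field F] [Fintype F] [Algebra (ZMod p) F]

lemma mulChar_pow_one {φ : MulChar F C} {n : ℕ} (h : orderOf φ = n) {x : F} (hx : x ≠ 0) : φ x ^ n = 1 := by
  obtain ⟨u, rfl⟩ := isUnit_iff_ne_zero.mpr hx
  rw [← MulChar.pow_apply_coe, ← h, pow_orderOf_eq_one, MulChar.one_apply_coe]

lemma mulChar_Fp {φ : MulChar F C} {n : ℕ} (h : orderOf φ = n) (hco : Nat.Coprime n (p - 1)) {c : ZMod p} (hc : c ≠ 0) :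
    φ (algebraMap (ZMod p) F c) = 1 := by
  have hp : p.Prime := Fact.out
  have hc' : algebraMap (ZMod p) F c ≠ 0 := by simpa using hc
  apply eq_one_of_coprime_pow hco (mulChar_pow_one h hc')
  rw [← map_pow, ← map_pow, ZMod.pow_card_sub_one_eq_one hc, map_one, map_one]

lemma int_period {ζ : C} (hζ : IsPrimitiveRoot ζ p) (P : F → Prop)
    (hP : ∀ c : ZMod p, c ≠ 0 → ∀ x, P (algebraMap (ZMod p) F c * x) ↔ P x) :
    ∃ k : ℤ, ∑ x ∈ Finset.univ.filter P, trChar F hζ x = k := by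
  have hp : p.Prime := Fact.out
  let M : ZMod p → ℕ := fun t => ((Finset.univ.filter P).filter (fun x => Algebra.trace (ZMod p) F x = t)).card
  have hM : ∀ t, t ≠ 0 → M t = M 1 := by
    intro t ht
    symm
    have hat : algebraMap (ZMod p) F t ≠ 0 := by simpa using ht
    refine Finset.card_bij (fun x _ => algebraMap (ZMod p) F t * x) ?_ ?_ ?_
    · intro x hx
      simp only [Finset.mem_filter, Finset.mem_univ, true_and] at hx ⊢
      refine ⟨(hP t ht x).mpr hx.1, ?_⟩
      rw [← Algebra.smul_def, map_smul, hx.2, smul_eq_mul, mul_one]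
    · intro a _ b _ h
      exact mul_left_cancel₀ hat h
    · intro b hb
      simp only [Finset.mem_filter, Finset.mem_univ, true_and] at hb
      refine ⟨algebraMap (ZMod p) F t⁻¹ * b, ?_, ?_⟩
      · simp only [Finset.mem_filter, Finset.mem_univ, true_and]
        refine ⟨(hP t⁻¹ (inv_ne_zero ht) b).mpr hb.1, ?_⟩
        rw [← Algebra.smul_def, map_smul, hb.2, smul_eq_mul, inv_mul_cancel₀ ht]
      · rw [← mul_assoc, ← map_mul, mul_inv_cancel₀ ht, map_one, one_mul]
  refine ⟨(M 0 : ℤ) - M 1, ?_⟩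
  have h1 : ∑ x ∈ Finset.univ.filter P, trChar F hζ x = ∑ t : ZMod p, (M t : C) * ζ ^ t.val := by
    rw [← Finset.sum_fiberwise (Finset.univ.filter P) (fun x => Algebra.trace (ZMod p) F x)]
    refine Finset.sum_congr rfl fun t _ => ?_
    rw [Finset.sum_congr rfl (g := fun _ => ζ ^ t.val)]
    · rw [Finset.sum_const, nsmul_eq_mul]
    · intro x hx
      rw [trChar_apply, (Finset.mem_filter.mp hx).2]
  have h2 : ∀ t : ZMod p, (M t : C) * ζ ^ t.val = (M 1 : C) * ζ ^ t.val + if t = 0 then ((M 0 : C) - M 1) else 0 := by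
    intro t
    by_cases ht : t = 0
    · subst ht; simp
    · rw [hM t ht, if_neg ht, add_zero]
  have h3 : ∑ t : ZMod p, ζ ^ t.val = 0 := by
    rw [sum_zmod_range p (fun k => ζ ^ k)]
    exact hζ.geom_sum_eq_zero hp.one_lt
  rw [h1]
  simp_rw [h2]
  rw [Finset.sum_add_distrib, ← Finset.mul_sum, h3, Finset.sum_ite_eq' Finset.univ (0 : ZMod p), if_pos (Finset.mem_univ _)]
  push_cast; ring

lemma gauss_residue {p₁ m : ℕ} [Fact p₁.Prime]
    (hχ : ∀ a : ℕ, quadraticChar (ZMod p₁) a = 1 → ∃ k, p ^ k ≡ a [MOD p₁ ^ m])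
    {ζ : C} (hζ : IsPrimitiveRoot ζ p) {φ : MulChar F C} (hφ : orderOf φ = p₁ ^ m) (t : ℕ)
    (ht : quadraticChar (ZMod p₁) t = 1) :
    gaussSum (φ ^ t) (trChar F hζ) = gaussSum φ (trChar F hζ) := by
  obtain ⟨k, hk⟩ := hχ t ht
  have : φ ^ t = φ ^ p ^ k := by
    rw [pow_eq_pow_iff_modEq, hφ]; exact hk.symm
  rw [this, gauss_pow_p_pow]

lemma gauss_avg {p₁ m : ℕ} [Fact p₁.Prime] (hm : 1 ≤ m)
    (hχ : ∀ a : ℕ, quadraticChar (ZMod p₁) a = 1 → ∃ k, p ^ k ≡ a [MOD p₁ ^ m])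
    {ζ : C} (hζ : IsPrimitiveRoot ζ p) {φ : MulChar F C} (hφ : orderOf φ = p₁ ^ m) :
    gaussSum φ (trChar F hζ) = ∑ x ∈ Finset.univ.filter (fun x => φ x ^ p₁ = 1), φ x * trChar F hζ x := by
  have hp₁ : p₁.Prime := Fact.out
  have hn0 : ((p₁ ^ (m - 1) : ℕ) : C) ≠ 0 := by exact_mod_cast (pow_pos hp₁.pos _).ne'
  apply mul_left_cancel₀ hn0
  have h1 : ((p₁ ^ (m - 1) : ℕ) : C) * gaussSum φ (trChar F hζ) =
      ∑ i ∈ Finset.range (p₁ ^ (m - 1)), gaussSum (φ ^ (1 + p₁ * i)) (trChar F hζ) := by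
    rw [Finset.sum_congr rfl (g := fun _ => gaussSum φ (trChar F hζ))]
    · rw [Finset.sum_const, nsmul_eq_mul, Finset.card_range]
    · intro i _
      apply gauss_residue hχ hζ hφ
      simp
  rw [h1]
  unfold gaussSum
  rw [Finset.sum_comm, Finset.mul_sum, Finset.sum_filter]
  refine Finset.sum_congr rfl fun x _ => ?_
  rw [← Finset.sum_mul]
  have h2 : ∀ i, (φ ^ (1 + p₁ * i)) x = φ x * (φ x ^ p₁) ^ i := by
    intro i
    rw [MulChar.pow_apply' _ (by omega), pow_add, pow_one, pow_mul]
  simp_rw [h2, ← Finset.mul_sum]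
  by_cases hx : x = 0
  · subst hx
    simp [MulChar.map_zero, hp₁.ne_zero]
  · split_ifs with h
    · rw [h]; simp; ring
    · have h3 := geom_sum_mul (φ x ^ p₁) (p₁ ^ (m - 1))
      rw [← pow_mul, ← pow_succ', Nat.sub_add_cancel hm, mulChar_pow_one hφ hx, sub_self] at h3
      rcases mul_eq_zero.mp h3 with h4 | h4
      · rw [h4]; ring
      · exact absurd (sub_eq_zero.mp h4) h

theorem gauss_xy {p₁ m : ℕ} [Fact p₁.Prime] (hmod : p₁ % 8 = 3) (hm : 1 ≤ m)
    (hχ : ∀ a : ℕ, quadraticChar (ZMod p₁) a = 1 → ∃ k, p ^ k ≡ a [MOD p₁ ^ m])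
    (hco : Nat.Coprime (p₁ ^ m) (p - 1)) (hco2 : Nat.Coprime p (p₁ ^ m))
    {ζ : C} (hζ : IsPrimitiveRoot ζ p) {φ : MulChar F C} (hφ : orderOf φ = p₁ ^ m) {ξ : C} (hξ : IsPrimitiveRoot ξ p₁) :
    ∃ x y : ℤ, gaussSum φ (trChar F hζ) + gaussSum φ⁻¹ (trChar F hζ) = x ∧
      gaussSum φ (trChar F hζ) - gaussSum φ⁻¹ (trChar F hζ) = y * qtau p₁ ξ := by
  have hp₁ : p₁.Prime := Fact.out
  have hp : p.Prime := Fact.out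
  have hp2 : p₁ ≠ 2 := by rintro rfl; omega
  have hchar : CharP F p := charP_of_injective_algebraMap (algebraMap (ZMod p) F).injective p
  let c : ZMod p₁ → C := fun a => ∑ x ∈ Finset.univ.filter (fun x => φ x = ξ ^ a.val), trChar F hζ x
  have hcint : ∀ a, ∃ k : ℤ, c a = k := by
    intro a
    apply int_period hζ
    intro u hu x
    rw [map_mul, mulChar_Fp hφ hco hu, one_mul]
  have hξ0 : ξ ≠ 0 := hξ.ne_zero hp₁.ne_zero
  have hφi : orderOf φ⁻¹ = p₁ ^ m := by rw [orderOf_inv, hφ]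
  have hexp : ∀ (φ' : MulChar F C) (ξ' : C), orderOf φ' = p₁ ^ m → IsPrimitiveRoot ξ' p₁ →
      (∀ x a, x ≠ 0 → (φ' x = ξ' ^ a ↔ φ x = ξ ^ a)) → gaussSum φ' (trChar F hζ) = ∑ a, c a * ξ' ^ a.val := by
    intro φ' ξ' hφ' hξ' hiff
    rw [gauss_avg hm hχ hζ hφ', Finset.sum_filter]
    simp only [c, Finset.sum_mul, Finset.sum_filter]
    rw [Finset.sum_comm]
    refine Finset.sum_congr rfl fun x _ => ?_
    by_cases hx : x = 0
    · subst hx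
      simp only [MulChar.map_zero]
      rw [Finset.sum_eq_zero]
      · simp
      · intro a _
        rw [if_neg (pow_ne_zero _ hξ0).symm, zero_mul]
    · split_ifs with h
      · obtain ⟨i, hi, hi2⟩ := hξ'.eq_pow_of_pow_eq_one h
        rw [Finset.sum_eq_single (i : ZMod p₁)]
        · rw [ZMod.val_cast_of_lt hi, hi2, if_pos ((hiff x i hx).mp hi2.symm)]; ring
        · intro b _ hb
          rw [if_neg, zero_mul]
          intro hb2
          rw [← hiff x _ hx, ← hi2] at hb2
          have := hξ'.pow_inj hi (ZMod.val_lt b) hb2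
          apply hb
          rw [this, ZMod.natCast_zmod_val]
        · intro h; exact absurd (Finset.mem_univ _) h
      · rw [Finset.sum_eq_zero]
        intro b _
        rw [if_neg, zero_mul]
        intro hb2
        rw [← hiff x _ hx] at hb2
        apply h
        rw [hb2, ← pow_mul, mul_comm, pow_mul, hξ'.pow_eq_one, one_pow]
  have e1 := hexp φ ξ hφ hξ (fun _ _ _ => Iff.rfl)
  have e2 := hexp φ⁻¹ ξ⁻¹ hφi hξ.inv (by
    intro x a hx
    rw [MulChar.inv_apply_eq_inv, Ring.inverse_eq_inv', inv_pow, inv_inj])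
  have hstep : ∀ a, c ((p : ZMod p₁) * a) = c a := by
    intro a
    simp only [c, Finset.sum_filter]
    symm
    refine Fintype.sum_equiv (frobeniusEquiv F p).toEquiv _ _ ?_
    intro x
    simp only [RingEquiv.toEquiv_eq_coe, EquivLike.coe_coe, frobeniusEquiv_apply, frobenius_def]
    rw [trChar_apply, trChar_apply, trace_pow_p, map_pow]
    have h1 : ξ ^ ((p : ZMod p₁) * a).val = (ξ ^ a.val) ^ p := by
      rw [← pow_mul, mul_comm a.val, ← rootpow_val hξ.pow_eq_one (p * a.val)]
      push_cast; rw [ZMod.natCast_zmod_val]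
    rw [h1]
    congr 1
    apply propext
    constructor
    · intro h; rw [h]
    · intro h
      by_cases hx : x = 0
      · subst hx
        rw [MulChar.map_zero, zero_pow hp.ne_zero] at h
        exact absurd h.symm (pow_ne_zero _ (pow_ne_zero _ hξ0))
      · have hz : φ x / ξ ^ a.val = 1 := by
          apply eq_one_of_coprime_pow hco2
          · rw [div_pow, h, div_self (pow_ne_zero _ (pow_ne_zero _ hξ0))]
          · rw [div_pow, mulChar_pow_one hφ hx]
            have : (ξ ^ a.val) ^ p₁ ^ m = 1 := by
              obtain ⟨j, rfl⟩ : ∃ j, m = j + 1 := ⟨m - 1, by omega⟩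
              rw [pow_succ', pow_mul, ← pow_mul ξ, mul_comm a.val, pow_mul ξ, hξ.pow_eq_one, one_pow, one_pow]
            rw [this, div_one]
        exact (div_eq_one_iff_eq (pow_ne_zero _ hξ0)).mp hz
  have hstepk : ∀ (k : ℕ) a, c ((p : ZMod p₁) ^ k * a) = c a := by
    intro k
    induction k with
    | zero => simp
    | succ k ih => intro a; rw [pow_succ', mul_assoc, hstep, ih]
  have hres : ∀ a : ZMod p₁, quadraticChar (ZMod p₁) a = 1 → ∃ k, a = (p : ZMod p₁) ^ k := by
    intro a ha
    obtain ⟨k, hk⟩ := hχ a.val (by rwa [ZMod.natCast_zmod_val])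
    refine ⟨k, ?_⟩
    have := hk.of_dvd (dvd_pow_self p₁ (by omega : m ≠ 0))
    rw [← ZMod.natCast_eq_natCast_iff] at this
    push_cast at this
    rw [this, ZMod.natCast_zmod_val]
  have hval : ∀ a, 2 * c a = (c 1 + c (-1)) + ((quadraticChar (ZMod p₁) a : ℤ) : C) * (c 1 - c (-1)) +
      if a = 0 then (2 * c 0 - c 1 - c (-1)) else 0 := by
    intro a
    by_cases ha : a = 0
    · subst ha; simp
    · rw [if_neg ha]
      rcases quadraticChar_dichotomy ha with h | h
      · obtain ⟨k, hk⟩ := hres a h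
        have : c a = c 1 := by rw [← hstepk k 1, mul_one, ← hk]
        rw [this, h]; push_cast; ring
      · obtain ⟨k, hk⟩ := hres (-a) (by rw [neg_eq_neg_one_mul, map_mul, chi_neg_one hmod, h]; norm_num)
        have : c a = c (-1) := by rw [← hstepk k (-1), ← hk]; simp
        rw [this, h]; push_cast; ring
  have hsum : ∀ ξ' : C, IsPrimitiveRoot ξ' p₁ → 2 * ∑ a, c a * ξ' ^ a.val =
      (c 1 - c (-1)) * qtau p₁ ξ' + (2 * c 0 - c 1 - c (-1)) := by
    intro ξ' hξ'
    have h3 : ∑ t : ZMod p₁, ξ' ^ t.val = 0 := by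
      rw [sum_zmod_range p₁ (fun k => ξ' ^ k)]
      exact hξ'.geom_sum_eq_zero hp₁.one_lt
    rw [Finset.mul_sum]
    have h4 : ∀ a, 2 * (c a * ξ' ^ a.val) = (c 1 + c (-1)) * ξ' ^ a.val + (c 1 - c (-1)) * (((quadraticChar (ZMod p₁) a : ℤ) : C) * ξ' ^ a.val) + if a = 0 then (2 * c 0 - c 1 - c (-1)) else 0 := by
      intro a
      rw [← mul_assoc, hval]
      by_cases ha : a = 0
      · subst ha; simp
      · rw [if_neg ha]; ring
    simp_rw [h4]
    rw [Finset.sum_add_distrib, Finset.sum_add_distrib, ← Finset.mul_sum, h3, ← Finset.mul_sum,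
      Finset.sum_ite_eq' Finset.univ (0 : ZMod p₁), if_pos (Finset.mem_univ _)]
    unfold qtau; ring
  have s1 := hsum ξ hξ
  have s2 := hsum ξ⁻¹ hξ.inv
  rw [qtau_inv hmod hξ.pow_eq_one] at s2
  rw [← e1] at s1
  rw [← e2] at s2
  obtain ⟨k0, hk0⟩ := hcint 0
  obtain ⟨k1, hk1⟩ := hcint 1
  obtain ⟨k2, hk2⟩ := hcint (-1)
  rw [hk0, hk1, hk2] at s1 s2
  refine ⟨2 * k0 - k1 - k2, k1 - k2, ?_, ?_⟩
  · push_cast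
    have h2 : (2 : C) ≠ 0 := two_ne_zero
    apply mul_left_cancel₀ h2
    linear_combination s1 + s2
  · push_cast
    have h2 : (2 : C) ≠ 0 := two_ne_zero
    apply mul_left_cancel₀ h2
    linear_combination s1 - s2

end C3

section C4
variable {C : Type*} [NormedField C] [IsUltrametricDist C] [IsAlgClosed C] [CharZero C] {p : ℕ} [Fact p.Prime]
  {F : Type*} [Field F] [Fintype F] [Algebra (ZMod p) F] {f : ℕ}

lemma int_dvd_of_norm (hpn : ‖(p : C)‖ = (p : ℝ)⁻¹) (x : ℤ) (k : ℕ) (h : ‖(x : C)‖ ^ 2 ≤ ((p : ℝ)⁻¹) ^ k) :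
    (p : ℤ) ^ ((k + 1) / 2) ∣ x := by
  have hp : p.Prime := Fact.out
  by_cases hx : x = 0
  · rw [hx]; exact dvd_zero _
  have hx' : x.natAbs ≠ 0 := by omega
  obtain ⟨e, n', hn', he⟩ := Nat.exists_eq_pow_mul_and_not_dvd hx' p hp.ne_one
  have hnorm : ‖(x : C)‖ = ‖((x.natAbs : ℕ) : C)‖ := by
    rcases Int.natAbs_eq x with h | h
    · conv_lhs => rw [h]
      simp
    · conv_lhs => rw [h]
      simp
  rw [hnorm, he] at h
  push_cast at h
  rw [norm_mul, norm_pow, hpn, norm_natCast_coprime hpn hn', mul_one, ← pow_mul] at h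
  have hp1 : (p : ℝ)⁻¹ < 1 := inv_lt_one_of_one_lt₀ (by exact_mod_cast hp.one_lt)
  have hp0 : 0 < (p : ℝ)⁻¹ := inv_pos.mpr (by exact_mod_cast hp.pos)
  have h2 : k ≤ e * 2 := (pow_le_pow_iff_right_of_lt_one₀ hp0 hp1).mp h
  have h3 : (p : ℤ) ^ e ∣ x := by
    rw [← Int.dvd_natAbs, he]; push_cast; exact dvd_mul_right _ _
  exact (pow_dvd_pow _ (by omega)).trans h3

lemma dioph {p₁ p e h : ℕ} {x y : ℤ} (hmod : p₁ % 8 = 3) (hpmod : p % 4 = 3) (he : e % 2 = 1) (heh : e ≤ h)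
    (hcl : 1 + p₁ = 4 * p ^ h) (hxy : x ^ 2 + p₁ * y ^ 2 = 4 * (p : ℤ) ^ e) : (x = 1 ∨ x = -1) ∧ (y = 1 ∨ y = -1) := by
  have hle : 4 * (p : ℤ) ^ e ≤ 1 + p₁ := by
    have : p ^ e ≤ p ^ h := Nat.pow_le_pow_right (by omega) heh
    have : 4 * p ^ e ≤ 1 + p₁ := by omega
    exact_mod_cast this
  have hp3 : (3 : ℤ) ≤ p₁ := by omega
  have hpe : p ^ e % 4 = 3 := by
    obtain ⟨k, hk⟩ : ∃ k, e = 2 * k + 1 := ⟨e / 2, by omega⟩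
    rw [hk, pow_succ, pow_mul, Nat.mul_mod, Nat.pow_mod]
    have : p ^ 2 % 4 = 1 := by rw [Nat.pow_mod, hpmod]
    rw [this, hpmod, one_pow]
    rfl
  have hpeZ : (p : ℤ) ^ e % 4 = 3 := by exact_mod_cast hpe
  have hy2 : y ^ 2 ≤ 1 := by
    by_contra! hh
    nlinarith [sq_nonneg x, sq_nonneg y]
  have hy1 : -1 ≤ y ∧ y ≤ 1 := by constructor <;> nlinarith
  have hyn : y ≠ 0 := by
    rintro rfl
    have h1 : x ^ 2 = 4 * (p : ℤ) ^ e := by linarith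
    have h2 : x % 2 = 0 := by
      rcases Int.emod_two_eq_zero_or_one x with h | h
      · exact h
      · have : x ^ 2 % 2 = 1 := by rw [pow_two, Int.mul_emod, h]; rfl
        omega
    obtain ⟨w, hw⟩ : ∃ w, x = 2 * w := ⟨x / 2, by omega⟩
    have h3 : w ^ 2 = (p : ℤ) ^ e := by rw [hw] at h1; linarith
    have h4 : w ^ 2 % 4 = 0 ∨ w ^ 2 % 4 = 1 := by
      have : w % 4 = 0 ∨ w % 4 = 1 ∨ w % 4 = 2 ∨ w % 4 = 3 := by omega
      rw [pow_two, Int.mul_emod]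
      rcases this with h | h | h | h <;> rw [h] <;> simp
    rw [h3] at h4; omega
  have hysq : y ^ 2 = 1 := by
    have := sq_nonneg y
    have : y ^ 2 ≠ 0 := pow_ne_zero 2 hyn
    omega
  rw [hysq] at hxy
  have hx2 : x ^ 2 ≤ 1 := by linarith
  have hx1 : -1 ≤ x ∧ x ≤ 1 := by constructor <;> nlinarith
  have hxn : x ≠ 0 := by
    rintro rfl
    simp at hxy
    omega
  omega

lemma gauss_mul_inv {n : ℕ} {ζ : C} (hζ : IsPrimitiveRoot ζ p) {φ : MulChar F C} (hφ : orderOf φ = n) (hn : 1 < n) (hno : n % 2 = 1) :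
    gaussSum φ (trChar F hζ) * gaussSum φ⁻¹ (trChar F hζ) = Fintype.card F := by
  have hφ1 : φ ≠ 1 := by rintro rfl; rw [orderOf_one] at hφ; omega
  have h1 := gaussSum_mul_gaussSum_eq_card hφ1 (trChar_prim (F := F) hζ)
  have h2 : φ (-1) = 1 := by
    have e1 := mulChar_pow_one hφ (x := -1) (by simp)
    have e2 : φ (-1) ^ 2 = 1 := by rw [← map_pow]; simp
    exact eq_one_of_coprime_pow (Nat.coprime_two_right.mpr (Nat.odd_iff.mpr hno)) e1 e2
  have h3 := mul_gaussSum_inv_eq_gaussSum φ⁻¹ (trChar F hζ)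
  rw [MulChar.inv_apply', inv_neg_one, h2, one_mul] at h3
  rw [← h1, h3]

theorem gauss_rel (hpn : ‖(p : C)‖ = (p : ℝ)⁻¹) {p₁ m h : ℕ} [Fact p₁.Prime] (hmod : p₁ % 8 = 3) (hm : 1 ≤ m)
    (hpmod : p % 4 = 3) (hh : 1 ≤ h) (hcl : 1 + p₁ = 4 * p ^ h)
    (hcop : Nat.Coprime p (p₁ ^ m)) (hord : orderOf ((p : ZMod (p₁ ^ m))) = f) (hfodd : f % 2 = 1)
    (hford : 2 * f = Nat.totient (p₁ ^ m))
    (hcn : |∑ a : ZMod p₁, (a.val : ℤ) * quadraticChar (ZMod p₁) a| ≤ p₁ * h)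
    (hcard : Fintype.card F = p ^ f)
    {ζ : C} (hζ : IsPrimitiveRoot ζ p) :
    ∃ φ : MulChar F C, orderOf φ = p₁ ^ m ∧ ∀ ξ : C, IsPrimitiveRoot ξ p₁ →
      ((gaussSum φ (trChar F hζ) * (1 - qtau p₁ ξ) = gaussSum φ⁻¹ (trChar F hζ) * (1 + qtau p₁ ξ)) ∨
       (gaussSum φ (trChar F hζ) * (1 - qtau p₁ ξ⁻¹) = gaussSum φ⁻¹ (trChar F hζ) * (1 + qtau p₁ ξ⁻¹))) := by
  have hp : p.Prime := Fact.out
  have hp₁ : p₁.Prime := Fact.out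
  have hf0 : f ≠ 0 := by omega
  have hn1 : 1 < p₁ ^ m := Nat.one_lt_pow (by omega) hp₁.one_lt
  have hnodd : p₁ ^ m % 2 = 1 := Nat.odd_iff.mp (Odd.pow (Nat.odd_iff.mpr (by omega)))
  have hq2 : 2 < p ^ f := by
    have : p ^ 1 ≤ p ^ f := Nat.pow_le_pow_right hp.pos (by omega)
    rw [pow_one] at this
    omega
  have hndvd : p₁ ^ m ∣ p ^ f - 1 := by
    rw [← ZMod.natCast_eq_zero_iff, Nat.cast_sub (Nat.one_le_pow _ _ hp.pos)]
    push_cast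
    rw [← hord, pow_orderOf_eq_one, sub_self]
  obtain ⟨hχp, hχ⟩ := C1_char hmod hm hcop hord hfodd hford
  have hplt : p < p₁ := by
    have : p ^ 1 ≤ p ^ h := Nat.pow_le_pow_right hp.pos hh
    rw [pow_one] at this
    omega
  have hco : Nat.Coprime (p₁ ^ m) (p - 1) := by
    apply Nat.Coprime.pow_left
    rw [hp₁.coprime_iff_not_dvd]
    intro hd
    have := Nat.le_of_dvd (by have := hp.two_le; omega) hd
    omega
  have hpp₁ : ¬ p ∣ p₁ := by
    intro hd
    rcases (Nat.dvd_prime hp₁).mp hd with h1 | h1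
    · exact hp.ne_one h1
    · omega
  obtain ⟨φ, hφ, hb1, hb2⟩ := stickelberger_bound (F := F) hpn hf0 hcard hq2 hζ hn1 hndvd
  refine ⟨φ, hφ, ?_⟩
  intro ξ hξ
  obtain ⟨x, y, hx, hy⟩ := gauss_xy hmod hm hχ hco hcop hζ hφ hξ
  have hGG := gauss_mul_inv hζ hφ hn1 hnodd
  set G := gaussSum φ (trChar F hζ) with hG
  set G' := gaussSum φ⁻¹ (trChar F hζ) with hG'
  set n := p₁ ^ m with hn
  set S := ∑ j ∈ Finset.range f, p ^ j % n with hS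
  have hS' : ∑ j ∈ Finset.range f, (n - p ^ j % n) = n * f - S := by
    rw [Finset.sum_tsub_distrib _ (fun j _ => (Nat.mod_lt _ (by omega)).le)]
    rw [Finset.sum_const, Finset.card_range, smul_eq_mul, mul_comm f n]
  have hSle : S ≤ n * f := by
    calc S ≤ ∑ j ∈ Finset.range f, n := Finset.sum_le_sum (fun j _ => (Nat.mod_lt _ (by omega)).le)
      _ = n * f := by simp [mul_comm]
  rw [hS'] at hb2
  have hP0 : 0 < (p : ℝ)⁻¹ := inv_pos.mpr (by exact_mod_cast hp.pos)
  have hP1 : (p : ℝ)⁻¹ ≤ 1 := inv_le_one_of_one_le₀ (by exact_mod_cast hp.one_le)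
  set P := (p : ℝ)⁻¹ with hP
  have hprod : ‖G‖ * ‖G'‖ = P ^ f := by
    rw [← norm_mul, hGG, hcard]; push_cast; rw [norm_pow, hpn]
  have hprodn : ‖G‖ ^ n * ‖G'‖ ^ n = P ^ S * P ^ (n * f - S) := by
    rw [← mul_pow, hprod, ← pow_mul, ← pow_add, mul_comm f n]; congr 1; omega
  have hu1 : ‖G‖ ^ n ≤ P ^ S := by
    have h1 : 0 < P ^ (n * f - S) := by positivity
    have h2 : ‖G‖ ^ n * P ^ (n * f - S) ≤ P ^ S * P ^ (n * f - S) := by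
      rw [← hprodn]; gcongr
    exact le_of_mul_le_mul_right h2 h1
  have hu2 : ‖G'‖ ^ n ≤ P ^ (n * f - S) := by
    have h1 : 0 < P ^ S := by positivity
    have h2 : P ^ S * ‖G'‖ ^ n ≤ P ^ S * P ^ (n * f - S) := by
      rw [← hprodn]; gcongr
    exact le_of_mul_le_mul_left h2 h1
  have hsum := C2_sum hmod hm hcop hord hfodd hford
  have habs : |(2 * S - n * f : ℤ)| ≤ n * h := by
    have h1 : (2 * (S : ℤ) - n * f) = (p₁ ^ (m - 1) : ℕ) * ∑ a : ZMod p₁, (a.val : ℤ) * quadraticChar (ZMod p₁) a := by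
      exact_mod_cast hsum
    rw [h1, abs_mul, Nat.abs_cast]
    calc ((p₁ ^ (m - 1) : ℕ) : ℤ) * |∑ a : ZMod p₁, (a.val : ℤ) * quadraticChar (ZMod p₁) a| ≤ ((p₁ ^ (m - 1) : ℕ) : ℤ) * (p₁ * h) := by gcongr
      _ = n * h := by
        rw [hn, ← mul_assoc]; congr 1
        rw [← Nat.cast_mul, ← pow_succ, Nat.sub_add_cancel hm]
  rw [abs_le] at habs
  have hnfh : n * (f - h) + n * h ≥ n * f := by rw [← mul_add]; exact Nat.mul_le_mul_left _ (by omega)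
  have hnfh2 : f ≤ h ∨ n * (f - h) + n * h = n * f := by
    rcases le_total f h with h1 | h1
    · exact Or.inl h1
    · right; rw [← mul_add]; congr 1; omega
  have k1 : n * (f - h) ≤ 2 * S := by
    rcases hnfh2 with h1 | h1
    · rw [Nat.sub_eq_zero_of_le h1]; omega
    · zify; zify at h1; linarith [habs.1]
  have k2 : n * (f - h) ≤ 2 * (n * f - S) := by
    rcases hnfh2 with h1 | h1
    · rw [Nat.sub_eq_zero_of_le h1]; omega
    · zify [hSle]; zify at h1; linarith [habs.2]
  have hsq : ∀ (g : ℝ) (T : ℕ), 0 ≤ g → g ^ n ≤ P ^ T → n * (f - h) ≤ 2 * T → g ^ 2 ≤ P ^ (f - h) := by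
    intro g T hg h1 h2
    have h3 : (g ^ 2) ^ n ≤ (P ^ (f - h)) ^ n := by
      calc (g ^ 2) ^ n = (g ^ n) ^ 2 := by rw [← pow_mul, ← pow_mul, mul_comm]
        _ ≤ (P ^ T) ^ 2 := by gcongr
        _ = P ^ (2 * T) := by rw [← pow_mul, mul_comm]
        _ ≤ P ^ (n * (f - h)) := pow_le_pow_of_le_one hP0.le hP1 h2
        _ = (P ^ (f - h)) ^ n := by rw [← pow_mul, mul_comm]
    exact le_of_pow_le_pow_left₀ (by omega) (by positivity) h3
  have m1 := hsq _ _ (norm_nonneg _) hu1 k1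
  have m2 := hsq _ _ (norm_nonneg _) hu2 k2
  have hmax : (max ‖G‖ ‖G'‖) ^ 2 ≤ P ^ (f - h) := by
    rcases max_choice ‖G‖ ‖G'‖ with h1 | h1 <;> rw [h1] <;> assumption
  have hxn : ‖(x : C)‖ ^ 2 ≤ P ^ (f - h) := by
    rw [← hx]
    refine le_trans ?_ hmax
    gcongr
    exact IsUltrametricDist.norm_add_le_max _ _
  have hτsq := qtau_sq hmod hξ
  have hτ : ‖qtau p₁ ξ‖ = 1 := by
    have h1 := congrArg norm hτsq
    rw [norm_pow, norm_neg, norm_natCast_coprime hpn hpp₁] at h1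
    exact (pow_eq_one_iff_of_nonneg (norm_nonneg _) two_ne_zero).mp h1
  have hyn : ‖(y : C)‖ ^ 2 ≤ P ^ (f - h) := by
    have h1 : ‖(y : C)‖ = ‖G - G'‖ := by rw [hy, norm_mul, hτ, mul_one]
    rw [h1]
    refine le_trans ?_ hmax
    gcongr
    have h2 := IsUltrametricDist.norm_add_le_max G (-G')
    rwa [norm_neg, ← sub_eq_add_neg] at h2
  obtain ⟨x', hx'⟩ := int_dvd_of_norm hpn x _ hxn
  obtain ⟨y', hy'⟩ := int_dvd_of_norm hpn y _ hyn
  set b := (f - h + 1) / 2 with hb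
  have hxyC : ((x ^ 2 + p₁ * y ^ 2 : ℤ) : C) = ((4 * (p : ℤ) ^ f : ℤ) : C) := by
    push_cast
    have : ((Fintype.card F : ℕ) : C) = (p : C) ^ f := by rw [hcard]; push_cast; rfl
    rw [← this, ← hGG, ← hx]
    linear_combination ((y : C) ^ 2) * hτsq + (G - G' + y * qtau p₁ ξ) * hy
  have hxyZ : x ^ 2 + p₁ * y ^ 2 = 4 * (p : ℤ) ^ f := by exact_mod_cast hxyC
  have hpb : (p : ℤ) ^ b ≠ 0 := pow_ne_zero _ (by exact_mod_cast hp.ne_zero)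
  have hxy' : x' ^ 2 + p₁ * y' ^ 2 = 4 * (p : ℤ) ^ (f - 2 * b) := by
    have h1 : (p : ℤ) ^ f = ((p : ℤ) ^ b) ^ 2 * (p : ℤ) ^ (f - 2 * b) := by
      rw [← pow_mul, ← pow_add]; congr 1; omega
    rw [hx', hy', h1] at hxyZ
    apply mul_left_cancel₀ (pow_ne_zero 2 hpb)
    linear_combination hxyZ
  obtain ⟨hx1, hy1⟩ := dioph hmod hpmod (by omega) (by omega) hcl hxy'
  have hinv := qtau_inv hmod hξ.pow_eq_one
  rw [hx'] at hx
  rw [hy'] at hy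
  push_cast at hx hy
  have h2 : (2 : C) ≠ 0 := two_ne_zero
  rw [hinv]
  set τ := qtau p₁ ξ with hτdef
  set B := (p : C) ^ b
  rcases hx1 with h1 | h1 <;> rcases hy1 with h3 | h3 <;> rw [h1] at hx <;> rw [h3] at hy <;> push_cast at hx hy
  · left; linear_combination hy - τ * hx
  · right; linear_combination hy + τ * hx
  · right; linear_combination hy + τ * hx
  · left; linear_combination hy - τ * hx

end C4

section C5
variable {C : Type*} [Field C] [CharZero C] {F : Type*} [Field F] [Fintype F]

/-- the quadratic character with values in `C` -/
noncomputable def etaC (F C : Type*) [Field F] [Fintype F] [Field C] : MulChar F C :=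
  (quadraticChar F).ringHomComp (Int.castRingHom C)

lemma etaC_apply (x : F) : etaC F C x = ((quadraticChar F x : ℤ) : C) := by
  simp [etaC, MulChar.ringHomComp_apply]

lemma etaC_quad : (etaC F C).IsQuadratic := (quadraticChar_isQuadratic F).comp _

lemma jacobi_dup (hF : ringChar F ≠ 2) (φ : MulChar F C) (h4 : φ 4 = 1) :
    jacobiSum φ φ = jacobiSum (etaC F C) φ + ∑ w : F, φ w := by
  have h2 : (2 : F) ≠ 0 := Ring.two_ne_zero hF
  have h1 : jacobiSum φ φ = ∑ y : F, φ (1 - y ^ 2) := by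
    unfold jacobiSum
    let e : F ≃ F := (Equiv.mulLeft₀ (2 : F) h2).trans (Equiv.subRight (1 : F))
    refine Fintype.sum_equiv e _ _ ?_
    intro x
    have : e x = 2 * x - 1 := rfl
    rw [this, ← map_mul, show (1 - (2 * x - 1) ^ 2 : F) = 4 * (x * (1 - x)) by ring, map_mul φ 4, h4, one_mul]
  rw [h1, ← Finset.sum_fiberwise Finset.univ (fun y : F => y ^ 2)]
  have h3 : ∀ w : F, ∑ y ∈ Finset.univ.filter (fun y : F => y ^ 2 = w), φ (1 - y ^ 2) = (etaC F C w + 1) * φ (1 - w) := by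
    intro w
    rw [Finset.sum_congr rfl (g := fun _ => φ (1 - w))]
    · rw [Finset.sum_const, nsmul_eq_mul]
      congr 1
      have := quadraticChar_card_sqrts hF w
      rw [etaC_apply]
      have h5 : {x : F | x ^ 2 = w}.toFinset = Finset.univ.filter (fun y : F => y ^ 2 = w) := by
        ext y; simp
      rw [h5] at this
      exact_mod_cast this
    · intro y hy
      rw [(Finset.mem_filter.mp hy).2]
  simp_rw [h3, add_mul, one_mul, Finset.sum_add_distrib]
  unfold jacobiSum
  congr 1
  exact Fintype.sum_equiv (Equiv.subLeft (1 : F)) _ _ (fun x => rfl)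

lemma etaC_neg_one (hF : Fintype.card F % 4 = 3) : etaC F C (-1) = -1 := by
  have hF2 : ringChar F ≠ 2 := by
    intro h
    have := FiniteField.even_card_of_char_two h
    omega
  rw [etaC_apply, quadraticChar_neg_one hF2, ZMod.χ₄_nat_three_mod_four hF]; simp

lemma dav_hasse (hF : Fintype.card F % 4 = 3) {ψ : AddChar F C} (hψ : ψ.IsPrimitive) (φ : MulChar F C) (h4 : φ 4 = 1)
    {n : ℕ} (hφ : orderOf φ = n) (hn : 1 < n) (hno : n % 2 = 1) :
    gaussSum φ ψ * gaussSum (φ * etaC F C) ψ = gaussSum (φ ^ 2) ψ * gaussSum (etaC F C) ψ := by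
  have hF2 : ringChar F ≠ 2 := by
    intro h
    have := FiniteField.even_card_of_char_two h
    omega
  have hφ1 : φ ≠ 1 := by rintro rfl; rw [orderOf_one] at hφ; omega
  have hη := etaC_neg_one (C := C) hF
  have hφm : φ (-1) = 1 := by
    have e1 := mulChar_pow_one hφ (x := -1) (by simp)
    have e2 : φ (-1) ^ 2 = 1 := by rw [← map_pow]; simp
    exact eq_one_of_coprime_pow (Nat.coprime_two_right.mpr (Nat.odd_iff.mpr hno)) e1 e2
  have hJ := jacobi_dup hF2 φ h4
  rw [MulChar.sum_eq_zero_of_ne_one hφ1, add_zero] at hJ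
  have hφ2 : φ * φ ≠ 1 := by
    rw [← pow_two]
    intro h
    have := orderOf_dvd_of_pow_eq_one h
    rw [hφ] at this
    have := Nat.le_of_dvd (by norm_num) this
    omega
  have hφη : etaC F C * φ ≠ 1 := by
    intro h
    have := congrArg (fun c => c (-1)) h
    simp only [MulChar.mul_apply, hη, hφm] at this
    rw [show (-1 : F) = ((-1 : Fˣ) : F) by simp, MulChar.one_apply_coe] at this
    norm_num at this
  have e1 := jacobiSum_mul_nontrivial hφ2 ψ
  have e2 := jacobiSum_mul_nontrivial hφη ψ
  have hG : gaussSum φ ψ ≠ 0 := by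
    intro h0
    have := gaussSum_mul_gaussSum_eq_card hφ1 hψ
    rw [h0, zero_mul] at this
    have hc : (Fintype.card F : C) ≠ 0 := by exact_mod_cast Fintype.card_ne_zero
    exact hc this.symm
  apply mul_left_cancel₀ hG
  rw [hJ, ← pow_two φ] at e1
  rw [mul_comm φ (etaC F C)]
  linear_combination (-gaussSum (etaC F C * φ) ψ) * e1 + gaussSum (φ ^ 2) ψ * e2

lemma gauss_mul_inv' {ψ : AddChar F C} (hψ : ψ.IsPrimitive) {X : MulChar F C} (hX : X ≠ 1) (hXm : X (-1) = -1) :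
    gaussSum X ψ * gaussSum X⁻¹ ψ = -(Fintype.card F : C) := by
  have h1 := gaussSum_mul_gaussSum_eq_card hX hψ
  have h3 := mul_gaussSum_inv_eq_gaussSum X⁻¹ ψ
  rw [MulChar.inv_apply', inv_neg_one, hXm] at h3
  rw [← h1, ← h3]; ring

lemma gen_root {φ : MulChar F C} {n : ℕ} (hφ : orderOf φ = n) {γ : Fˣ} (hγ : ∀ x : Fˣ, x ∈ Subgroup.zpowers γ) :
    IsPrimitiveRoot (φ γ) n := by
  refine ⟨mulChar_pow_one hφ γ.ne_zero, ?_⟩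
  intro l hl
  rw [← hφ]
  apply orderOf_dvd_of_pow_eq_one
  ext x
  obtain ⟨k, hk⟩ := Subgroup.mem_zpowers_iff.mp (hγ x)
  rw [MulChar.one_apply_coe, MulChar.pow_apply_coe, ← hk]
  have : φ ((γ ^ k : Fˣ) : F) = φ γ ^ k := by
    rw [← MulChar.coe_toUnitHom, map_zpow, Units.val_zpow_eq_zpow_val, MulChar.coe_toUnitHom]
  rw [this, ← zpow_natCast, ← zpow_mul, mul_comm, zpow_mul, zpow_natCast, hl, one_zpow]

end C5

section C6
variable {C : Type*} [NormedField C] [IsUltrametricDist C] [IsAlgClosed C] [CharZero C] {p : ℕ} [Fact p.Prime]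
  {F : Type*} [Field F] [Fintype F] [Algebra (ZMod p) F] {f : ℕ}

theorem gauss_all (hpn : ‖(p : C)‖ = (p : ℝ)⁻¹) {p₁ m h : ℕ} [Fact p₁.Prime] (hmod : p₁ % 8 = 3) (hm : 1 ≤ m)
    (hpmod : p % 4 = 3) (hh : 1 ≤ h) (hcl : 1 + p₁ = 4 * p ^ h)
    (hcop : Nat.Coprime p (p₁ ^ m)) (hord : orderOf ((p : ZMod (p₁ ^ m))) = f) (hfodd : f % 2 = 1)
    (hford : 2 * f = Nat.totient (p₁ ^ m))
    (hcn : |∑ a : ZMod p₁, (a.val : ℤ) * quadraticChar (ZMod p₁) a| ≤ p₁ * h)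
    (hcard : Fintype.card F = p ^ f)
    {ζ : C} (hζ : IsPrimitiveRoot ζ p) :
    ∃ (γ : Fˣ) (X : MulChar F C) (s : C), (∀ x : Fˣ, x ∈ Subgroup.zpowers γ) ∧
      IsPrimitiveRoot (X γ) (2 * p₁ ^ m) ∧ X ^ (2 * p₁ ^ m) = 1 ∧ s ^ 2 = -(Fintype.card F : C) ∧
      (∀ t : ℕ, t % 2 = 1 → p₁ ^ m ∣ t → gaussSum (X ^ t) (trChar F hζ) = s) ∧
      (∀ t : ℕ, t % 2 = 1 → ¬ p₁ ∣ t → gaussSum (X ^ t) (trChar F hζ) * (1 - qtau p₁ ((-(X γ)⁻¹ ^ (p₁ ^ (m - 1))) ^ t)) =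
        s * (1 + qtau p₁ ((-(X γ)⁻¹ ^ (p₁ ^ (m - 1))) ^ t))) := by
  have hp : p.Prime := Fact.out
  have hp₁ : p₁.Prime := Fact.out
  have hp2 : p₁ ≠ 2 := by rintro rfl; omega
  have hn1 : 1 < p₁ ^ m := Nat.one_lt_pow (by omega) hp₁.one_lt
  have hnodd : p₁ ^ m % 2 = 1 := Nat.odd_iff.mp (Odd.pow (Nat.odd_iff.mpr (by omega)))
  have hModd : Odd (p₁ ^ (m - 1)) := Odd.pow (Nat.odd_iff.mpr (by omega))
  have hMn : p₁ ^ m = p₁ ^ (m - 1) * p₁ := by rw [← pow_succ, Nat.sub_add_cancel hm]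
  obtain ⟨hχp, hχ⟩ := C1_char hmod hm hcop hord hfodd hford
  have hplt : p < p₁ := by
    have : p ^ 1 ≤ p ^ h := Nat.pow_le_pow_right hp.pos hh
    rw [pow_one] at this
    omega
  have hco : Nat.Coprime (p₁ ^ m) (p - 1) := by
    apply Nat.Coprime.pow_left
    rw [hp₁.coprime_iff_not_dvd]
    intro hd
    have := Nat.le_of_dvd (by have := hp.two_le; omega) hd
    omega
  have hF : Fintype.card F % 4 = 3 := by
    rw [hcard]
    obtain ⟨k, hk⟩ : ∃ k, f = 2 * k + 1 := ⟨f / 2, by omega⟩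
    rw [hk, pow_succ, pow_mul, Nat.mul_mod, Nat.pow_mod]
    have : p ^ 2 % 4 = 1 := by rw [Nat.pow_mod, hpmod]
    rw [this, hpmod, one_pow]
    rfl
  obtain ⟨φ, hφ, hrel⟩ := gauss_rel (F := F) hpn hmod hm hpmod hh hcl hcop hord hfodd hford hcn hcard hζ
  set ψ := trChar F hζ with hψdef
  have hψ : ψ.IsPrimitive := trChar_prim (F := F) hζ
  -- choice of the generator
  obtain ⟨γ, hγ, hγrel⟩ : ∃ γ : Fˣ, (∀ x : Fˣ, x ∈ Subgroup.zpowers γ) ∧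
      gaussSum φ ψ * (1 - qtau p₁ (φ γ ^ (p₁ ^ (m - 1)))) = gaussSum φ⁻¹ ψ * (1 + qtau p₁ (φ γ ^ (p₁ ^ (m - 1)))) := by
    obtain ⟨γ₀, hγ₀⟩ := IsCyclic.exists_generator (α := Fˣ)
    have hr : IsPrimitiveRoot (φ γ₀ ^ (p₁ ^ (m - 1))) p₁ :=
      (gen_root hφ hγ₀).pow (by omega) hMn
    rcases hrel _ hr with h1 | h1
    · exact ⟨γ₀, hγ₀, h1⟩
    · refine ⟨γ₀⁻¹, ?_, ?_⟩
      · intro x; rw [Subgroup.zpowers_inv]; exact hγ₀ x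
      · have : φ ((γ₀⁻¹ : Fˣ) : F) = (φ γ₀)⁻¹ := by
          rw [← MulChar.coe_toUnitHom, map_inv, Units.val_inv_eq_inv_val, MulChar.coe_toUnitHom]
        rw [this, inv_pow]; exact h1
  have hroot := gen_root hφ hγ
  have hξ : IsPrimitiveRoot (φ γ ^ (p₁ ^ (m - 1))) p₁ := hroot.pow (by omega) hMn
  set ξ := φ γ ^ (p₁ ^ (m - 1)) with hξdef
  have hηm := etaC_neg_one (F := F) (C := C) hF
  have hηsq : etaC F C ^ 2 = 1 := etaC_quad.sq_eq_one
  have hηγ : etaC F C γ = -1 := by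
    rcases etaC_quad (F := F) (C := C) γ with h1 | h1 | h1
    · exfalso
      have h2 : IsUnit (etaC F C (γ : F)) := by
        rw [← MulChar.coe_toUnitHom]; exact Units.isUnit _
      rw [h1] at h2; exact not_isUnit_zero h2
    · exfalso
      obtain ⟨k, hk⟩ := Subgroup.mem_zpowers_iff.mp (hγ (-1))
      have h2 : etaC F C ((γ ^ k : Fˣ) : F) = 1 := by
        rw [← MulChar.coe_toUnitHom, map_zpow, Units.val_zpow_eq_zpow_val, MulChar.coe_toUnitHom, h1, one_zpow]
      rw [hk, Units.val_neg, Units.val_one, hηm] at h2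
      norm_num at h2
    · exact h1
  have hη1 : etaC F C ≠ 1 := by
    intro h
    rw [h, MulChar.one_apply_coe] at hηγ
    norm_num at hηγ
  have hs2 : gaussSum (etaC F C) ψ ^ 2 = -(Fintype.card F : C) := by
    rw [gaussSum_sq hη1 etaC_quad hψ, hηm]; ring
  set s := gaussSum (etaC F C) ψ with hs
  have hcard0 : (Fintype.card F : C) ≠ 0 := by exact_mod_cast Fintype.card_ne_zero
  have hs0 : s ≠ 0 := by
    intro h0; rw [h0] at hs2
    apply hcard0
    linear_combination hs2
  set X := φ * etaC F C with hX
  have hφm : φ (-1) = 1 := by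
    have e1 := mulChar_pow_one hφ (x := -1) (by simp)
    have e2 : φ (-1) ^ 2 = 1 := by rw [← map_pow]; simp
    exact eq_one_of_coprime_pow (Nat.coprime_two_right.mpr (Nat.odd_iff.mpr hnodd)) e1 e2
  have hXm : X (-1) = -1 := by rw [hX, MulChar.mul_apply, hφm, hηm, one_mul]
  have hφn : φ ^ (p₁ ^ m) = 1 := by rw [← hφ, pow_orderOf_eq_one]
  have hXN : X ^ (2 * p₁ ^ m) = 1 := by
    rw [hX, mul_pow, pow_mul (etaC F C), hηsq, one_pow, mul_one, mul_comm, pow_mul, hφn, one_pow]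
  have hXγ : X γ = - φ γ := by rw [hX, MulChar.mul_apply, hηγ]; ring
  have hWroot : IsPrimitiveRoot (X γ) (2 * p₁ ^ m) := by
    rw [hXγ, neg_eq_neg_one_mul]
    have h1 : orderOf (-1 : C) = 2 := by
      rw [orderOf_neg_one, if_neg]
      rw [ringChar.eq C 0]; norm_num
    have h2 := (Commute.all (-1 : C) (φ γ)).orderOf_mul_eq_mul_orderOf_of_coprime (by
      rw [h1, ← hroot.eq_orderOf]; exact Nat.coprime_two_left.mpr (Nat.odd_iff.mpr hnodd))
    rw [h1, ← hroot.eq_orderOf] at h2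
    rw [← h2]
    exact IsPrimitiveRoot.orderOf _
  have hz : -(X γ)⁻¹ ^ (p₁ ^ (m - 1)) = ξ⁻¹ := by
    rw [hXγ, inv_neg, hModd.neg_pow, neg_neg, inv_pow]
  -- base relation
  have h4 : φ 4 = 1 := by
    have h40 : (4 : ZMod p) ≠ 0 := by
      intro h0
      have : ((4 : ℕ) : ZMod p) = 0 := by exact_mod_cast h0
      rw [ZMod.natCast_eq_zero_iff] at this
      have h5 := (Nat.Prime.dvd_of_dvd_pow hp (show p ∣ 2 ^ 2 from this))
      have := Nat.le_of_dvd (by norm_num) h5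
      omega
    have := mulChar_Fp hφ hco h40
    rwa [map_ofNat] at this
  have hDH := dav_hasse hF hψ φ h4 hφ hn1 hnodd
  have hG2 : gaussSum (φ ^ 2) ψ = gaussSum φ⁻¹ ψ := by
    have hφi : orderOf φ⁻¹ = p₁ ^ m := by rw [orderOf_inv, hφ]
    rw [← gauss_residue hχ hζ hφi (p₁ ^ m - 2)]
    · congr 1
      rw [inv_pow, eq_inv_iff_mul_eq_one, ← pow_add, Nat.add_sub_cancel' (by omega), hφn]
    · rw [Nat.cast_sub (by omega)]
      have h0 : ((p₁ ^ m : ℕ) : ZMod p₁) = 0 := by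
        push_cast; rw [ZMod.natCast_self, zero_pow (by omega)]
      rw [h0, zero_sub, neg_eq_neg_one_mul, map_mul, chi_neg_one hmod, Nat.cast_ofNat,
        quadraticChar_two (by rwa [ZMod.ringChar_zmod_n]), ZMod.card, ZMod.χ₈_nat_mod_eight, hmod]
      rfl
  rw [hG2] at hDH
  have hGφ : gaussSum φ ψ ≠ 0 := by
    intro h0
    have := gauss_mul_inv hζ hφ hn1 hnodd
    rw [← hψdef, h0, zero_mul] at this
    exact hcard0 this.symm
  have hτi := qtau_inv hmod hξ.pow_eq_one
  have hbase : gaussSum X ψ * (1 - qtau p₁ ξ⁻¹) = s * (1 + qtau p₁ ξ⁻¹) := by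
    rw [hτi]
    apply mul_left_cancel₀ hGφ
    linear_combination (1 + qtau p₁ ξ) * hDH - s * hγrel
  have hres : ∀ t : ℕ, t % 2 = 1 → quadraticChar (ZMod p₁) t = 1 → gaussSum (X ^ t) ψ = gaussSum X ψ := by
    intro t ht ht1
    obtain ⟨k, hk⟩ := hχ t ht1
    have : X ^ t = X ^ p ^ k := by
      have h1 : t ≡ p ^ k [MOD (2 * p₁ ^ m)] := by
        rw [← Nat.modEq_and_modEq_iff_modEq_mul (Nat.coprime_two_left.mpr (Nat.odd_iff.mpr hnodd))]
        refine ⟨?_, hk.symm⟩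
        have : p ^ k % 2 = 1 := Nat.odd_iff.mp (Odd.pow (Nat.odd_iff.mpr (by omega)))
        unfold Nat.ModEq; omega
      rw [pow_eq_pow_iff_modEq]
      exact h1.of_dvd (orderOf_dvd_of_pow_eq_one hXN)
    rw [this, gauss_pow_p_pow]
  refine ⟨γ, X, s, hγ, hWroot, hXN, hs2, ?_, ?_⟩
  · intro t ht hnt
    have : X ^ t = etaC F C := by
      obtain ⟨c, rfl⟩ := hnt
      rw [hX, mul_pow, pow_mul φ, hφn, one_pow, one_mul]
      generalize p₁ ^ m * c = t at ht
      obtain ⟨k, hk⟩ : ∃ k, t = 2 * k + 1 := ⟨t / 2, by omega⟩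
      rw [hk, pow_succ, pow_mul, hηsq, one_pow, one_mul]
    rw [this]
  · intro t ht hpt
    have hξi : (ξ⁻¹) ^ p₁ = 1 := by rw [inv_pow, hξ.pow_eq_one, inv_one]
    have ht0 : (t : ZMod p₁) ≠ 0 := by rwa [Ne, ZMod.natCast_eq_zero_iff]
    rw [hz, qtau_pow hξi t ht0]
    set τ := qtau p₁ ξ⁻¹ with hτ
    rcases quadraticChar_dichotomy ht0 with h1 | h1
    · rw [h1, hres t ht h1]
      push_cast
      linear_combination hbase
    · rw [h1]
      have hXt1 : (X ^ t) (-1) = -1 := by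
        rw [MulChar.pow_apply' _ (by omega), hXm, Odd.neg_one_pow (Nat.odd_iff.mpr ht)]
      have hXt : X ^ t ≠ 1 := by
        intro h
        rw [h, show (-1 : F) = ((-1 : Fˣ) : F) by simp, MulChar.one_apply_coe] at hXt1
        norm_num at hXt1
      have e1 := gauss_mul_inv' hψ hXt hXt1
      have e2 : (X ^ t)⁻¹ = X ^ (t * (2 * p₁ ^ m - 1)) := by
        rw [inv_eq_iff_mul_eq_one, ← pow_add]
        have : t + t * (2 * p₁ ^ m - 1) = (2 * p₁ ^ m) * t := by
          obtain ⟨k, hk⟩ : ∃ k, 2 * p₁ ^ m = k + 1 := ⟨2 * p₁ ^ m - 1, by omega⟩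
          rw [hk]; simp; ring
        rw [this, pow_mul, hXN, one_pow]
      rw [e2, hres (t * (2 * p₁ ^ m - 1))] at e1
      · push_cast
        apply mul_left_cancel₀ hs0
        linear_combination (-(1 - τ)) * hs2 + (1 - τ) * e1 - gaussSum (X ^ t) ψ * hbase
      · rw [Nat.mul_mod, ht]; omega
      · rw [Nat.cast_mul, Nat.cast_sub (by omega)]
        have h0 : ((2 * p₁ ^ m : ℕ) : ZMod p₁) = 0 := by
          push_cast; rw [ZMod.natCast_self, zero_pow (by omega), mul_zero]
        rw [h0, map_mul, h1, Nat.cast_one, zero_sub, chi_neg_one hmod]; rfl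

end C6

section D1
variable {C : Type*} [Field C] [CharZero C] {F : Type*} [Field F] [Fintype F]

theorem skew_of_sum {ψ : AddChar F C} (hψ : ψ.IsPrimitive) (D : Set F) (h0 : (0 : F) ∉ D)
    (hsk : ∀ g : F, g ≠ 0 → (g ∈ D ↔ -g ∉ D))
    (hT : ∀ a : F, a ≠ 0 →
      (∑ x : F, ((if x ∈ D then 1 else 0) - (if -x ∈ D then 1 else 0) : C) * ψ (x * a)) ^ 2 = -(Fintype.card F : C)) :
    IsSkewHadamardDifferenceSet D := by
  refine ⟨h0, hsk, ?_⟩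
  let S : F → C := fun a => ∑ x : F, (if x ∈ D then 1 else 0 : C) * ψ (x * a)
  have hSneg : ∀ a, S (-a) = ∑ x : F, (if -x ∈ D then 1 else 0 : C) * ψ (x * a) := by
    intro a
    refine Fintype.sum_equiv (Equiv.neg F) _ _ ?_
    intro x
    simp
  have hSS : ∀ a, a ≠ 0 → S a * S (-a) = (1 + Fintype.card F) / 4 := by
    intro a ha
    have h1 : S a + S (-a) = -1 := by
      rw [hSneg]
      simp only [S]
      rw [← Finset.sum_add_distrib]
      have h2 : ∀ x : F, (if x ∈ D then 1 else 0 : C) * ψ (x * a) + (if -x ∈ D then 1 else 0 : C) * ψ (x * a)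
          = ψ (x * a) - if x = 0 then 1 else 0 := by
        intro x
        by_cases hx : x = 0
        · subst hx; simp [h0]
        · have := hsk x hx
          by_cases hxD : x ∈ D
          · simp [hxD, this.mp hxD, hx]
          · have h3 : -x ∈ D := by by_contra h4; exact hxD (this.mpr h4)
            simp [hxD, h3, hx]
      simp_rw [h2]
      rw [Finset.sum_sub_distrib, AddChar.sum_mulShift a hψ, if_neg ha]
      simp
    have h2 : (S a - S (-a)) ^ 2 = -(Fintype.card F : C) := by
      rw [← hT a ha, hSneg]
      simp only [S]
      rw [← Finset.sum_sub_distrib]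
      simp_rw [sub_mul]
    have h3 : S a * S (-a) * 4 = 1 + Fintype.card F := by
      linear_combination (S a + S (-a) - 1) * h1 - h2
    rw [← h3]; field_simp
  have hcard0 : (Fintype.card F : C) ≠ 0 := by exact_mod_cast Fintype.card_ne_zero
  let R : F → ℕ := fun g => Nat.card {x : F × F // x.1 ∈ D ∧ x.2 ∈ D ∧ x.1 - x.2 = g}
  have hR : ∀ g, g ≠ 0 → (Fintype.card F : C) * R g = S 0 * S 0 - (1 + Fintype.card F) / 4 := by
    intro g hg
    have e1 : (Fintype.card F : C) * R g = ∑ x : F, ∑ y : F,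
        (if x ∈ D then 1 else 0 : C) * (if y ∈ D then 1 else 0 : C) * ∑ a : F, ψ (a * (x - y - g)) := by
      have : ∀ x y : F, (if x ∈ D then 1 else 0 : C) * (if y ∈ D then 1 else 0 : C) * ∑ a : F, ψ (a * (x - y - g))
          = (Fintype.card F : C) * if (x ∈ D ∧ y ∈ D ∧ x - y = g) then 1 else 0 := by
        intro x y
        rw [AddChar.sum_mulShift _ hψ]
        by_cases h1 : x ∈ D <;> by_cases h2 : y ∈ D <;> by_cases h3 : x - y = g <;> simp [h1, h2, h3, sub_eq_zero]
      simp_rw [this, ← Finset.mul_sum]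
      congr 1
      rw [← Fintype.sum_prod_type' (f := fun x y : F => if (x ∈ D ∧ y ∈ D ∧ x - y = g) then (1 : C) else 0)]
      rw [Finset.sum_boole]
      congr 1
      simp only [R]
      rw [Nat.card_eq_fintype_card, Fintype.card_subtype]
    have e2 : (Fintype.card F : C) * R g = ∑ a : F, S a * S (-a) * ψ (a * (-g)) := by
      rw [e1]
      simp_rw [Finset.mul_sum]
      have : ∀ a : F, S a * S (-a) * ψ (a * (-g)) = ∑ x : F, ∑ y : F,
          (if x ∈ D then 1 else 0 : C) * (if y ∈ D then 1 else 0 : C) * ψ (a * (x - y - g)) := by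
        intro a
        simp only [S]
        rw [Finset.sum_mul_sum, Finset.sum_mul]
        refine Finset.sum_congr rfl fun x _ => ?_
        rw [Finset.sum_mul]
        refine Finset.sum_congr rfl fun y _ => ?_
        rw [show a * (x - y - g) = x * a + y * (-a) + a * (-g) by ring, AddChar.map_add_eq_mul, AddChar.map_add_eq_mul]
        ring
      simp_rw [this]
      symm
      rw [Finset.sum_comm]
      refine Finset.sum_congr rfl fun x _ => ?_
      rw [Finset.sum_comm]
    have e3 : ∀ a : F, S a * S (-a) * ψ (a * (-g)) =
        (1 + Fintype.card F) / 4 * ψ (a * (-g)) + if a = 0 then (S 0 * S 0 - (1 + Fintype.card F) / 4) else 0 := by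
      intro a
      by_cases ha : a = 0
      · subst ha; simp
      · rw [hSS a ha, if_neg ha, add_zero]
    rw [e2]
    simp_rw [e3]
    rw [Finset.sum_add_distrib, ← Finset.mul_sum, AddChar.sum_mulShift _ hψ, if_neg (neg_ne_zero.mpr hg)]
    simp
  refine ⟨R 1, fun g hg => ?_⟩
  have h1 := hR g hg
  rw [← hR 1 one_ne_zero] at h1
  have h2 := mul_left_cancel₀ hcard0 h1
  exact_mod_cast h2

end D1

section D2

/-- the sign function on `ZMod (2 * p₁)` -/
noncomputable def esgn (p₁ : ℕ) [Fact p₁.Prime] (σ : ℤ) (j : ℕ) : ℤ :=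
  (-1) ^ j * ((if p₁ ∣ j then 1 else 0) + σ * quadraticChar (ZMod p₁) (j : ZMod p₁))

lemma esgn_pm (p₁ : ℕ) [Fact p₁.Prime] {σ : ℤ} (hσ : σ = 1 ∨ σ = -1) (j : ℕ) : esgn p₁ σ j = 1 ∨ esgn p₁ σ j = -1 := by
  unfold esgn
  have h1 : (if p₁ ∣ j then 1 else 0) + σ * quadraticChar (ZMod p₁) (j : ZMod p₁) = 1 ∨
    (if p₁ ∣ j then 1 else 0) + σ * quadraticChar (ZMod p₁) (j : ZMod p₁) = -1 := by
    by_cases h : p₁ ∣ j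
    · rw [if_pos h, (ZMod.natCast_eq_zero_iff j p₁).mpr h]; simp
    · rw [if_neg h, zero_add]
      rcases quadraticChar_dichotomy (F := ZMod p₁) (a := (j : ZMod p₁)) (by rwa [Ne, ZMod.natCast_eq_zero_iff]) with h2 | h2 <;>
      rcases hσ with h3 | h3 <;> rw [h2, h3] <;> simp
  rcases h1 with h1 | h1 <;> rw [h1] <;> rcases neg_one_pow_eq_or ℤ j with h2 | h2 <;> rw [h2] <;> simp

lemma esgn_add (p₁ : ℕ) [Fact p₁.Prime] (hodd : p₁ % 2 = 1) (σ : ℤ) (j : ℕ) : esgn p₁ σ (j + p₁) = - esgn p₁ σ j := by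
  unfold esgn
  rw [pow_add, Odd.neg_one_pow (Nat.odd_iff.mpr hodd)]
  simp

lemma esgn_two (p₁ : ℕ) [Fact p₁.Prime] (hodd : p₁ % 2 = 1) (σ : ℤ) (j c : ℕ) : esgn p₁ σ (j + 2 * p₁ * c) = esgn p₁ σ j := by
  induction c with
  | zero => simp
  | succ c ih =>
    rw [show j + 2 * p₁ * (c + 1) = j + 2 * p₁ * c + p₁ + p₁ by ring, esgn_add p₁ hodd, esgn_add p₁ hodd, ih, neg_neg]

lemma esgn_mod (p₁ : ℕ) [Fact p₁.Prime] (hodd : p₁ % 2 = 1) (σ : ℤ) (j : ℕ) : esgn p₁ σ (j % (2 * p₁)) = esgn p₁ σ j := by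
  conv_rhs => rw [← Nat.mod_add_div j (2 * p₁)]
  rw [esgn_two p₁ hodd]

lemma esgn_sum {C : Type*} [Field C] [CharZero C] (p₁ : ℕ) [Fact p₁.Prime] (hodd : p₁ % 2 = 1) (σ : ℤ) (u : C) :
    ∑ j ∈ Finset.range (2 * p₁), (esgn p₁ σ j : C) * u ^ j = (1 - u ^ p₁) * (1 + σ * qtau p₁ (-u)) := by
  have hp₁ : p₁.Prime := Fact.out
  rw [two_mul, Finset.sum_range_add]
  have h1 : ∑ j ∈ Finset.range p₁, (esgn p₁ σ j : C) * u ^ j = 1 + σ * qtau p₁ (-u) := by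
    have h2 : qtau p₁ (-u) = ∑ j ∈ Finset.range p₁, ((quadraticChar (ZMod p₁) (j : ZMod p₁) : ℤ) : C) * (-u) ^ j := by
      rw [← sum_zmod_range p₁ (fun j => ((quadraticChar (ZMod p₁) (j : ZMod p₁) : ℤ) : C) * (-u) ^ j)]
      simp only [qtau, ZMod.natCast_zmod_val]
    have h3 : (1 : C) = ∑ j ∈ Finset.range p₁, if j = 0 then 1 else 0 := by
      rw [Finset.sum_ite_eq' (Finset.range p₁) 0, if_pos (Finset.mem_range.mpr hp₁.pos)]
    rw [h2, Finset.mul_sum]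
    nth_rewrite 1 [h3]
    rw [← Finset.sum_add_distrib]
    refine Finset.sum_congr rfl fun j hj => ?_
    rw [Finset.mem_range] at hj
    unfold esgn
    rw [neg_pow u]
    by_cases h : j = 0
    · subst h; simp
    · have h4 : ¬ p₁ ∣ j := fun hd => by
        have := Nat.le_of_dvd (by omega) hd
        omega
      rw [if_neg h, if_neg h4]
      push_cast; ring
  have h5 : ∑ j ∈ Finset.range p₁, (esgn p₁ σ (p₁ + j) : C) * u ^ (p₁ + j) =
      - u ^ p₁ * ∑ j ∈ Finset.range p₁, (esgn p₁ σ j : C) * u ^ j := by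
    rw [Finset.mul_sum]
    refine Finset.sum_congr rfl fun j _ => ?_
    rw [add_comm p₁ j, esgn_add p₁ hodd, pow_add]
    push_cast; ring
  rw [h5, h1]; ring

lemma J_iff {p₁ p : ℕ} [Fact p₁.Prime] (hmod : p₁ % 8 = 3) (hpodd : p % 2 = 1)
    (hχp : quadraticChar (ZMod p₁) p = 1) (hχ : ∀ a : ℕ, quadraticChar (ZMod p₁) a = 1 → ∃ k, p ^ k ≡ a [MOD p₁])
    (j : ZMod (2 * p₁)) :
    j ∈ ({x : ZMod (2 * p₁) | ∃ k : ℕ, x = (p : ZMod (2 * p₁)) ^ k} ∪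
      {x : ZMod (2 * p₁) | ∃ k : ℕ, x = 2 * (p : ZMod (2 * p₁)) ^ k} ∪ {0}) ↔ esgn p₁ (-1) j.val = 1 := by
  have hp₁ : p₁.Prime := Fact.out
  have hp2 : p₁ ≠ 2 := by rintro rfl; omega
  have hodd : p₁ % 2 = 1 := by omega
  haveI : NeZero (2 * p₁) := ⟨by have := hp₁.pos; omega⟩
  have hχ2 : quadraticChar (ZMod p₁) 2 = -1 := by
    rw [quadraticChar_two (by rwa [ZMod.ringChar_zmod_n]), ZMod.card, ZMod.χ₈_nat_mod_eight, hmod]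
    rfl
  have hndvd : ∀ k : ℕ, quadraticChar (ZMod p₁) (k : ZMod p₁) ≠ 0 → ¬ p₁ ∣ k := by
    intro k hk hd
    rw [(ZMod.natCast_eq_zero_iff k p₁).mpr hd] at hk
    simp at hk
  constructor
  · rintro ((⟨k, hk⟩ | ⟨k, hk⟩) | hj)
    · have : j = ((p ^ k : ℕ) : ZMod (2 * p₁)) := by rw [hk]; push_cast; rfl
      rw [this, ZMod.val_natCast, esgn_mod p₁ hodd]
      have hc : quadraticChar (ZMod p₁) ((p ^ k : ℕ) : ZMod p₁) = 1 := by
        push_cast; rw [map_pow, hχp, one_pow]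
      unfold esgn
      rw [hc, if_neg (hndvd _ (by rw [hc]; norm_num)), Odd.neg_one_pow (Odd.pow (Nat.odd_iff.mpr hpodd))]
      rfl
    · have : j = ((2 * p ^ k : ℕ) : ZMod (2 * p₁)) := by rw [hk]; push_cast; rfl
      rw [this, ZMod.val_natCast, esgn_mod p₁ hodd]
      have hc : quadraticChar (ZMod p₁) ((2 * p ^ k : ℕ) : ZMod p₁) = -1 := by
        push_cast; rw [map_mul, map_pow, hχp, one_pow, hχ2]; rfl
      unfold esgn
      rw [hc, if_neg (hndvd _ (by rw [hc]; norm_num)), pow_mul]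
      simp
    · rw [Set.mem_singleton_iff] at hj
      rw [hj]
      simp [esgn]
  · intro h
    have hjv : ((j.val : ℕ) : ZMod (2 * p₁)) = j := ZMod.natCast_zmod_val j
    have hlt := ZMod.val_lt j
    set v := j.val with hv
    unfold esgn at h
    have hco : Nat.Coprime 2 p₁ := Nat.coprime_two_left.mpr (Nat.odd_iff.mpr hodd)
    by_cases hd : p₁ ∣ v
    · rw [if_pos hd, (ZMod.natCast_eq_zero_iff v p₁).mpr hd] at h
      simp only [MulChar.map_zero, mul_zero, add_zero, mul_one] at h
      have he : Even v := by
        by_contra ho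
        rw [Nat.not_even_iff_odd] at ho
        rw [ho.neg_one_pow] at h
        norm_num at h
      have : 2 * p₁ ∣ v := hco.mul_dvd_of_dvd_of_dvd he.two_dvd hd
      have : v = 0 := Nat.eq_zero_of_dvd_of_lt this hlt
      right
      rw [Set.mem_singleton_iff, ← hjv, this]; simp
    · rw [if_neg hd, zero_add] at h
      left
      rcases Nat.even_or_odd v with he | ho
      · right
        rw [he.neg_one_pow, one_mul] at h
        obtain ⟨w, hw⟩ := he
        have hw2 : v = 2 * w := by omega
        have hc : quadraticChar (ZMod p₁) (w : ZMod p₁) = 1 := by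
          rw [hw2] at h
          push_cast at h
          rw [map_mul, hχ2] at h
          linarith
        obtain ⟨k, hk⟩ := hχ w hc
        refine ⟨k, ?_⟩
        rw [← hjv, hw2]
        have := (hk.mul_left' 2)
        have := (ZMod.natCast_eq_natCast_iff _ _ _).mpr this
        rw [← this]; push_cast; rfl
      · left
        rw [ho.neg_one_pow] at h
        have hc : quadraticChar (ZMod p₁) (v : ZMod p₁) = 1 := by linarith
        obtain ⟨k, hk⟩ := hχ v hc
        refine ⟨k, ?_⟩
        have h2 : p ^ k ≡ v [MOD 2] := by
          have : p ^ k % 2 = 1 := Nat.odd_iff.mp (Odd.pow (Nat.odd_iff.mpr hpodd))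
          have := Nat.odd_iff.mp ho
          unfold Nat.ModEq; omega
        have := (Nat.modEq_and_modEq_iff_modEq_mul hco).mp ⟨h2, hk⟩
        have := (ZMod.natCast_eq_natCast_iff _ _ _).mpr this
        rw [← hjv, ← this]; push_cast; rfl

lemma B_bij {p₁ M : ℕ} [Fact p₁.Prime] (hM : M % 2 = 1) [NeZero (2 * (M * p₁))] [NeZero (2 * p₁)] :
    Function.Bijective (fun x : Fin M × ZMod (2 * p₁) => ((2 * (x.1 : ℕ) + M * x.2.val : ℕ) : ZMod (2 * (M * p₁)))) := by
  rw [Fintype.bijective_iff_injective_and_card]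
  constructor
  · rintro ⟨i, j⟩ ⟨i', j'⟩ h
    simp only at h
    rw [ZMod.natCast_eq_natCast_iff] at h
    have h1 : 2 * (i : ℕ) ≡ 2 * (i' : ℕ) [MOD M] := by
      have h2 : 2 * (i : ℕ) + M * j.val ≡ 2 * (i' : ℕ) + M * j'.val [MOD M] := h.of_dvd ⟨2 * p₁, by ring⟩
      unfold Nat.ModEq at h2 ⊢
      rwa [Nat.add_mul_mod_self_left, Nat.add_mul_mod_self_left] at h2
    have h3 : (i : ℕ) ≡ (i' : ℕ) [MOD M] :=
      Nat.ModEq.cancel_left_of_coprime (by rw [← Nat.coprime_iff_gcd_eq_one]; exact Nat.coprime_two_right.mpr (Nat.odd_iff.mpr hM)) h1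
    have h4 : i = i' := by
      apply Fin.ext
      unfold Nat.ModEq at h3
      rwa [Nat.mod_eq_of_lt i.2, Nat.mod_eq_of_lt i'.2] at h3
    subst h4
    have h5 : M * j.val ≡ M * j'.val [MOD (M * (2 * p₁))] := by
      have h6 := Nat.ModEq.add_left_cancel' _ h
      rwa [show M * (2 * p₁) = 2 * (M * p₁) by ring]
    have h6 := Nat.ModEq.mul_left_cancel' (by omega) h5
    have h7 : j = j' := by
      have := (ZMod.natCast_eq_natCast_iff _ _ _).mpr h6
      rwa [ZMod.natCast_zmod_val, ZMod.natCast_zmod_val] at this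
    rw [h7]
  · rw [Fintype.card_prod, Fintype.card_fin, ZMod.card, ZMod.card]; ring

end D2

section D3

/-- the parametrization of `ZMod N` by pairs `(i, j)` -/
noncomputable def Beq (p₁ M : ℕ) [Fact p₁.Prime] (hM : M % 2 = 1) [NeZero (2 * (M * p₁))] [NeZero (2 * p₁)] :
    Fin M × ZMod (2 * p₁) ≃ ZMod (2 * (M * p₁)) := Equiv.ofBijective _ (B_bij hM)

/-- the `±1`-valued function on `ZMod N` -/
noncomputable def delt (p₁ M : ℕ) [Fact p₁.Prime] (hM : M % 2 = 1) [NeZero (2 * (M * p₁))] [NeZero (2 * p₁)]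
    (σ : ℤ) (κ : ZMod (2 * (M * p₁))) : ℤ := esgn p₁ σ ((Beq p₁ M hM).symm κ).2.val

variable {C : Type*} [Field C] [CharZero C] {p₁ M : ℕ} [Fact p₁.Prime] (hM : M % 2 = 1) [NeZero (2 * (M * p₁))] [NeZero (2 * p₁)]

/-- the finite Fourier transform of `delt` -/
noncomputable def dhat (W : C) (σ : ℤ) (t : ℕ) : C :=
  ∑ κ : ZMod (2 * (M * p₁)), (delt p₁ M hM σ κ : C) * (W⁻¹ ^ t) ^ κ.val

lemma Beq_apply (i : Fin M) (j : ZMod (2 * p₁)) :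
    Beq p₁ M hM (i, j) = ((2 * (i : ℕ) + M * j.val : ℕ) : ZMod (2 * (M * p₁))) := rfl

lemma delt_Beq (σ : ℤ) (i : Fin M) (j : ZMod (2 * p₁)) : delt p₁ M hM σ (Beq p₁ M hM (i, j)) = esgn p₁ σ j.val := by
  unfold delt; rw [Equiv.symm_apply_apply]

lemma dhat_eq (hodd : p₁ % 2 = 1) {W : C} (hW : IsPrimitiveRoot W (2 * (M * p₁))) (σ : ℤ) (t : ℕ) :
    dhat (p₁ := p₁) hM W σ t = (∑ i ∈ Finset.range M, ((W⁻¹ ^ t) ^ 2) ^ i) *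
      ((1 - ((W⁻¹ ^ t) ^ M) ^ p₁) * (1 + σ * qtau p₁ (-((W⁻¹ ^ t) ^ M)))) := by
  unfold dhat
  rw [← (Beq p₁ M hM).sum_comp, ← esgn_sum p₁ hodd, Fintype.sum_prod_type, ← Fin.sum_univ_eq_sum_range (fun i => ((W⁻¹ ^ t) ^ 2) ^ i),
    Finset.sum_mul]
  refine Finset.sum_congr rfl fun i _ => ?_
  rw [← sum_zmod_range (2 * p₁) (fun j => (esgn p₁ σ j : C) * ((W⁻¹ ^ t) ^ M) ^ j), Finset.mul_sum]
  refine Finset.sum_congr rfl fun j _ => ?_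
  have hv : (W⁻¹ ^ t) ^ (2 * (M * p₁)) = 1 := by
    rw [← pow_mul, mul_comm, pow_mul, inv_pow, hW.pow_eq_one, inv_one, one_pow]
  rw [delt_Beq, Beq_apply, rootpow_val hv, pow_add, pow_mul, pow_mul]
  ring

lemma dhat_rel (hodd : p₁ % 2 = 1) {W : C} (hW : IsPrimitiveRoot W (2 * (M * p₁))) (Gs : ℕ → C) (s : C)
    (h1 : ∀ t : ℕ, t % 2 = 1 → M * p₁ ∣ t → Gs t = s)
    (h2 : ∀ t : ℕ, t % 2 = 1 → ¬ p₁ ∣ t → Gs t * (1 - qtau p₁ ((-W⁻¹ ^ M) ^ t)) = s * (1 + qtau p₁ ((-W⁻¹ ^ M) ^ t)))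
    (t : ℕ) : dhat (p₁ := p₁) hM W (-1) t * Gs t = s * dhat (p₁ := p₁) hM W 1 t := by
  have hp₁ : p₁.Prime := Fact.out
  have hW0 : W ≠ 0 := hW.ne_zero (NeZero.ne _)
  have hWi : IsPrimitiveRoot W⁻¹ (2 * (M * p₁)) := hW.inv
  rw [dhat_eq hM hodd hW, dhat_eq hM hodd hW]
  set V := W⁻¹ with hV
  rcases Nat.even_or_odd t with he | ho
  · obtain ⟨w, hw⟩ := he
    have : ((V ^ t) ^ M) ^ p₁ = 1 := by
      rw [← pow_mul, ← pow_mul, hw, show (w + w) * (M * p₁) = 2 * (M * p₁) * w by ring, pow_mul, hWi.pow_eq_one, one_pow]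
    rw [this]; ring
  · have ht := Nat.odd_iff.mp ho
    have hz : -((V ^ t) ^ M) = (-V ^ M) ^ t := by
      rw [ho.neg_pow, ← pow_mul, ← pow_mul, mul_comm]
    by_cases hp : p₁ ∣ t
    · by_cases hn : M * p₁ ∣ t
      · rw [h1 t ht hn]
        obtain ⟨c, hc⟩ := hp
        have hq : qtau p₁ (-((V ^ t) ^ M)) = 0 := by
          have hVn : V ^ (M * p₁) = -1 := by
            have e1 : (V ^ (M * p₁)) ^ 2 = 1 := by rw [← pow_mul, mul_comm, hWi.pow_eq_one]
            rcases eq_or_eq_neg_of_sq_eq_sq (V ^ (M * p₁)) 1 (by rw [e1, one_pow]) with e2 | e2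
            · exfalso
              have hpos : 0 < M * p₁ := Nat.mul_pos (by omega) hp₁.pos
              have := Nat.le_of_dvd hpos (hWi.dvd_of_pow_eq_one _ e2)
              omega
            · exact e2
          have : (V ^ t) ^ M = -1 := by
            rw [← pow_mul, hc, show p₁ * c * M = M * p₁ * c by ring, pow_mul, hVn]
            apply Odd.neg_one_pow
            rw [hc] at ho
            exact (Nat.odd_mul.mp ho).2
          rw [this, neg_neg]
          simp only [qtau, one_pow, mul_one]
          rw [← Int.cast_sum, quadraticChar_sum_zero (by rw [ZMod.ringChar_zmod_n]; rintro rfl; omega), Int.cast_zero]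
        rw [hq]; ring
      · have h0 : ∑ i ∈ Finset.range M, ((V ^ t) ^ 2) ^ i = 0 := by
          have h3 := geom_sum_mul ((V ^ t) ^ 2) M
          obtain ⟨c, hc⟩ := hp
          have h4 : ((V ^ t) ^ 2) ^ M = 1 := by
            rw [← pow_mul, ← pow_mul, hc, show p₁ * c * (2 * M) = 2 * (M * p₁) * c by ring, pow_mul, hWi.pow_eq_one, one_pow]
          rw [h4, sub_self] at h3
          rcases mul_eq_zero.mp h3 with h5 | h5
          · exact h5
          · exfalso
            apply hn
            have h6 : V ^ (2 * t) = 1 := by rw [mul_comm, pow_mul]; exact sub_eq_zero.mp h5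
            exact Nat.dvd_of_mul_dvd_mul_left (by norm_num) (hWi.dvd_of_pow_eq_one _ h6)
        rw [h0]; ring
    · have h3 := h2 t ht hp
      rw [← hz] at h3
      push_cast
      linear_combination (∑ i ∈ Finset.range M, ((V ^ t) ^ 2) ^ i) * (1 - ((V ^ t) ^ M) ^ p₁) * h3

lemma dhat_inv {W : C} (hW : IsPrimitiveRoot W (2 * (M * p₁))) (σ : ℤ) (k : ℕ) :
    ∑ t ∈ Finset.range (2 * (M * p₁)), dhat (p₁ := p₁) hM W σ t * (W ^ k) ^ t =
      ((2 * (M * p₁) : ℕ) : C) * (delt p₁ M hM σ (k : ZMod (2 * (M * p₁))) : C) := by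
  have hW0 : W ≠ 0 := hW.ne_zero (NeZero.ne _)
  unfold dhat
  simp_rw [Finset.sum_mul]
  rw [Finset.sum_comm, Finset.sum_eq_single (k : ZMod (2 * (M * p₁)))]
  · rw [Finset.sum_congr rfl (g := fun _ => (delt p₁ M hM σ (k : ZMod (2 * (M * p₁))) : C))]
    · rw [Finset.sum_const, Finset.card_range, nsmul_eq_mul]
    · intro t _
      have : (W⁻¹ ^ t) ^ ((k : ZMod (2 * (M * p₁))).val) * (W ^ k) ^ t = 1 := by
        rw [rootpow_val]
        · rw [← pow_mul, ← pow_mul, mul_comm k t, ← mul_pow, inv_mul_cancel₀ hW0, one_pow]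
        · rw [← pow_mul, mul_comm, pow_mul, inv_pow, hW.pow_eq_one, inv_one, one_pow]
      rw [mul_assoc, this, mul_one]
  · intro κ _ hκ
    have h1 : ∀ t : ℕ, (delt p₁ M hM σ κ : C) * (W⁻¹ ^ t) ^ κ.val * (W ^ k) ^ t = (delt p₁ M hM σ κ : C) * (W⁻¹ ^ κ.val * W ^ k) ^ t := by
      intro t
      rw [mul_pow, pow_right_comm W⁻¹ t, mul_assoc]
    simp_rw [h1]
    rw [← Finset.mul_sum]
    set r := W⁻¹ ^ κ.val * W ^ k with hr
    have h3 := geom_sum_mul r (2 * (M * p₁))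
    have h4 : r ^ (2 * (M * p₁)) = 1 := by
      rw [hr, mul_pow, ← pow_mul, ← pow_mul, mul_comm κ.val, mul_comm k, pow_mul, pow_mul W, inv_pow, hW.pow_eq_one]; simp
    rw [h4, sub_self] at h3
    rcases mul_eq_zero.mp h3 with h5 | h5
    · rw [h5, mul_zero]
    · exfalso
      apply hκ
      have h6 : W ^ k = W ^ κ.val := by
        have h7 : r = 1 := sub_eq_zero.mp h5
        rw [hr, inv_pow] at h7
        field_simp at h7
        exact h7
      have h8 : k ≡ κ.val [MOD (2 * (M * p₁))] := by
        rw [pow_eq_pow_mod k hW.pow_eq_one] at h6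
        have h9 := hW.pow_inj (Nat.mod_lt _ (NeZero.pos _)) (ZMod.val_lt κ) h6
        unfold Nat.ModEq
        rw [h9, Nat.mod_eq_of_lt (ZMod.val_lt κ)]
      have := (ZMod.natCast_eq_natCast_iff _ _ _).mpr h8
      rw [this, ZMod.natCast_zmod_val]
  · intro h; exact absurd (Finset.mem_univ _) h

end D3

section D4
variable {C : Type*} [Field C] [CharZero C] {F : Type*} [Field F] [Fintype F]

lemma delt_pm {p₁ M : ℕ} [Fact p₁.Prime] (hM : M % 2 = 1) [NeZero (2 * (M * p₁))] [NeZero (2 * p₁)] {σ : ℤ}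
    (hσ : σ = 1 ∨ σ = -1) (κ : ZMod (2 * (M * p₁))) : delt p₁ M hM σ κ = 1 ∨ delt p₁ M hM σ κ = -1 :=
  esgn_pm p₁ hσ _

lemma delt_add {p₁ M : ℕ} [Fact p₁.Prime] (hM : M % 2 = 1) (hodd : p₁ % 2 = 1) [NeZero (2 * (M * p₁))] [NeZero (2 * p₁)] (σ : ℤ)
    (κ : ZMod (2 * (M * p₁))) : delt p₁ M hM σ (κ + ((M * p₁ : ℕ) : ZMod (2 * (M * p₁)))) = - delt p₁ M hM σ κ := by
  obtain ⟨⟨i, j⟩, rfl⟩ := (Beq p₁ M hM).surjective κ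
  have h1 : Beq p₁ M hM (i, j) + ((M * p₁ : ℕ) : ZMod (2 * (M * p₁))) = Beq p₁ M hM (i, j + (p₁ : ZMod (2 * p₁))) := by
    rw [Beq_apply, Beq_apply, ← Nat.cast_add, ZMod.natCast_eq_natCast_iff]
    have h2 : (j + (p₁ : ZMod (2 * p₁))).val ≡ j.val + p₁ [MOD (2 * p₁)] := by
      rw [← ZMod.natCast_eq_natCast_iff]
      push_cast
      rw [ZMod.natCast_zmod_val, ZMod.natCast_zmod_val]
    have h3 := h2.mul_left' M
    rw [show M * (2 * p₁) = 2 * (M * p₁) by ring] at h3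
    have h4 := (h3.add_left (2 * (i : ℕ))).symm
    rwa [show 2 * (i : ℕ) + M * (j.val + p₁) = 2 * (i : ℕ) + M * j.val + M * p₁ by ring] at h4
  rw [h1, delt_Beq, delt_Beq]
  have h5 : (j + (p₁ : ZMod (2 * p₁))).val = (j.val + p₁) % (2 * p₁) := by
    rw [← ZMod.val_natCast]
    push_cast
    rw [ZMod.natCast_zmod_val]
  rw [h5, esgn_mod p₁ hodd, esgn_add p₁ hodd]

theorem final_skew {p₁ M : ℕ} [Fact p₁.Prime] (hM : M % 2 = 1) (hodd : p₁ % 2 = 1) [NeZero (2 * (M * p₁))] [NeZero (2 * p₁)]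
    (hF : Fintype.card F % 4 = 3) {ψ : AddChar F C} (hψ : ψ.IsPrimitive)
    {γ : Fˣ} (hγ : ∀ x : Fˣ, x ∈ Subgroup.zpowers γ) {X : MulChar F C} {s : C}
    (hW : IsPrimitiveRoot (X γ) (2 * (M * p₁))) (hs2 : s ^ 2 = -(Fintype.card F : C))
    (h1 : ∀ t : ℕ, t % 2 = 1 → M * p₁ ∣ t → gaussSum (X ^ t) ψ = s)
    (h2 : ∀ t : ℕ, t % 2 = 1 → ¬ p₁ ∣ t → gaussSum (X ^ t) ψ * (1 - qtau p₁ ((-(X γ)⁻¹ ^ M) ^ t)) =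
        s * (1 + qtau p₁ ((-(X γ)⁻¹ ^ M) ^ t)))
    (J : Set (ZMod (2 * p₁))) (hJ : ∀ j, j ∈ J ↔ esgn p₁ (-1) j.val = 1) :
    IsSkewHadamardDifferenceSet (⋃ i < M, ⋃ j ∈ J, cycClass γ (2 * (M * p₁)) (2 * i + M * ZMod.val j)) := by
  set N := 2 * (M * p₁) with hN
  set D : Set F := (⋃ i < M, ⋃ j ∈ J, cycClass γ N (2 * i + M * ZMod.val j)) with hD
  have hXpow : ∀ k : ℕ, X ((γ ^ k : Fˣ) : F) = X γ ^ k := by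
    intro k; rw [Units.val_pow_eq_pow_val, map_pow]
  have hNo : N ∣ orderOf γ := by
    apply hW.dvd_of_pow_eq_one
    rw [← hXpow, pow_orderOf_eq_one, Units.val_one, map_one]
  have ho : orderOf γ = Fintype.card F - 1 := by
    rw [orderOf_eq_card_of_forall_mem_zpowers hγ, Nat.card_eq_fintype_card, Fintype.card_units]
  have hnat : ∀ x : F, x ≠ 0 → ∃ k : ℕ, x = ((γ ^ k : Fˣ) : F) := by
    intro x hx
    obtain ⟨u, rfl⟩ := isUnit_iff_ne_zero.mpr hx
    obtain ⟨k, hk⟩ := mem_powers_iff_mem_zpowers.mpr (hγ u)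
    exact ⟨k, by rw [← hk]⟩
  have hmem : ∀ k : ℕ, (((γ ^ k : Fˣ) : F) ∈ D ↔ delt p₁ M hM (-1) (k : ZMod (2 * (M * p₁))) = 1) := by
    intro k
    simp only [hD, Set.mem_iUnion, cycClass, Set.mem_setOf_eq, exists_prop]
    constructor
    · rintro ⟨i, hi, j, hj, c, hc⟩
      have e1 : γ ^ (k : ℤ) = γ ^ (((2 * i + M * j.val : ℕ) : ℤ) + (N : ℤ) * c) := by
        apply Units.ext; rw [zpow_natCast]; exact hc
      rw [zpow_eq_zpow_iff_modEq] at e1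
      have e2 : (k : ℤ) ≡ ((2 * i + M * j.val : ℕ) : ℤ) + (N : ℤ) * c [ZMOD N] := e1.of_dvd (by exact_mod_cast hNo)
      have e3 := (ZMod.intCast_eq_intCast_iff _ _ _).mpr e2
      have e4 : (k : ZMod N) = ((2 * i + M * j.val : ℕ) : ZMod N) := by
        push_cast at e3 ⊢
        rw [e3]; simp
      have e5 : (k : ZMod N) = Beq p₁ M hM (⟨i, hi⟩, j) := e4
      change delt p₁ M hM (-1) (k : ZMod N) = 1
      rw [e5, delt_Beq]
      exact (hJ j).mp hj
    · intro h
      obtain ⟨⟨i, j⟩, hij⟩ := (Beq p₁ M hM).surjective (k : ZMod (2 * (M * p₁)))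
      rw [← hij, delt_Beq] at h
      refine ⟨i, i.2, j, (hJ j).mpr h, ?_⟩
      rw [Beq_apply] at hij
      have e1 : (((2 * (i : ℕ) + M * j.val : ℕ) : ℤ) : ZMod N) = ((k : ℤ) : ZMod N) := by
        rw [Int.cast_natCast, Int.cast_natCast]; exact hij
      rw [ZMod.intCast_eq_intCast_iff] at e1
      obtain ⟨c, hc⟩ := e1.dvd
      refine ⟨c, ?_⟩
      rw [← hc, add_sub_cancel, zpow_natCast]
  have hneg1 : ((γ ^ (orderOf γ / 2) : Fˣ) : F) = -1 := by
    have e1 : (((γ ^ (orderOf γ / 2) : Fˣ) : F)) ^ 2 = 1 ^ 2 := by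
      rw [← Units.val_pow_eq_pow_val, ← pow_mul, show orderOf γ / 2 * 2 = orderOf γ by omega, pow_orderOf_eq_one]; simp
    rcases eq_or_eq_neg_of_sq_eq_sq _ _ e1 with e2 | e2
    · exfalso
      have e3 : γ ^ (orderOf γ / 2) = 1 := Units.ext e2
      have := Nat.le_of_dvd (by omega) (orderOf_dvd_of_pow_eq_one e3)
      omega
    · exact e2
  have hhalf : ((orderOf γ / 2 : ℕ) : ZMod (2 * (M * p₁))) = ((M * p₁ : ℕ) : ZMod (2 * (M * p₁))) := by
    obtain ⟨c, hc⟩ := hNo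
    have e1 : orderOf γ / 2 = M * p₁ * c := by
      rw [hc, hN, mul_assoc, Nat.mul_div_cancel_left _ (by norm_num)]
    have e2 : c % 2 = 1 := by
      have : (M * p₁ * c) % 2 = 1 := by omega
      rcases Nat.mod_two_eq_zero_or_one c with h | h
      · rw [Nat.mul_mod, h] at this; simp at this
      · exact h
    obtain ⟨d, hd⟩ : ∃ d, c = 2 * d + 1 := ⟨c / 2, by omega⟩
    rw [e1, hd, show M * p₁ * (2 * d + 1) = 2 * (M * p₁) * d + M * p₁ by ring, Nat.cast_add, Nat.cast_mul (2 * (M * p₁)) d,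
      ZMod.natCast_self, zero_mul, zero_add]
  have hmemneg : ∀ k : ℕ, (-((γ ^ k : Fˣ) : F) ∈ D ↔ delt p₁ M hM (-1) (k : ZMod (2 * (M * p₁))) = -1) := by
    intro k
    have e1 : -((γ ^ k : Fˣ) : F) = ((γ ^ (k + orderOf γ / 2) : Fˣ) : F) := by
      rw [pow_add, Units.val_mul, hneg1]; ring
    rw [e1, hmem, Nat.cast_add, hhalf, delt_add hM hodd, neg_eq_iff_eq_neg]
  have h0 : (0 : F) ∉ D := by
    intro h
    simp only [hD, Set.mem_iUnion, cycClass, Set.mem_setOf_eq, exists_prop] at h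
    obtain ⟨i, hi, j, hj, c, hc⟩ := h
    exact Units.ne_zero _ hc.symm
  have hsk : ∀ g : F, g ≠ 0 → (g ∈ D ↔ -g ∉ D) := by
    intro g hg
    obtain ⟨k, rfl⟩ := hnat g hg
    rw [hmem, hmemneg]
    rcases delt_pm hM (Or.inr rfl : (-1 : ℤ) = 1 ∨ (-1 : ℤ) = -1) (k : ZMod (2 * (M * p₁))) with h | h <;> rw [h] <;> norm_num
  apply skew_of_sum hψ D h0 hsk
  intro a ha
  have hN0 : (N : C) ≠ 0 := by exact_mod_cast NeZero.ne N
  have hd : ∀ x : F, (N : C) * ((if x ∈ D then 1 else 0) - (if -x ∈ D then 1 else 0) : C) =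
      ∑ t ∈ Finset.range N, dhat (p₁ := p₁) hM (X γ) (-1) t * (X ^ t) x := by
    intro x
    by_cases hx : x = 0
    · subst hx
      rw [Finset.sum_eq_zero (fun t _ => by rw [MulChar.map_zero, mul_zero])]
      simp [h0]
    · obtain ⟨k, rfl⟩ := hnat x hx
      have e1 : ∀ t : ℕ, (X ^ t) ((γ ^ k : Fˣ) : F) = (X γ ^ k) ^ t := by
        intro t; rw [MulChar.pow_apply_coe, hXpow]
      simp_rw [e1]
      have e2 := dhat_inv (p₁ := p₁) hM hW (-1) k
      rw [e2, hmem, hmemneg]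
      congr 1
      rcases delt_pm hM (Or.inr rfl : (-1 : ℤ) = 1 ∨ (-1 : ℤ) = -1) (k : ZMod (2 * (M * p₁))) with h | h <;> rw [h] <;> norm_num
  obtain ⟨l, hl⟩ := hnat a⁻¹ (inv_ne_zero ha)
  have hT : (N : C) * ∑ x : F, ((if x ∈ D then 1 else 0) - (if -x ∈ D then 1 else 0) : C) * ψ (x * a) =
      (N : C) * (s * (delt p₁ M hM 1 (l : ZMod (2 * (M * p₁))) : C)) := by
    rw [Finset.mul_sum]
    simp_rw [← mul_assoc, hd, Finset.sum_mul]
    rw [Finset.sum_comm]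
    have e3 := dhat_inv (p₁ := p₁) hM hW 1 l
    rw [mul_comm (N : C) s, mul_assoc, ← e3, Finset.mul_sum]
    refine Finset.sum_congr rfl fun t _ => ?_
    have e4 : ∑ x : F, (X ^ t) x * ψ (x * a) = (X γ ^ l) ^ t * gaussSum (X ^ t) ψ := by
      have e5 := gaussSum_mulShift (X ^ t) ψ (Units.mk0 a ha)
      have e6 : (X γ ^ l) ^ t = (X ^ t) a⁻¹ := by rw [hl, MulChar.pow_apply_coe, hXpow]
      rw [e6, ← e5, ← mul_assoc, ← map_mul, Units.val_mk0, inv_mul_cancel₀ ha, map_one, one_mul]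
      unfold gaussSum
      refine Finset.sum_congr rfl fun x _ => ?_
      rw [AddChar.mulShift_apply, mul_comm x a]
    simp_rw [mul_assoc]
    rw [← Finset.mul_sum, e4]
    have e7 := dhat_rel hM hodd hW (fun t => gaussSum (X ^ t) ψ) s h1 h2 t
    linear_combination (X γ ^ l) ^ t * e7
  have hT' := mul_left_cancel₀ hN0 hT
  rw [hT', mul_pow, hs2]
  rcases delt_pm hM (Or.inl rfl : (1 : ℤ) = 1 ∨ (1 : ℤ) = -1) (l : ZMod (2 * (M * p₁))) with h | h <;> rw [h] <;> norm_num

end D4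

end Helpers

/-- Corollary 3.5 of the paper, the case `p ≡ 3 (mod 4)`. -/
theorem statement_16 (p₁ m : ℕ) (hp₁ : p₁.Prime) (hp₁mod : p₁ % 8 = 3) (hp₁ne : p₁ ≠ 3)
    (hm : 1 ≤ m) (N : ℕ) (hN : N = 2 * p₁ ^ m)
    -- `h` is the class number of `ℚ(√-p₁)`
    (K : Type*) [Field K] [NumberField K] (α : K)
    (hα : α ^ 2 = -(p₁ : K)) (hKα : Algebra.adjoin ℚ {α} = ⊤)
    (h : ℕ) (hh : h = NumberField.classNumber K)
    (p : ℕ) (hp : p.Prime) (hpmod : p % 4 = 3) (hcl : 1 + p₁ = 4 * p ^ h)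
    (f : ℕ) (hf : f = orderOf ((p : ZMod N))) (hford : 2 * f = Nat.totient N)
    (F : Type*) [Field F] [Fintype F] (hcard : Fintype.card F = p ^ f)
    -- `J = ⟨p⟩ ∪ 2⟨p⟩ ∪ {0} ⊆ Z_{2p₁}`
    (J : Set (ZMod (2 * p₁)))
    (hJ : J = {x : ZMod (2 * p₁) | ∃ k : ℕ, x = (p : ZMod (2 * p₁)) ^ k} ∪
      {x : ZMod (2 * p₁) | ∃ k : ℕ, x = 2 * (p : ZMod (2 * p₁)) ^ k} ∪ {0}) :
    ∃ γ : Fˣ, (∀ x : Fˣ, x ∈ Subgroup.zpowers γ) ∧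
      IsSkewHadamardDifferenceSet
        (⋃ i < p₁ ^ (m - 1), ⋃ j ∈ J,
          cycClass γ N (2 * i + p₁ ^ (m - 1) * ZMod.val j)) := by
  haveI : Fact p₁.Prime := ⟨hp₁⟩
  haveI : Fact p.Prime := ⟨hp⟩
  subst hN
  have hcb := class_number_bound hp₁ hp₁mod hα hKα
  rw [← hh] at hcb
  have hh1 : 1 ≤ h := by
    rw [hh]; exact Nat.one_le_iff_ne_zero.mpr (NumberField.classNumber_ne_zero K)
  obtain ⟨hf1, hfodd, hford'⟩ := C1_f hp₁ hp₁mod hm hford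
  obtain ⟨hcop, hpodd, hord⟩ := C1_ord hp₁ hp₁mod hm hp hf hford
  obtain ⟨hχp, hχ⟩ := C1_char hp₁mod hm hcop hord hfodd hford'
  haveI : CharP F p := by
    obtain ⟨r, hr⟩ := CharP.exists F
    haveI := hr
    obtain ⟨k, hrp, hk⟩ := FiniteField.card F r
    have h1 : r ∣ p ^ f := by rw [← hcard, hk]; exact dvd_pow_self r k.ne_zero
    have h2 := (Nat.prime_dvd_prime_iff_eq hrp hp).mp (hrp.dvd_of_dvd_pow h1)
    rw [← h2]; exact hr
  letI : Algebra (ZMod p) F := ZMod.algebra F p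
  haveI : IsUltrametricDist (PadicAlgCl p) := PadicAlgCl.isUltrametricDist p
  have hpn : ‖(p : PadicAlgCl p)‖ = (p : ℝ)⁻¹ := by
    have h1 := PadicAlgCl.norm_extends p (p : ℚ_[p])
    rw [← Padic.norm_p, ← h1]
    congr 1
  haveI : NeZero ((p : ℕ) : PadicAlgCl p) := ⟨by exact_mod_cast hp.ne_zero⟩
  obtain ⟨ζ, hζ⟩ := HasEnoughRootsOfUnity.exists_primitiveRoot (PadicAlgCl p) p
  obtain ⟨γ, X, s, hγ, hW, -, hs2, hr1, hr2⟩ := gauss_all (F := F) hpn hp₁mod hm hpmod hh1 hcl hcop hord hfodd hford' hcb hcard hζ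
  refine ⟨γ, hγ, ?_⟩
  have hodd : p₁ % 2 = 1 := by omega
  have hM : p₁ ^ (m - 1) % 2 = 1 := Nat.odd_iff.mp (Odd.pow (Nat.odd_iff.mpr hodd))
  have hMn : p₁ ^ m = p₁ ^ (m - 1) * p₁ := by rw [← pow_succ, Nat.sub_add_cancel hm]
  have hF : Fintype.card F % 4 = 3 := by
    rw [hcard]
    obtain ⟨k, hk⟩ : ∃ k, f = 2 * k + 1 := ⟨f / 2, by omega⟩
    rw [hk, pow_succ, pow_mul, Nat.mul_mod, Nat.pow_mod]
    have : p ^ 2 % 4 = 1 := by rw [Nat.pow_mod, hpmod]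
    rw [this, hpmod, one_pow]
    rfl
  have hJ' : ∀ j, j ∈ J ↔ esgn p₁ (-1) j.val = 1 := by
    intro j
    rw [hJ]
    refine J_iff hp₁mod hpodd hχp ?_ j
    intro a ha
    obtain ⟨k, hk⟩ := hχ a ha
    exact ⟨k, hk.of_dvd (dvd_pow_self _ (by omega))⟩
  rw [hMn] at hW hr1 ⊢
  haveI : NeZero (2 * (p₁ ^ (m - 1) * p₁)) := ⟨by have := hp₁.pos; positivity⟩
  haveI : NeZero (2 * p₁) := ⟨by have := hp₁.pos; positivity⟩
  exact final_skew hM hodd hF (trChar_prim (F := F) hζ) hγ hW hs2 hr1 hr2 J hJ'
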